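/- Let ℓ be a prime. The only solutions in integers x ≥ 1, y to the equation (x+1)³ + (x+2)³ + ⋯ + (x+25)³ = yˡ are (x, y, ℓ) = (15587, ±9742200, 2) and (5, 60, 3), the latter being 6³ + 7³ + ⋯ + 30³ = 60³. -/

import Mathlib

namespace CubeSum

open Polynomial

/-- The Euler operator `f ↦ X f'` on real polynomials. -/
noncomputable def euler : ℝ[X] →ₗ[ℝ] ℝ[X] :=
  LinearMap.mulLeft ℝ (X : ℝ[X]) ∘ₗ (derivative : ℝ[X] →ₗ[ℝ] ℝ[X])

lemma euler_apply (f : ℝ[X]) : euler f = X * derivative f := rfl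

lemma coeff_euler_pow (j : ℕ) (f : ℝ[X]) (n : ℕ) :
    ((euler ^ j) f).coeff n = (n : ℝ) ^ j * f.coeff n := by
  induction j generalizing n with
  | zero => simp
  | succ j ih =>
    rw [pow_succ', Module.End.mul_apply, euler_apply]
    cases n with
    | zero => simp
    | succ n =>
      rw [coeff_X_mul, coeff_derivative, ih]
      push_cast
      ring

lemma natDegree_euler_pow_le (j : ℕ) (f : ℝ[X]) :
    ((euler ^ j) f).natDegree ≤ f.natDegree := by
  rw [natDegree_le_iff_coeff_eq_zero]
  intro n hn
  rw [coeff_euler_pow, coeff_eq_zero_of_natDegree_lt hn, mul_zero]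

lemma X_pow_dvd_euler_pow {e : ℕ} (j : ℕ) {f : ℝ[X]} (h : X ^ e ∣ f) :
    X ^ e ∣ (euler ^ j) f := by
  rw [X_pow_dvd_iff] at h ⊢
  intro n hn
  rw [coeff_euler_pow, h n hn, mul_zero]

lemma pow_dvd_euler_pow {a : ℝ} {T : ℕ} (j : ℕ) {f : ℝ[X]} (h : (X - C a) ^ T ∣ f) :
    (X - C a) ^ (T - j) ∣ (euler ^ j) f := by
  induction j with
  | zero => simpa using h
  | succ j ih =>
    rw [pow_succ', Module.End.mul_apply, euler_apply, ← Nat.sub_sub]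
    exact (pow_sub_one_dvd_derivative_of_pow_dvd ih).mul_left X

lemma natDegree_prod_coeff {ι : Type*} (u : Finset ι) (f : ι → ℝ[X]) (d : ι → ℕ)
    (h : ∀ i ∈ u, (f i).natDegree ≤ d i) :
    (∏ i ∈ u, f i).natDegree ≤ ∑ i ∈ u, d i ∧
      (∏ i ∈ u, f i).coeff (∑ i ∈ u, d i) = ∏ i ∈ u, (f i).coeff (d i) := by
  classical
  induction u using Finset.induction_on with
  | empty => simp
  | insert a u ha ih =>
    obtain ⟨h1, h2⟩ := ih fun i hi => h i (Finset.mem_insert_of_mem hi)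
    have h3 := h a (Finset.mem_insert_self a u)
    rw [Finset.prod_insert ha, Finset.sum_insert ha, Finset.prod_insert ha, ← h2]
    exact ⟨natDegree_mul_le.trans (add_le_add h3 h1), coeff_mul_add_eq_of_natDegree_le h3 h1⟩

/-- The Wronskian of a family of polynomials with respect to the Euler operator. -/
noncomputable def eulerWronskian {s : ℕ} (f : Fin s → ℝ[X]) : Matrix (Fin s) (Fin s) ℝ[X] :=
  Matrix.of fun i j => (euler ^ (j : ℕ)) (f i)

lemma pow_dvd_det_eulerWronskian {s : ℕ} (f : Fin s → ℝ[X]) (c : Fin s → ℝ) (i₀ : Fin s)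
    (hc : c i₀ ≠ 0) {a : ℝ} {T : ℕ} (h : (X - C a) ^ T ∣ ∑ i, C (c i) * f i) :
    (X - C a) ^ (T - (s - 1)) ∣ (eulerWronskian f).det := by
  have key := Matrix.det_updateRow_sum (eulerWronskian f) i₀ (fun i => C (c i))
  have hdvd : (X - C a) ^ (T - (s - 1)) ∣ C (c i₀) * (eulerWronskian f).det := by
    rw [smul_eq_mul] at key
    rw [← key, Matrix.det_eq_sum_mul_adjugate_row _ i₀]
    refine Finset.dvd_sum fun j _ => Dvd.dvd.mul_right ?_ _
    have : (∑ k, C (c k) • eulerWronskian f k) j = (euler ^ (j : ℕ)) (∑ i, C (c i) * f i) := by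
      simp [eulerWronskian, Finset.sum_apply, ← smul_eq_C_mul]
    rw [Matrix.updateRow_self, this]
    refine (pow_dvd_pow _ ?_).trans (pow_dvd_euler_pow j h)
    have := j.2
    omega
  have hu : IsUnit (C (c i₀)) := isUnit_C.2 hc.isUnit
  exact (hu.dvd_mul_left).1 hdvd

/-- A zero estimate: polynomials `f i` with distinct degrees, each supported on `R` consecutive
exponents, cannot have two combinations with nonzero coefficients vanishing to high total order at
two different nonzero points. -/
theorem zero_estimate {s R T T' : ℕ} (hs : 1 ≤ s) (f : Fin s → ℝ[X]) (e : Fin s → ℕ)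
    (hf : ∀ i, f i ≠ 0) (hdeg : Function.Injective fun i => (f i).natDegree)
    (he : ∀ i, X ^ e i ∣ f i) (hR : ∀ i, (f i).natDegree + 1 ≤ e i + R)
    (c d : Fin s → ℝ) (hc : ∀ i, c i ≠ 0) (hd : ∀ i, d i ≠ 0) {a b : ℝ} (ha : a ≠ 0) (hb : b ≠ 0)
    (hab : a ≠ b) (h1 : (X - C a) ^ T ∣ ∑ i, C (c i) * f i)
    (h2 : (X - C b) ^ T' ∣ ∑ i, C (d i) * f i) : T + T' + 2 ≤ s * (R + 1) := by
  set W := (eulerWronskian f).det with hW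
  have hcoef : W.natDegree ≤ ∑ i, (f i).natDegree ∧
      W.coeff (∑ i, (f i).natDegree) =
        (∏ i, (f i).leadingCoeff) *
          (Matrix.vandermonde fun i => ((f i).natDegree : ℝ)).det := by
    have hterm : ∀ σ : Equiv.Perm (Fin s),
        (∏ i, eulerWronskian f (σ i) i).natDegree ≤ ∑ i, (f i).natDegree ∧
        (∏ i, eulerWronskian f (σ i) i).coeff (∑ i, (f i).natDegree) =
          (∏ i, (f i).leadingCoeff) *
            ∏ i, Matrix.vandermonde (fun i => ((f i).natDegree : ℝ)) (σ i) i := by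
      intro σ
      have := natDegree_prod_coeff Finset.univ (fun i => eulerWronskian f (σ i) i)
        (fun i => (f (σ i)).natDegree) fun i _ => natDegree_euler_pow_le _ _
      rw [Equiv.sum_comp σ (fun i => (f i).natDegree)] at this
      refine ⟨this.1, this.2.trans ?_⟩
      rw [← Equiv.prod_comp σ (fun i => (f i).leadingCoeff), ← Finset.prod_mul_distrib]
      refine Finset.prod_congr rfl fun i _ => ?_
      simp only [eulerWronskian, Matrix.of_apply, coeff_euler_pow, Matrix.vandermonde_apply]
      rw [leadingCoeff, mul_comm]
    constructor
    · rw [hW, Matrix.det_apply]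
      refine natDegree_sum_le_of_forall_le _ _ fun σ _ => ?_
      exact (natDegree_smul_le _ _).trans (hterm σ).1
    · rw [hW, Matrix.det_apply, Matrix.det_apply, finsetSum_coeff, Finset.mul_sum]
      refine Finset.sum_congr rfl fun σ _ => ?_
      rw [coeff_smul, (hterm σ).2, mul_smul_comm]
  have hW0 : W ≠ 0 := by
    intro h0
    rw [h0, coeff_zero] at hcoef
    have : (Matrix.vandermonde fun i => ((f i).natDegree : ℝ)).det ≠ 0 :=
      Matrix.det_vandermonde_ne_zero_iff.2 fun i j hij => hdeg (by exact_mod_cast hij)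
    refine mul_ne_zero (Finset.prod_ne_zero_iff.2 fun i _ => ?_) this hcoef.2.symm
    exact leadingCoeff_ne_zero.2 (hf i)
  have hX : X ^ (∑ i, e i) ∣ W := by
    rw [hW, Matrix.det_apply]
    refine Finset.dvd_sum fun σ _ => ?_
    rw [Units.smul_def, zsmul_eq_mul]
    refine Dvd.dvd.mul_left ?_ _
    rw [← Equiv.sum_comp σ e, ← Finset.prod_pow_eq_pow_sum]
    exact Finset.prod_dvd_prod_of_dvd _ _ fun i _ => X_pow_dvd_euler_pow _ (he _)
  have hA := pow_dvd_det_eulerWronskian f c ⟨0, hs⟩ (hc _) h1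
  have hB := pow_dvd_det_eulerWronskian f d ⟨0, hs⟩ (hd _) h2
  have cop : ∀ {u v : ℝ}, u ≠ v → IsCoprime (X - C u) (X - C v) := fun h =>
    isCoprime_X_sub_C_of_isUnit_sub (sub_ne_zero.2 h).isUnit
  have cX : ∀ {u : ℝ}, u ≠ 0 → IsCoprime (X : ℝ[X]) (X - C u) := fun h => by
    simpa using cop (Ne.symm h)
  have hAB := (((cop hab).pow (m := T - (s - 1)) (n := T' - (s - 1))).mul_dvd hA hB)
  have hall := (IsCoprime.mul_right ((cX ha).pow (m := ∑ i, e i) (n := T - (s - 1)))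
    ((cX hb).pow (n := T' - (s - 1)))).mul_dvd hX hAB
  have hle := natDegree_le_of_dvd hall hW0
  rw [((monic_X_pow _).natDegree_mul (((monic_X_sub_C a).pow _).mul ((monic_X_sub_C b).pow _))),
    ((monic_X_sub_C a).pow _).natDegree_mul ((monic_X_sub_C b).pow _)] at hle
  simp only [natDegree_pow, natDegree_X_sub_C, natDegree_X, mul_one] at hle
  have hsum : ∑ i, ((f i).natDegree + 1) ≤ ∑ i, (e i + R) := Finset.sum_le_sum fun i _ => hR i
  simp only [Finset.sum_add_distrib, Finset.sum_const, Finset.card_univ, Fintype.card_fin,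
    smul_eq_mul, mul_one] at hsum
  have := hcoef.1
  rw [mul_add, mul_one]
  omega

end CubeSum

namespace CubeSum

open Finset

/-- The divided difference of `f` on the nodes `x 0, …, x m` (where `f` is a function of the
index of the node). -/
noncomputable def dd (x : ℕ → ℕ) (m : ℕ) (f : ℕ → ℝ) : ℝ :=
  ∑ j ∈ range (m + 1), f j / ∏ i ∈ (range (m + 1)).erase j, ((x j : ℝ) - x i)

lemma dd_zero (x : ℕ → ℕ) (f : ℕ → ℝ) : dd x 0 f = f 0 := by
  simp [dd]

lemma dd_add (x : ℕ → ℕ) (m : ℕ) (f g : ℕ → ℝ) :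
    dd x m (fun n => f n + g n) = dd x m f + dd x m g := by
  simp [dd, add_div, sum_add_distrib]

lemma dd_const_mul (x : ℕ → ℕ) (m : ℕ) (a : ℝ) (f : ℕ → ℝ) :
    dd x m (fun n => a * f n) = a * dd x m f := by
  simp [dd, mul_sum, mul_div_assoc]

lemma dd_sum (x : ℕ → ℕ) (m : ℕ) (s : Finset ℕ) (f : ℕ → ℕ → ℝ) :
    dd x m (fun n => ∑ j ∈ s, f j n) = ∑ j ∈ s, dd x m (f j) := by
  simp only [dd, sum_div]
  exact sum_comm

lemma dd_congr (x : ℕ → ℕ) (m : ℕ) {f g : ℕ → ℝ} (h : ∀ n ≤ m, f n = g n) :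
    dd x m f = dd x m g :=
  sum_congr rfl fun j hj => by rw [h j (by simpa [Nat.lt_succ_iff] using hj)]

lemma dd_succ_sub_last_mul {x : ℕ → ℕ} (hx : StrictMono x) (m : ℕ) (f : ℕ → ℝ) :
    dd x (m + 1) (fun n => ((x n : ℝ) - x (m + 1)) * f n) = dd x m f := by
  rw [dd, sum_range_succ, sub_self, zero_mul, zero_div, add_zero]
  refine sum_congr rfl fun j hj => ?_
  have hj' : j < m + 1 := by simpa using hj
  have hset : (range (m + 1 + 1)).erase j = insert (m + 1) ((range (m + 1)).erase j) := by
    ext i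
    simp only [mem_erase, mem_range, mem_insert]
    omega
  have hne : ((x j : ℝ) - x (m + 1)) ≠ 0 :=
    sub_ne_zero.2 (by exact_mod_cast (hx hj').ne)
  rw [hset, prod_insert (by simp), mul_div_mul_left _ _ hne]

lemma dd_succ_sub_mul {x : ℕ → ℕ} (hx : StrictMono x) (m : ℕ) (c : ℝ) (f : ℕ → ℝ) :
    dd x (m + 1) (fun n => ((x n : ℝ) - c) * f n) =
      ((x (m + 1) : ℝ) - c) * dd x (m + 1) f + dd x m f := by
  rw [← dd_succ_sub_last_mul hx m f, ← dd_const_mul, ← dd_add]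
  refine dd_congr _ _ fun n _ => ?_
  ring

lemma cast_choose_succ (n j : ℕ) :
    ((n.choose (j + 1) : ℕ) : ℝ) = (1 / (j + 1 : ℝ)) * (((n : ℝ) - j) * n.choose j) := by
  have h := Nat.choose_succ_right_eq n j
  have h' : ((n.choose (j + 1) : ℕ) : ℝ) * (j + 1) = n.choose j * ((n : ℝ) - j) := by
    rcases le_or_gt j n with hjn | hjn
    · rw [← Nat.cast_sub hjn]
      exact_mod_cast h
    · rw [Nat.choose_eq_zero_of_lt hjn, Nat.choose_eq_zero_of_lt (by omega)]
      simp
  have : (j + 1 : ℝ) ≠ 0 := by positivity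
  field_simp
  linarith

lemma dd_choose_of_lt {x : ℕ → ℕ} (hx : StrictMono x) {m j : ℕ} (hj : j < m) :
    dd x m (fun n => ((x n).choose j : ℝ)) = 0 := by
  induction j generalizing m with
  | zero =>
    have h := Lagrange.coeff_eq_sum (s := range (m + 1)) (v := fun n => (x n : ℝ)) (P := 1)
      (fun i _ j _ hij => hx.injective (Nat.cast_injective hij))
      (by rw [Polynomial.degree_one, card_range]; exact_mod_cast Nat.succ_pos m)
    simp only [card_range, Nat.add_sub_cancel, Polynomial.eval_one] at h
    simp only [dd, Nat.choose_zero_right, Nat.cast_one]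
    rw [← h, Polynomial.coeff_one, if_neg hj.ne']
  | succ j ih =>
    obtain ⟨m, rfl⟩ : ∃ k, m = k + 1 := ⟨m - 1, by omega⟩
    simp only [cast_choose_succ]
    rw [dd_const_mul, dd_succ_sub_mul hx, ih (by omega), ih (by omega)]
    simp

lemma dd_choose_self {x : ℕ → ℕ} (hx : StrictMono x) (m : ℕ) :
    dd x m (fun n => ((x n).choose m : ℝ)) = 1 / m.factorial := by
  induction m with
  | zero => simp [dd_zero]
  | succ m ih =>
    simp only [cast_choose_succ]
    rw [dd_const_mul, dd_succ_sub_mul hx, dd_choose_of_lt hx (Nat.lt_succ_self m), ih,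
      Nat.factorial_succ]
    push_cast
    have : (m.factorial : ℝ) ≠ 0 := by positivity
    field_simp
    ring

lemma abs_dd_choose_le {x : ℕ → ℕ} (hx : StrictMono x) {X : ℕ} (m i : ℕ) (hm : x m ≤ X)
    (hi : m + i ≤ X) :
    |dd x m (fun n => ((x n).choose (m + i) : ℝ))| ≤
      (X : ℝ) ^ i / (m.factorial * i.factorial) := by
  obtain ⟨j, hj⟩ : ∃ j, j = m + i := ⟨_, rfl⟩
  rw [← hj]
  induction j generalizing m i with
  | zero =>
    obtain ⟨rfl, rfl⟩ : m = 0 ∧ i = 0 := by omega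
    simp [dd_zero]
  | succ j ih =>
    rcases Nat.eq_zero_or_pos i with rfl | hi0
    · rw [hj, Nat.add_zero, dd_choose_self hx, abs_of_nonneg (by positivity)]
      simp
    obtain ⟨i, rfl⟩ : ∃ k, i = k + 1 := ⟨i - 1, by omega⟩
    have hxj : ∀ n, x n ≤ X → |(x n : ℝ) - j| ≤ X := fun n hn => by
      have h1 : (x n : ℝ) ≤ X := by exact_mod_cast hn
      have h2 : (j : ℝ) ≤ X := by exact_mod_cast (by omega : j ≤ X)
      have h3 : (0 : ℝ) ≤ x n := by positivity
      have h4 : (0 : ℝ) ≤ j := by positivity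
      rw [abs_le]
      constructor <;> linarith
    have h1 := ih m i hm (by omega) (by omega)
    simp only [cast_choose_succ]
    rw [dd_const_mul, abs_mul, abs_of_nonneg (by positivity)]
    have hfi : (0 : ℝ) < i.factorial := by positivity
    have hfm : (0 : ℝ) < m.factorial := by positivity
    cases m with
    | zero =>
      rw [dd_zero] at h1 ⊢
      rw [abs_mul]
      have hji : j = i := by omega
      subst hji
      calc 1 / (j + 1 : ℝ) * (|(x 0 : ℝ) - j| * |((x 0).choose j : ℝ)|)
          ≤ 1 / (j + 1 : ℝ) * (X * ((X : ℝ) ^ j / (Nat.factorial 0 * j.factorial))) := by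
            gcongr
            exact hxj 0 hm
        _ = _ := by
            rw [Nat.factorial_succ]
            push_cast
            field_simp
            ring
    | succ m =>
      have h2 := ih m (i + 1) ((hx (Nat.lt_succ_self m)).le.trans hm) (by omega) (by omega)
      rw [dd_succ_sub_mul hx]
      calc 1 / (j + 1 : ℝ) * |((x (m + 1) : ℝ) - j) *
              dd x (m + 1) (fun n => ((x n).choose j : ℝ)) +
              dd x m (fun n => ((x n).choose j : ℝ))|
          ≤ 1 / (j + 1 : ℝ) * (X * ((X : ℝ) ^ i / ((m + 1).factorial * i.factorial)) +
              (X : ℝ) ^ (i + 1) / (m.factorial * (i + 1).factorial)) := by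
            gcongr
            refine (abs_add_le _ _).trans (add_le_add ?_ h2)
            rw [abs_mul]
            gcongr
            exact hxj _ hm
        _ = _ := by
            have hje : (j : ℝ) = m + i + 1 := by exact_mod_cast (by omega : j = m + i + 1)
            rw [hje, Nat.factorial_succ, Nat.factorial_succ]
            push_cast
            field_simp
            ring

lemma factorial_mul_factorial_le_prod {x : ℕ → ℕ} (hx : StrictMono x) {m j : ℕ} (hj : j ≤ m) :
    (j.factorial : ℝ) * (m - j).factorial ≤
      |∏ i ∈ (range (m + 1)).erase j, ((x j : ℝ) - x i)| := by
  have hset : (range (m + 1)).erase j = range j ∪ Ico (j + 1) (m + 1) := by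
    ext i
    simp only [mem_erase, mem_range, mem_union, mem_Ico]
    omega
  have hdisj : Disjoint (range j) (Ico (j + 1) (m + 1)) := by
    rw [disjoint_left]
    intro i hi hi'
    simp only [mem_range, mem_Ico] at hi hi'
    omega
  have hgap : ∀ a b : ℕ, a ≤ b → (b : ℝ) - a ≤ (x b : ℝ) - x a := by
    intro a b hab
    have : b - a ≤ x b - x a := by
      obtain ⟨d, rfl⟩ := Nat.exists_eq_add_of_le hab
      have := hx.add_le_nat d a
      have h2 : a + d = d + a := add_comm _ _
      rw [h2]
      omega
    have h3 := hx.monotone hab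
    rw [← Nat.cast_sub hab, ← Nat.cast_sub h3]
    exact_mod_cast this
  rw [hset, abs_prod, prod_union hdisj]
  have e1 : (j.factorial : ℝ) = ∏ i ∈ range j, ((j : ℝ) - i) := by
    rw [← prod_range_add_one_eq_factorial, ← prod_range_reflect, Nat.cast_prod]
    refine prod_congr rfl fun i hi => ?_
    have : i < j := by simpa using hi
    rw [← Nat.cast_sub this.le]
    congr 1
    omega
  have e2 : ((m - j).factorial : ℝ) = ∏ i ∈ Ico (j + 1) (m + 1), ((i : ℝ) - j) := by
    rw [prod_Ico_eq_prod_range, ← prod_range_add_one_eq_factorial, Nat.cast_prod,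
      show m + 1 - (j + 1) = m - j by omega]
    refine prod_congr rfl fun i _ => ?_
    push_cast
    ring
  rw [e1, e2]
  refine mul_le_mul (prod_le_prod (fun i hi => ?_) fun i hi => ?_)
    (prod_le_prod (fun i hi => ?_) fun i hi => ?_) (prod_nonneg fun i hi => ?_)
    (prod_nonneg fun i _ => abs_nonneg _)
  · have : (i : ℝ) ≤ j := by exact_mod_cast (by simpa using hi : i < j).le
    linarith
  · exact (hgap i j (by simpa using hi : i < j).le).trans (le_abs_self _)
  · have : (j : ℝ) ≤ i := by
      have := (mem_Ico.1 hi).1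
      exact_mod_cast (by omega : j ≤ i)
    linarith
  · rw [abs_sub_comm]
    have := (mem_Ico.1 hi).1
    exact (hgap j i (by omega)).trans (le_abs_self _)
  · have : (j : ℝ) ≤ i := by
      have := (mem_Ico.1 hi).1
      exact_mod_cast (by omega : j ≤ i)
    linarith

lemma abs_dd_le {x : ℕ → ℕ} (hx : StrictMono x) (m : ℕ) {g : ℕ → ℝ} {G : ℝ}
    (hg : ∀ n ≤ m, |g n| ≤ G) : |dd x m g| ≤ G * 2 ^ m / m.factorial := by
  have hG : 0 ≤ G := (abs_nonneg _).trans (hg 0 (Nat.zero_le _))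
  calc |dd x m g| ≤ ∑ j ∈ range (m + 1), G / (j.factorial * (m - j).factorial) := by
        refine (abs_sum_le_sum_abs _ _).trans (sum_le_sum fun j hj => ?_)
        have hj' : j ≤ m := by simpa [Nat.lt_succ_iff] using hj
        rw [abs_div]
        exact div_le_div₀ hG (hg j hj') (by positivity) (factorial_mul_factorial_le_prod hx hj')
    _ = ∑ j ∈ range (m + 1), G / m.factorial * (m.choose j : ℝ) := by
        refine sum_congr rfl fun j hj => ?_
        have hj' : j ≤ m := by simpa [Nat.lt_succ_iff] using hj
        rw [Nat.cast_choose ℝ hj']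
        field_simp
    _ = _ := by
        rw [← mul_sum, ← Nat.cast_sum, Nat.sum_range_choose]
        push_cast
        ring

lemma choose_mul_pow_eq_sum (β : ℝ) {n X : ℕ} (t : ℕ) (hn : n ≤ X) :
    (n.choose t : ℝ) * β ^ n =
      ∑ j ∈ range (X + 1), β ^ t * (j.choose t * (β - 1) ^ (j - t)) * (n.choose j : ℝ) := by
  rcases lt_or_ge n t with hnt | hnt
  · rw [Nat.choose_eq_zero_of_lt hnt, sum_eq_zero]
    · simp
    intro j _
    rcases lt_or_ge n j with h | h
    · simp [Nat.choose_eq_zero_of_lt h]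
    · simp [Nat.choose_eq_zero_of_lt (h.trans_lt hnt)]
  · have h1 : ∑ j ∈ range (X + 1), β ^ t * (j.choose t * (β - 1) ^ (j - t)) * (n.choose j : ℝ) =
        ∑ j ∈ Ico t (n + 1), β ^ t * (j.choose t * (β - 1) ^ (j - t)) * (n.choose j : ℝ) := by
      symm
      refine sum_subset (fun j hj => ?_) fun j _ hj => ?_
      · simp only [mem_Ico, mem_range] at hj ⊢
        omega
      · rcases lt_or_ge n j with h | h
        · simp [Nat.choose_eq_zero_of_lt h]
        · have : j < t := by
            simp only [mem_Ico, not_and_or] at hj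
            omega
          simp [Nat.choose_eq_zero_of_lt this]
    rw [h1, sum_Ico_eq_sum_range, show n + 1 - t = (n - t) + 1 by omega]
    have h2 : ∀ i ∈ range (n - t + 1),
        β ^ t * (((t + i).choose t : ℝ) * (β - 1) ^ (t + i - t)) * (n.choose (t + i) : ℝ) =
        β ^ t * n.choose t * ((β - 1) ^ i * 1 ^ (n - t - i) * ((n - t).choose i : ℝ)) := by
      intro i hi
      have hi' : i ≤ n - t := by simpa [Nat.lt_succ_iff] using hi
      have := Nat.choose_mul (n := n) (k := t + i) (s := t) (Nat.le_add_right t i)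
      rw [Nat.add_sub_cancel_left] at this
      have h3 : (n.choose (t + i) : ℝ) * (t + i).choose t = n.choose t * (n - t).choose i := by
        exact_mod_cast this
      rw [Nat.add_sub_cancel_left, one_pow]
      linear_combination β ^ t * (β - 1) ^ i * h3
    rw [sum_congr rfl h2, ← mul_sum, ← add_pow, sub_add_cancel]
    rw [mul_comm (β ^ t), mul_assoc, ← pow_add, Nat.add_sub_cancel' hnt]

lemma abs_dd_choose_mul_pow_le {x : ℕ → ℕ} (hx : StrictMono x) {X m t T : ℕ} {β ε : ℝ}
    (hm : x m ≤ X) (hβ : 1 ≤ β) (hβε : β - 1 ≤ ε) (hε : 0 < ε) (htm : t ≤ m) (hT : 0 < T)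
    (hz : X * ε / T < 1) :
    |dd x m (fun n => ((x n).choose t : ℝ) * β ^ x n)| ≤
      β ^ t * (Real.exp T / t.factorial * (ε / T) ^ (m - t) *
        (1 / (1 - X * ε / T) ^ (m + 1))) := by
  set z : ℝ := X * ε / T with hzdef
  have hT' : (0 : ℝ) < T := by exact_mod_cast hT
  have hz0 : 0 ≤ z := by positivity
  have hη : 0 ≤ β - 1 := by linarith
  have hmX : m ≤ X := (hx.le_apply).trans hm
  have h1 : dd x m (fun n => ((x n).choose t : ℝ) * β ^ x n) =
      ∑ j ∈ range (X + 1), β ^ t * (j.choose t * (β - 1) ^ (j - t)) *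
        dd x m (fun n => ((x n).choose j : ℝ)) := by
    rw [dd_congr x m (fun n hn => choose_mul_pow_eq_sum β t ((hx.monotone hn).trans hm)), dd_sum]
    simp only [dd_const_mul]
  have h2 : ∑ j ∈ range (X + 1), β ^ t * (j.choose t * (β - 1) ^ (j - t)) *
        dd x m (fun n => ((x n).choose j : ℝ)) =
      ∑ i ∈ range (X - m + 1), β ^ t * ((m + i).choose t * (β - 1) ^ (m + i - t)) *
        dd x m (fun n => ((x n).choose (m + i) : ℝ)) := by
    rw [show X - m + 1 = X + 1 - m by omega,
      ← sum_Ico_eq_sum_range (fun j => β ^ t * (j.choose t * (β - 1) ^ (j - t)) *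
        dd x m (fun n => ((x n).choose j : ℝ)))]
    symm
    refine sum_subset (fun j hj => ?_) fun j hj hj' => ?_
    · simp only [mem_Ico, mem_range] at hj ⊢
      omega
    · have : j < m := by
        simp only [mem_Ico, mem_range, not_and_or] at hj hj'
        omega
      rw [dd_choose_of_lt hx this, mul_zero]
  rw [h1, h2]
  have hterm : ∀ i ∈ range (X - m + 1),
      |β ^ t * ((m + i).choose t * (β - 1) ^ (m + i - t)) *
        dd x m (fun n => ((x n).choose (m + i) : ℝ))| ≤
      β ^ t * (Real.exp T / t.factorial * (ε / T) ^ (m - t)) *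
        (((i + m).choose m : ℝ) * z ^ i) := by
    intro i hi
    have hi' : m + i ≤ X := by
      have : i < X - m + 1 := by simpa using hi
      omega
    have hd := abs_dd_choose_le hx m i hm hi'
    have hexp := Real.pow_div_factorial_le_exp (T : ℝ) hT'.le (m + i - t)
    rw [abs_mul, abs_of_nonneg (by positivity)]
    have hpow : (β - 1) ^ (m + i - t) ≤ ε ^ (m + i - t) := by gcongr
    have hch : ((m + i).choose t : ℝ) =
        (m + i).factorial / (t.factorial * (m + i - t).factorial) :=
      Nat.cast_choose ℝ (by omega)
    have hch' : ((i + m).choose m : ℝ) = (m + i).factorial / (m.factorial * i.factorial) := by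
      rw [add_comm i m, Nat.cast_choose ℝ (Nat.le_add_right m i), Nat.add_sub_cancel_left]
    calc β ^ t * (((m + i).choose t : ℝ) * (β - 1) ^ (m + i - t)) *
          |dd x m (fun n => ((x n).choose (m + i) : ℝ))|
        ≤ β ^ t * (((m + i).choose t : ℝ) * ε ^ (m + i - t)) *
          ((X : ℝ) ^ i / (m.factorial * i.factorial)) := by gcongr
      _ = β ^ t * (((T : ℝ) ^ (m + i - t) / (m + i - t).factorial) / t.factorial *
            (ε / T) ^ (m - t)) * (((i + m).choose m : ℝ) * z ^ i) := by
          rw [hch, hch', hzdef, show m + i - t = (m - t) + i by omega, div_pow, div_pow, mul_pow,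
            pow_add, pow_add]
          field_simp
      _ ≤ _ := by gcongr
  refine (abs_sum_le_sum_abs _ _).trans ((sum_le_sum hterm).trans ?_)
  rw [← mul_sum]
  have hE : 0 ≤ β ^ t * (Real.exp T / t.factorial * (ε / T) ^ (m - t)) := by positivity
  refine (mul_le_mul_of_nonneg_left ?_ hE).trans_eq (mul_assoc _ _ _)
  have hzn : ‖z‖ < 1 := by rwa [Real.norm_of_nonneg hz0]
  rw [← tsum_choose_mul_geometric_of_norm_lt_one m hzn]
  exact (summable_choose_mul_geometric_of_norm_lt_one m hzn).sum_le_tsum _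
    fun i _ => by positivity

end CubeSum

namespace CubeSum

open Finset Matrix

/-- The square matrix with rows `C(x n, t)` for `t < T` followed by the rows `G i`. -/
def rowMatrix (x : ℕ → ℕ) (T M : ℕ) (G : Fin M → ℕ → ℝ) :
    Matrix (Fin T ⊕ Fin M) (Fin T ⊕ Fin M) ℝ :=
  of fun r p => Sum.elim (fun t : Fin T => ((x (finSumFinEquiv p)).choose t : ℝ))
    (fun i => G i (finSumFinEquiv p)) r

/-- The triangular matrix of divided differences. -/
noncomputable def ddMatrix (x : ℕ → ℕ) (N : ℕ) : Matrix (Fin N) (Fin N) ℝ :=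
  of fun n m => if (n : ℕ) ≤ m then
    1 / ∏ i ∈ (range (m + 1)).erase n, ((x n : ℝ) - x i) else 0

/-- The Vandermonde product of the first `N` nodes. -/
noncomputable def vandermondeProd (x : ℕ → ℕ) (N : ℕ) : ℝ :=
  ∏ m ∈ range N, ∏ i ∈ range m, ((x m : ℝ) - x i)

lemma vandermondeProd_pos {x : ℕ → ℕ} (hx : StrictMono x) (N : ℕ) : 0 < vandermondeProd x N :=
  prod_pos fun m _ => prod_pos fun i hi =>
    sub_pos.2 (by exact_mod_cast hx (by simpa using hi))

lemma det_ddMatrix (x : ℕ → ℕ) (N : ℕ) : (ddMatrix x N).det = 1 / vandermondeProd x N := by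
  rw [det_of_isUpperTriangular]
  · simp only [ddMatrix, of_apply, le_refl, if_true, vandermondeProd]
    rw [Fin.prod_univ_eq_prod_range
      (fun m => 1 / ∏ i ∈ (range (m + 1)).erase m, ((x m : ℝ) - x i)) N, prod_div_distrib,
      prod_const_one]
    congr 1
    refine prod_congr rfl fun m _ => ?_
    congr 1
    ext i
    simp only [mem_erase, mem_range]
    omega
  · intro n m h
    have h' : (m : ℕ) < n := h
    simp only [ddMatrix, of_apply]
    rw [if_neg (by omega)]

lemma sum_mul_ddMatrix (x : ℕ → ℕ) (N : ℕ) (f : ℕ → ℝ) (m : Fin N) :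
    ∑ n : Fin N, f n * ddMatrix x N n m = dd x m f := by
  simp only [ddMatrix, of_apply]
  rw [Fin.sum_univ_eq_sum_range (fun n => f n * if n ≤ (m : ℕ) then
    1 / ∏ i ∈ (range (m + 1)).erase n, ((x n : ℝ) - x i) else 0) N, dd]
  symm
  have hm := m.2
  refine sum_subset_zero_on_sdiff (fun n hn => ?_) (fun n hn => ?_) fun n hn => ?_
  · simp only [mem_range] at hn ⊢
    omega
  · simp only [mem_sdiff, mem_range] at hn
    rw [if_neg (by omega), mul_zero]
  · simp only [mem_range] at hn
    rw [if_pos (by omega), mul_one_div]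

lemma rowMatrix_mul_ddMatrix {x : ℕ → ℕ} (hx : StrictMono x) (T M : ℕ) (G : Fin M → ℕ → ℝ) :
    rowMatrix x T M G * (ddMatrix x (T + M)).submatrix finSumFinEquiv finSumFinEquiv =
      fromBlocks (of fun t m : Fin T => dd x m fun n => ((x n).choose t : ℝ)) 0
        (of fun i (m : Fin T) => dd x m (G i)) (of fun i (m : Fin M) => dd x (T + m) (G i)) := by
  have key : ∀ (f : ℕ → ℝ) (q : Fin T ⊕ Fin M), ∑ p : Fin T ⊕ Fin M, f (finSumFinEquiv p) *
      ddMatrix x (T + M) (finSumFinEquiv p) (finSumFinEquiv q) = dd x (finSumFinEquiv q) f := by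
    intro f q
    rw [← sum_mul_ddMatrix x (T + M)]
    exact Equiv.sum_comp finSumFinEquiv
      (fun n : Fin (T + M) => f n * ddMatrix x (T + M) n (finSumFinEquiv q))
  ext r q
  rw [mul_apply]
  rcases r with t | i
  · refine (key (fun n => ((x n).choose t : ℝ)) q).trans ?_
    rcases q with m | m
    · simp
    · simp only [finSumFinEquiv_apply_right, Fin.val_natAdd, fromBlocks_apply₁₂, Matrix.zero_apply]
      exact dd_choose_of_lt hx (by omega)
  · refine (key (G i) q).trans ?_
    rcases q with m | m <;> simp

lemma det_dd_choose {x : ℕ → ℕ} (hx : StrictMono x) (T M : ℕ) :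
    (of fun t m : Fin M => dd x (T + m) fun n => ((x n).choose (T + t) : ℝ)).det =
      ∏ t ∈ range M, (1 / ((T + t).factorial : ℝ)) := by
  rw [det_of_isLowerTriangular, ← Fin.prod_univ_eq_prod_range
    (fun t => 1 / ((T + t).factorial : ℝ)) M]
  · simp only [of_apply, dd_choose_self hx]
  · intro t m htm
    have : (t : ℕ) < m := htm
    exact dd_choose_of_lt hx (by omega)

lemma det_rowMatrix {x : ℕ → ℕ} (hx : StrictMono x) (T M : ℕ) (G : Fin M → ℕ → ℝ) :
    (rowMatrix x T M G).det = vandermondeProd x (T + M) *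
      (∏ t ∈ range T, (1 / (t.factorial : ℝ))) *
        (of fun i (m : Fin M) => dd x (T + m) (G i)).det := by
  have h := congrArg det (rowMatrix_mul_ddMatrix hx T M G)
  have h0 := det_dd_choose hx 0 T
  simp only [zero_add] at h0
  rw [det_mul, det_submatrix_equiv_self, det_ddMatrix, det_fromBlocks_zero₁₂, h0] at h
  have hV := (vandermondeProd_pos hx (T + M)).ne'
  rw [mul_one_div, div_eq_iff hV] at h
  rw [h]
  ring

lemma abs_det_le_factorial_mul {M : ℕ} {B : Matrix (Fin M) (Fin M) ℝ} {a b : Fin M → ℝ}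
    (h : ∀ i m, |B i m| ≤ a i * b m) : |B.det| ≤ M.factorial * ((∏ i, a i) * ∏ m, b m) := by
  rw [det_apply]
  refine (abs_sum_le_sum_abs _ _).trans ?_
  have : ∀ σ ∈ (univ : Finset (Equiv.Perm (Fin M))),
      |Equiv.Perm.sign σ • ∏ i, B (σ i) i| ≤ (∏ i, a i) * ∏ m, b m := by
    intro σ _
    have h1 : |Equiv.Perm.sign σ • ∏ i, B (σ i) i| = ∏ i, |B (σ i) i| := by
      rcases Int.units_eq_one_or (Equiv.Perm.sign σ) with h | h <;> simp [h, abs_prod]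
    rw [h1, ← Equiv.prod_comp σ a, ← prod_mul_distrib]
    exact prod_le_prod (fun i _ => abs_nonneg _) fun i _ => h _ _
  refine (sum_le_sum this).trans ?_
  simp [Fintype.card_perm]

lemma exists_rows {x : ℕ → ℕ} (hx : StrictMono x) {T M T' : ℕ} {G : Fin T' → ℕ → ℝ}
    (hG : ∀ a : ℕ → ℝ, (∀ t < T, ∑ n ∈ range (T + M), a n * ((x n).choose t : ℝ) = 0) →
      (∀ t, ∑ n ∈ range (T + M), a n * G t n = 0) → ∀ n < T + M, a n = 0) :
    ∃ τ : Fin M → Fin T', Function.Injective τ ∧ (rowMatrix x T M fun i => G (τ i)).det ≠ 0 := by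
  classical
  set v : Fin T ⊕ Fin T' → (Fin T ⊕ Fin M → ℝ) := fun r p =>
    Sum.elim (fun t : Fin T => ((x (finSumFinEquiv p)).choose t : ℝ))
      (fun i => G i (finSumFinEquiv p)) r with hv
  have hs : LinearIndepOn ℝ v (Set.range Sum.inl) := by
    have h1 : (rowMatrix x T M fun i n => ((x n).choose (T + i) : ℝ)).det ≠ 0 := by
      rw [det_rowMatrix hx, det_dd_choose hx]
      have := (vandermondeProd_pos hx (T + M)).ne'
      positivity
    have h2 := linearIndependent_rows_iff_isUnit.2 ((isUnit_iff_isUnit_det _).2 h1.isUnit)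
    rw [linearIndepOn_range_iff Sum.inl_injective]
    exact h2.comp Sum.inl Sum.inl_injective
  obtain ⟨b, -, hsb, hspan, hb⟩ := exists_linearIndepOn_extension hs (Set.subset_univ _)
  have htop : ⊤ ≤ Submodule.span ℝ (v '' b) := by
    refine le_trans ?_ (Submodule.span_le.2 hspan)
    by_contra hne
    obtain ⟨f, hf0, hf⟩ := Submodule.exists_le_ker_of_lt_top _ (lt_top_iff_ne_top.2
      fun h => hne h.ge)
    refine hf0 (LinearMap.pi_ext' fun p => LinearMap.ext_ring ?_)
    set a : ℕ → ℝ := fun n => if h : n < T + M then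
      f (Pi.single (finSumFinEquiv.symm ⟨n, h⟩) 1) else 0 with ha
    have hfa : ∀ g : ℕ → ℝ, f (fun p => g (finSumFinEquiv p)) =
        ∑ n ∈ range (T + M), a n * g n := by
      intro g
      rw [← Fin.sum_univ_eq_sum_range (fun n => a n * g n) (T + M),
        ← Equiv.sum_comp finSumFinEquiv, LinearMap.pi_apply_eq_sum_univ f]
      refine sum_congr rfl fun p _ => ?_
      simp only [ha, Fin.is_lt, dif_pos, Fin.eta, Equiv.symm_apply_apply, smul_eq_mul]
      rw [mul_comm]
      congr 2
      ext q
      simp [Pi.single_apply, eq_comm]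
    have hker : ∀ r, f (v r) = 0 := fun r =>
      hf (Submodule.subset_span (Set.mem_image_of_mem v (Set.mem_univ r)))
    have hz := hG a
      (fun t ht => by
        rw [← hfa fun n => ((x n).choose t : ℝ)]
        exact hker (Sum.inl ⟨t, ht⟩))
      (fun t => by
        rw [← hfa (G t)]
        exact hker (Sum.inr t))
      (finSumFinEquiv p) (Fin.is_lt _)
    simpa [ha] using hz
  have hcard : Fintype.card b = T + M := by
    rw [Set.image_eq_range] at htop
    have := Module.finrank_eq_card_basis (Module.Basis.mk hb htop)
    simpa using this.symm
  set J : Finset (Fin T') := univ.filter fun i => Sum.inr i ∈ b with hJ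
  have hJc : J.card = M := by
    have hbJ : b.toFinset = (univ : Finset (Fin T)).disjSum J := by
      ext r
      rcases r with t | i
      · simpa using hsb ⟨t, rfl⟩
      · simp [hJ]
    rw [← Set.toFinset_card, hbJ, card_disjSum, card_univ, Fintype.card_fin] at hcard
    omega
  refine ⟨J.orderEmbOfFin hJc, (J.orderEmbOfFin hJc).injective, ?_⟩
  have hmem : ∀ r : Fin T ⊕ Fin M, Sum.map id (J.orderEmbOfFin hJc) r ∈ b := by
    rintro (t | i)
    · exact hsb ⟨t, rfl⟩
    · have := J.orderEmbOfFin_mem hJc i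
      exact (mem_filter.1 this).2
  have hli : LinearIndependent ℝ (rowMatrix x T M fun i => G (J.orderEmbOfFin hJc i)).row := by
    have := hb.comp (fun r : Fin T ⊕ Fin M => (⟨_, hmem r⟩ : b)) fun r r' h =>
      (Sum.map_injective.2 ⟨Function.injective_id, (J.orderEmbOfFin hJc).injective⟩)
        (congrArg Subtype.val h)
    have heq : (rowMatrix x T M fun i => G (J.orderEmbOfFin hJc i)).row =
        (fun r : b => v r) ∘ fun r : Fin T ⊕ Fin M => (⟨_, hmem r⟩ : b) := by
      ext r p
      rcases r with t | i <;> rfl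
    rw [heq]
    exact this
  exact ((isUnit_iff_isUnit_det _).1 (linearIndependent_rows_iff_isUnit.1 hli)).ne_zero

end CubeSum

namespace CubeSum

open Finset Polynomial

/-- The `n`-th element of `{l * ℓ + k | k < R}`, in increasing order. -/
def node (R ℓ n : ℕ) : ℕ := n / R * ℓ + n % R

lemma node_mul_add {R : ℕ} (ℓ l : ℕ) {k : ℕ} (hk : k < R) : node R ℓ (R * l + k) = l * ℓ + k := by
  rw [node, Nat.mul_add_div (by omega), Nat.div_eq_of_lt hk, Nat.mul_add_mod,
    Nat.mod_eq_of_lt hk, add_zero]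

lemma node_strictMono {R ℓ : ℕ} (hR : 0 < R) (hRℓ : R ≤ ℓ) : StrictMono (node R ℓ) := by
  refine strictMono_nat_of_lt_succ fun n => ?_
  have h1 := Nat.div_add_mod n R
  have h3 := Nat.mod_lt n hR
  rcases Nat.lt_or_ge (n % R + 1) R with h | h
  · have h2 : n + 1 = R * (n / R) + (n % R + 1) := by omega
    rw [h2, node_mul_add ℓ _ h, node]
    omega
  · have h2 : n + 1 = R * (n / R + 1) + 0 := by
      rw [mul_add_one]
      omega
    rw [h2, node_mul_add ℓ _ hR, node, add_mul]
    omega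

@[to_additive]
lemma prod_range_blocks {α : Type*} [CommMonoid α] (R S : ℕ)
    (f : ℕ → α) : ∏ n ∈ range (R * S), f n = ∏ l ∈ range S, ∏ k ∈ range R, f (R * l + k) := by
  induction S with
  | zero => simp
  | succ S ih => rw [mul_add_one, prod_range_add, ih, prod_range_succ]

lemma X_sub_C_pow_dvd_of_choose {N T : ℕ} {x : ℕ → ℕ} {a : ℕ → ℝ} {b : ℝ} (hb : b ≠ 0)
    (h : ∀ t < T, ∑ n ∈ range N, a n * ((x n).choose t * b ^ x n) = 0) :
    (X - C b) ^ T ∣ ∑ n ∈ range N, C (a n) * X ^ x n := by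
  have h1 : X ^ T ∣ taylor b (∑ n ∈ range N, C (a n) * X ^ x n) := by
    rw [X_pow_dvd_iff]
    intro t ht
    rw [taylor_coeff, map_sum, eval_finsetSum]
    refine (mul_eq_zero.1 ?_).resolve_left (pow_ne_zero t hb)
    rw [← h t ht, mul_sum]
    refine sum_congr rfl fun n _ => ?_
    rw [C_mul_X_pow_eq_monomial, hasseDeriv_monomial, eval_monomial]
    rcases lt_or_ge (x n) t with hnt | hnt
    · simp [Nat.choose_eq_zero_of_lt hnt]
    · rw [← Nat.sub_add_cancel hnt, pow_add, Nat.add_sub_cancel]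
      ring
  obtain ⟨g, hg⟩ := h1
  refine ⟨taylor (-b) g, ?_⟩
  have h2 := congrArg (taylor (-b)) hg
  rw [taylor_taylor, neg_add_cancel, taylor_zero, taylor_mul, taylor_pow, taylor_X] at h2
  rw [h2, C_neg, sub_eq_add_neg]

lemma eq_zero_of_sum_choose_eq_zero {R ℓ S T : ℕ} (hR : 0 < R) (hRℓ : R ≤ ℓ)
    (hT : S * (R + 1) ≤ 2 * T + 1) {A β : ℝ} (hA : A ≠ 0) (hβ : β ≠ 0) (hβ1 : β ≠ 1) {a : ℕ → ℝ}
    (h1 : ∀ t < T, ∑ n ∈ range (R * S), a n * ((node R ℓ n).choose t : ℝ) = 0)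
    (h2 : ∀ t < T, ∑ n ∈ range (R * S),
      a n * ((node R ℓ n).choose t * (A ^ (n / R) * β ^ (n % R))) = 0) :
    ∀ n < R * S, a n = 0 := by
  by_contra! hne
  obtain ⟨n₀, hn₀, ha₀⟩ := hne
  set f : ℕ → ℝ[X] := fun l => ∑ k ∈ range R, C (a (R * l + k)) * X ^ (l * ℓ + k) with hfdef
  have hcoeff : ∀ l, ∀ k < R, (f l).coeff (l * ℓ + k) = a (R * l + k) := by
    intro l k hk
    rw [hfdef, finsetSum_coeff, sum_eq_single k]
    · simp
    · intro j _ hj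
      rw [coeff_C_mul_X_pow, if_neg (by omega)]
    · intro hk'
      exact absurd (mem_range.2 hk) hk'
  have hdvd : ∀ l, X ^ (l * ℓ) ∣ f l := fun l => dvd_sum fun k _ =>
    ((pow_dvd_pow X (Nat.le_add_right _ k)).mul_left _)
  have hdeg : ∀ l, (f l).natDegree + 1 ≤ l * ℓ + R := by
    intro l
    have : (f l).natDegree ≤ l * ℓ + (R - 1) := by
      refine natDegree_sum_le_of_forall_le _ _ fun k hk => ?_
      refine (natDegree_C_mul_X_pow_le _ _).trans ?_
      have : k < R := by simpa using hk
      omega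
    omega
  have hdeg' : ∀ l, f l ≠ 0 → l * ℓ ≤ (f l).natDegree := by
    intro l hl
    obtain ⟨g, hg⟩ := hdvd l
    have hg0 : g ≠ 0 := fun h => hl (by rw [hg, h, mul_zero])
    rw [hg, natDegree_X_pow_mul _ hg0]
    omega
  set J : Finset ℕ := (range S).filter fun l => f l ≠ 0 with hJ
  have hsum : ∀ d : ℕ → ℝ, ∑ i, C (d (J.orderEmbOfFin rfl i)) * f (J.orderEmbOfFin rfl i) =
      ∑ n ∈ range (R * S), C (a n * d (n / R)) * X ^ node R ℓ n := by
    intro d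
    have e1 : ∑ i, C (d (J.orderEmbOfFin rfl i)) * f (J.orderEmbOfFin rfl i) =
        ∑ l ∈ J, C (d l) * f l := by
      conv_rhs => rw [← J.map_orderEmbOfFin_univ rfl, sum_map]
      rfl
    have e2 : ∑ l ∈ J, C (d l) * f l = ∑ l ∈ range S, C (d l) * f l := by
      rw [hJ, sum_filter_of_ne]
      intro l _ h h0
      exact h (by rw [h0, mul_zero])
    rw [e1, e2, sum_range_blocks R S]
    refine sum_congr rfl fun l _ => ?_
    rw [hfdef, mul_sum]
    refine sum_congr rfl fun k hk => ?_
    have hk' : k < R := by simpa using hk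
    rw [node_mul_add ℓ l hk', Nat.mul_add_div hR, Nat.div_eq_of_lt hk', add_zero, C_mul]
    ring
  have hl₀ : n₀ / R ∈ J := by
    have hk := Nat.mod_lt n₀ hR
    refine mem_filter.2 ⟨mem_range.2 (Nat.div_lt_of_lt_mul hn₀), fun h => ha₀ ?_⟩
    have := hcoeff (n₀ / R) _ hk
    rwa [h, Nat.div_add_mod, coeff_zero, eq_comm] at this
  have hmem : ∀ i, f (J.orderEmbOfFin rfl i) ≠ 0 := fun i =>
    (mem_filter.1 (J.orderEmbOfFin_mem rfl i)).2
  have hcard : J.card ≤ S := by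
    simpa using card_le_card (filter_subset (fun l => f l ≠ 0) (range S))
  have key := zero_estimate (T := T) (T' := T) (card_pos.2 ⟨_, hl₀⟩)
    (fun i => f (J.orderEmbOfFin rfl i)) (fun i => J.orderEmbOfFin rfl i * ℓ) hmem
    (by
      intro i j hij
      have hi := hdeg' _ (hmem i)
      have hj := hdeg' _ (hmem j)
      have hi' := hdeg (J.orderEmbOfFin rfl i)
      have hj' := hdeg (J.orderEmbOfFin rfl j)
      simp only at hij
      refine (J.orderEmbOfFin rfl).injective (le_antisymm ?_ ?_) <;> by_contra! hlt
      · have := Nat.mul_le_mul_right ℓ (Nat.succ_le_of_lt hlt)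
        rw [Nat.succ_mul] at this
        omega
      · have := Nat.mul_le_mul_right ℓ (Nat.succ_le_of_lt hlt)
        rw [Nat.succ_mul] at this
        omega)
    (fun i => hdvd _) (fun i => hdeg _) (fun _ => 1)
    (fun i => (A / β ^ ℓ) ^ J.orderEmbOfFin rfl i) (fun _ => one_ne_zero)
    (fun i => by positivity) one_ne_zero hβ hβ1.symm
    (by
      rw [hsum fun _ => 1]
      refine X_sub_C_pow_dvd_of_choose one_ne_zero fun t ht => ?_
      simpa using h1 t ht)
    (by
      rw [hsum fun l => (A / β ^ ℓ) ^ l]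
      refine X_sub_C_pow_dvd_of_choose hβ fun t ht => ?_
      rw [← h2 t ht]
      refine sum_congr rfl fun n _ => ?_
      rw [node, pow_add, mul_comm (n / R) ℓ, pow_mul, div_pow]
      field_simp)
  have := Nat.mul_le_mul_right (R + 1) hcard
  omega

end CubeSum

namespace CubeSum

open Finset Matrix

/-- The rows `n ↦ C(x n, t) A ^ l β ^ k`, where the `n`-th node is `l * ℓ + k`. -/
def powRow (R ℓ : ℕ) (A β : ℝ) (t n : ℕ) : ℝ :=
  (node R ℓ n).choose t * (A ^ (n / R) * β ^ (n % R))

lemma sum_range_succ_id (c : ℕ) : ∑ k ∈ range (c + 1), k = c * (c + 1) / 2 := by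
  rw [sum_range_id, Nat.add_sub_cancel, mul_comm]

lemma sum_sub_mod_eq (c S : ℕ) :
    ∑ n ∈ range ((2 * c + 1) * S), (c - n % (2 * c + 1)) = S * (c * (c + 1) / 2) := by
  rw [sum_range_blocks, sum_congr rfl fun l _ => sum_congr rfl fun k hk => by
    rw [Nat.mul_add_mod, Nat.mod_eq_of_lt (mem_range.1 hk)]]
  rw [sum_const, card_range, smul_eq_mul, show 2 * c + 1 = (c + 1) + c by ring, sum_range_add,
    sum_eq_zero (s := range c) fun k _ => by omega, add_zero, ← sum_range_succ_id,
    ← sum_range_reflect (fun k => k) (c + 1)]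
  rfl

lemma sum_mod_sub_eq (c S : ℕ) :
    ∑ n ∈ range ((2 * c + 1) * S), (n % (2 * c + 1) - c) = S * (c * (c + 1) / 2) := by
  rw [sum_range_blocks, sum_congr rfl fun l _ => sum_congr rfl fun k hk => by
    rw [Nat.mul_add_mod, Nat.mod_eq_of_lt (mem_range.1 hk)]]
  rw [sum_const, card_range, smul_eq_mul, show 2 * c + 1 = c + (c + 1) by ring, sum_range_add,
    sum_eq_zero (s := range c) fun k hk => by have := mem_range.1 hk; omega, zero_add,
    ← sum_range_succ_id]
  simp

lemma one_le_abs_det {c S ℓ T M : ℕ} (hTM : T + M = (2 * c + 1) * S) (hM : M = c * S)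
    (τ : Fin M → ℕ) {p q P Q : ℕ} (hq : 0 < q) (hQ : 0 < Q) (hPQ : Q ≤ P)
    (hdet : (rowMatrix (node (2 * c + 1) ℓ) T M
      fun i => powRow (2 * c + 1) ℓ (p / q) (P / Q) (τ i)).det ≠ 0) :
    1 ≤ |(rowMatrix (node (2 * c + 1) ℓ) T M
      fun i => powRow (2 * c + 1) ℓ (p / q) (P / Q) (τ i)).det| * (q : ℝ) ^ (S * M) *
        (Q : ℝ) ^ (S * (c * (c + 1))) := by
  classical
  set R := 2 * c + 1 with hR
  set W := rowMatrix (node R ℓ) T M fun i => powRow R ℓ (p / q) (P / Q) (τ i) with hW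
  set U := S * (c * (c + 1) / 2) with hU
  have hUU : S * (c * (c + 1)) = 2 * U := by
    obtain ⟨r, hr⟩ := (Nat.even_mul_succ_self c).two_dvd
    rw [hU, show c * (c + 1) = 2 * r from hr]
    simp
    ring
  have hq' : (q : ℝ) ≠ 0 := by exact_mod_cast hq.ne'
  have hQ' : (Q : ℝ) ≠ 0 := by exact_mod_cast hQ.ne'
  have hdet_int : ∃ z : ℤ, W.det * (q : ℝ) ^ (S * M) * (Q : ℝ) ^ (M * c + U) =
      z * (P : ℝ) ^ (M * c - U) := by
    have hterm : ∀ σ : Equiv.Perm (Fin T ⊕ Fin M), ∃ z : ℤ,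
        (∏ i, W (σ i) i) * (q : ℝ) ^ (S * M) * (Q : ℝ) ^ (M * c + U) =
          z * (P : ℝ) ^ (M * c - U) := by
      intro σ
      set I := univ.filter fun i => (σ i).isRight with hI
      have hIcard : I.card = M := by
        have : I = (univ.map Function.Embedding.inr : Finset (Fin T ⊕ Fin M)).map
            σ.symm.toEmbedding := by
          ext i
          simp only [hI, mem_filter, mem_univ, true_and, mem_map, Function.Embedding.inr_apply,
            Equiv.coe_toEmbedding, exists_exists_eq_and]
          constructor
          · intro h
            obtain ⟨j, hj⟩ := Sum.isRight_iff.1 h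
            exact ⟨j, by rw [← hj, Equiv.symm_apply_apply]⟩
          · rintro ⟨j, rfl⟩
            simp
        rw [this, card_map, card_map, card_univ, Fintype.card_fin]
      set l : Fin T ⊕ Fin M → ℕ := fun i => (finSumFinEquiv i : ℕ) / R with hl
      set k : Fin T ⊕ Fin M → ℕ := fun i => (finSumFinEquiv i : ℕ) % R with hk
      have hlI : ∑ i ∈ I, l i ≤ S * M := by
        refine (sum_le_card_nsmul I l S fun i _ => ?_).trans (by simp [hIcard, mul_comm])
        refine (Nat.div_lt_of_lt_mul ?_).le
        rw [← hTM]
        exact Fin.is_lt _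
      have hall : ∀ g : ℕ → ℕ, ∑ i ∈ I, g (finSumFinEquiv i) ≤ ∑ n ∈ range (R * S), g n := by
        intro g
        rw [← hTM, ← Fin.sum_univ_eq_sum_range, ← Equiv.sum_comp finSumFinEquiv]
        exact sum_le_sum_of_subset (subset_univ I)
      have hMc : M * c = ∑ i ∈ I, c := by rw [sum_const, hIcard, smul_eq_mul]
      have hk1 : ∑ i ∈ I, k i ≤ M * c + U := by
        rw [hMc, hU, ← sum_mod_sub_eq c S]
        refine le_trans ?_ (Nat.add_le_add_left (hall fun n => n % R - c) _)
        rw [← sum_add_distrib]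
        exact sum_le_sum fun i _ => by simp only [hk]; omega
      have hk2 : M * c - U ≤ ∑ i ∈ I, k i := by
        rw [Nat.sub_le_iff_le_add, hMc, hU, ← sum_sub_mod_eq c S]
        refine le_trans ?_ (Nat.add_le_add_left (hall fun n => c - n % R) _)
        rw [← sum_add_distrib]
        exact sum_le_sum fun i _ => by simp only [hk]; omega
      have hent : ∀ i, ∃ z : ℤ, W (σ i) i =
          z * if (σ i).isRight then ((p : ℝ) / q) ^ l i * ((P : ℝ) / Q) ^ k i else 1 := by
        intro i
        rcases hσ : σ i with t | j
        · exact ⟨((node R ℓ (finSumFinEquiv i)).choose t : ℕ), by simp [hW, rowMatrix]⟩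
        · exact ⟨((node R ℓ (finSumFinEquiv i)).choose (τ j) : ℕ), by
            simp [hW, rowMatrix, powRow, hl, hk]⟩
      choose z hz using hent
      refine ⟨(∏ i, z i) * (p ^ (∑ i ∈ I, l i) * q ^ (S * M - ∑ i ∈ I, l i)) *
        (P ^ (∑ i ∈ I, k i - (M * c - U)) * Q ^ (M * c + U - ∑ i ∈ I, k i)), ?_⟩
      rw [prod_congr rfl fun i _ => hz i, prod_mul_distrib, ← prod_filter, prod_mul_distrib,
        prod_pow_eq_pow_sum, prod_pow_eq_pow_sum]
      obtain ⟨a, ha⟩ := Nat.exists_eq_add_of_le hlI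
      obtain ⟨b, hb⟩ := Nat.exists_eq_add_of_le hk1
      obtain ⟨d, hd⟩ := Nat.exists_eq_add_of_le hk2
      change _ * ((_ : ℝ) ^ (∑ i ∈ I, l i) * (_ : ℝ) ^ (∑ i ∈ I, k i)) * _ * _ = _
      rw [ha, hb, Nat.add_sub_cancel_left, Nat.add_sub_cancel_left, hd, Nat.add_sub_cancel_left]
      push_cast
      simp only [div_pow, pow_add]
      field_simp
    choose z hz using hterm
    refine ⟨∑ σ : Equiv.Perm (Fin T ⊕ Fin M), (Equiv.Perm.sign σ : ℤ) * z σ, ?_⟩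
    rw [det_apply', sum_mul, sum_mul]
    push_cast
    rw [sum_mul]
    refine sum_congr rfl fun σ _ => ?_
    linear_combination ((Equiv.Perm.sign σ : ℤ) : ℝ) * hz σ
  obtain ⟨z, hz⟩ := hdet_int
  have hP : (0 : ℝ) < P := by exact_mod_cast hQ.trans_le hPQ
  have hQP : (Q : ℝ) ≤ P := by exact_mod_cast hPQ
  have hQ0 : (0 : ℝ) < Q := by exact_mod_cast hQ
  have hz1 : (1 : ℝ) ≤ |(z : ℝ)| := by
    have : z ≠ 0 := by
      rintro rfl
      rw [Int.cast_zero, zero_mul] at hz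
      have := mul_ne_zero (mul_ne_zero hdet (pow_ne_zero (S * M) hq'))
        (pow_ne_zero (M * c + U) hQ')
      exact this hz
    exact_mod_cast Int.one_le_abs this
  have hUM : U ≤ M * c := by
    rw [hU, hM, mul_comm c S, mul_assoc]
    refine Nat.mul_le_mul_left S ?_
    rw [Nat.div_le_iff_le_mul_add_pred two_pos]
    rcases c with _ | c
    · simp
    · nlinarith
  have habs := congrArg abs hz
  rw [abs_mul, abs_mul, abs_mul, abs_of_nonneg (by positivity : (0 : ℝ) ≤ (q : ℝ) ^ (S * M)),
    abs_of_nonneg (by positivity : (0 : ℝ) ≤ (Q : ℝ) ^ (M * c + U)),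
    abs_of_nonneg (by positivity : (0 : ℝ) ≤ (P : ℝ) ^ (M * c - U)),
    show M * c + U = (M * c - U) + S * (c * (c + 1)) by omega, pow_add] at habs
  have hge : (Q : ℝ) ^ (M * c - U) ≤ |(z : ℝ)| * (P : ℝ) ^ (M * c - U) := by
    calc (Q : ℝ) ^ (M * c - U) ≤ 1 * (P : ℝ) ^ (M * c - U) := by rw [one_mul]; gcongr
      _ ≤ _ := by gcongr
  rw [← habs] at hge
  have hQpos : (0 : ℝ) < (Q : ℝ) ^ (M * c - U) := by positivity
  refine le_of_mul_le_mul_left ?_ hQpos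
  linarith

end CubeSum

namespace CubeSum

open Finset Matrix

/-- The product of the factorials `t!` with `t < n`. -/
noncomputable def facProd (n : ℕ) : ℝ := ∏ t ∈ range n, (t.factorial : ℝ)

lemma facProd_pos (n : ℕ) : 0 < facProd n := prod_pos fun t _ => by positivity

lemma prod_prod_sub_eq_facProd (R : ℕ) :
    ∏ k ∈ range R, ∏ j ∈ range k, ((k : ℝ) - j) = facProd R := by
  refine prod_congr rfl fun k _ => ?_
  rw [← prod_range_add_one_eq_factorial, ← prod_range_reflect]
  push_cast
  refine prod_congr rfl fun j hj => ?_
  have hj' : j < k := mem_range.1 hj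
  rw [Nat.cast_sub (by omega), Nat.cast_sub (by omega)]
  push_cast
  ring

lemma prod_prod_add_sub_le {R : ℕ} {y : ℝ} (hy : (R : ℝ) ≤ y) :
    ∏ k ∈ range R, ∏ j ∈ range R, (y + k - j) ≤ y ^ R ^ 2 := by
  have hpos : ∀ k ∈ range R, ∀ j ∈ range R, 0 ≤ y + k - j := by
    intro k _ j hj
    have : (j : ℝ) ≤ R := by exact_mod_cast (mem_range.1 hj).le
    have : (0 : ℝ) ≤ k := by positivity
    linarith
  have hy0 : 0 ≤ y := le_trans (by positivity) hy
  refine abs_le_of_sq_le_sq' ?_ (by positivity) |>.2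
  calc (∏ k ∈ range R, ∏ j ∈ range R, (y + k - j)) ^ 2
      = ∏ k ∈ range R, ∏ j ∈ range R, ((y + k - j) * (y + j - k)) := by
        rw [sq]
        nth_rewrite 2 [prod_comm]
        simp only [← prod_mul_distrib]
    _ ≤ ∏ k ∈ range R, ∏ j ∈ range R, y ^ 2 := by
        refine prod_le_prod (fun k hk => prod_nonneg fun j hj =>
          mul_nonneg (hpos k hk j hj) (hpos j hj k hk)) fun k hk => ?_
        refine prod_le_prod (fun j hj => mul_nonneg (hpos k hk j hj) (hpos j hj k hk))
          fun j _ => ?_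
        nlinarith [sq_nonneg ((k : ℝ) - j)]
    _ = (y ^ R ^ 2) ^ 2 := by
        simp only [prod_const, card_range]
        ring

lemma vandermondeProd_node_le {R ℓ : ℕ} (hR : 0 < R) (hRℓ : R ≤ ℓ) (S : ℕ) :
    vandermondeProd (node R ℓ) (R * S) ≤
      facProd R ^ S * ∏ s ∈ range S, ((ℓ : ℝ) ^ s * s.factorial) ^ R ^ 2 := by
  induction S with
  | zero => simp [vandermondeProd]
  | succ S ih =>
    have hx := node_strictMono hR hRℓ
    have hstep : vandermondeProd (node R ℓ) (R * (S + 1)) = vandermondeProd (node R ℓ) (R * S) *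
        ((∏ l ∈ range S, ∏ k ∈ range R, ∏ j ∈ range R, ((((S - l : ℕ) : ℝ) * ℓ) + k - j)) *
          facProd R) := by
      rw [vandermondeProd, mul_add_one, prod_range_add, ← vandermondeProd]
      congr 1
      rw [← prod_prod_sub_eq_facProd, prod_comm, ← prod_mul_distrib]
      refine prod_congr rfl fun k hk => ?_
      have hk' : k < R := mem_range.1 hk
      rw [prod_range_add]
      congr 1
      · have := prod_range_blocks R S fun i => ((node R ℓ (R * S + k) : ℝ) - node R ℓ i)
        rw [this]
        refine prod_congr rfl fun l hl => prod_congr rfl fun j hj => ?_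
        rw [node_mul_add ℓ S hk', node_mul_add ℓ l (mem_range.1 hj),
          Nat.cast_sub (mem_range.1 hl).le]
        push_cast
        ring
      · refine prod_congr rfl fun j hj => ?_
        rw [node_mul_add ℓ S hk', node_mul_add ℓ S ((mem_range.1 hj).trans hk')]
        push_cast
        ring
    have hRy : ∀ l ∈ range S, (R : ℝ) ≤ ((S - l : ℕ) : ℝ) * ℓ := by
      intro l hl
      have hl' : 1 ≤ S - l := by
        have := mem_range.1 hl
        omega
      exact_mod_cast hRℓ.trans (Nat.le_mul_of_pos_left ℓ hl')
    have hnn : ∀ l ∈ range S,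
        0 ≤ ∏ k ∈ range R, ∏ j ∈ range R, ((((S - l : ℕ) : ℝ) * ℓ) + k - j) := by
      refine fun l hl => prod_nonneg fun k _ => prod_nonneg fun j hj => ?_
      have h1 : (j : ℝ) ≤ R := by exact_mod_cast (mem_range.1 hj).le
      have h2 : (0 : ℝ) ≤ k := by positivity
      linarith [hRy l hl]
    have hle : ∏ l ∈ range S, ∏ k ∈ range R, ∏ j ∈ range R, ((((S - l : ℕ) : ℝ) * ℓ) + k - j) ≤
        ((ℓ : ℝ) ^ S * S.factorial) ^ R ^ 2 := by
      have hfac : ∏ l ∈ range S, (((S - l : ℕ) : ℝ) * ℓ) = (ℓ : ℝ) ^ S * S.factorial := by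
        rw [prod_mul_distrib, prod_const, card_range, mul_comm, ← prod_range_add_one_eq_factorial,
          ← prod_range_reflect]
        push_cast
        congr 1
        refine prod_congr rfl fun j hj => ?_
        have hj' : j < S := mem_range.1 hj
        exact_mod_cast show S - (S - 1 - j) = j + 1 by omega
      rw [← hfac, ← prod_pow]
      exact prod_le_prod hnn fun l hl => prod_prod_add_sub_le (hRy l hl)
    rw [hstep, prod_range_succ, pow_succ]
    have h0 := (vandermondeProd_pos hx (R * S)).le
    have h1 := (facProd_pos R).le
    calc _ ≤ (facProd R ^ S * ∏ s ∈ range S, ((ℓ : ℝ) ^ s * s.factorial) ^ R ^ 2) *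
          (((ℓ : ℝ) ^ S * S.factorial) ^ R ^ 2 * facProd R) :=
          mul_le_mul ih (mul_le_mul_of_nonneg_right hle h1)
            (mul_nonneg (prod_nonneg hnn) h1) (by positivity)
      _ = _ := by ring

lemma abs_one_add_pow_sub_one_le {κ : ℝ} {l S : ℕ} (hl : l ≤ S) (h : S * |κ| ≤ 1) :
    |(1 + κ) ^ l - 1| ≤ 2 * S * |κ| := by
  have h1 : |(1 + κ) ^ l - 1| ≤ (1 + |κ|) ^ l - 1 := by
    clear hl h
    induction l with
    | zero => simp
    | succ l ih =>
      have h2 : |(1 + κ) ^ l| ≤ (1 + |κ|) ^ l := by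
        rw [abs_pow]
        exact pow_le_pow_left₀ (abs_nonneg _) ((abs_add_le _ _).trans (by simp)) l
      calc |(1 + κ) ^ (l + 1) - 1| = |((1 + κ) ^ l - 1) + κ * (1 + κ) ^ l| := by
            congr 1
            ring
        _ ≤ ((1 + |κ|) ^ l - 1) + |κ| * (1 + |κ|) ^ l := by
            refine (abs_add_le _ _).trans (add_le_add ih ?_)
            rw [abs_mul]
            gcongr
        _ = _ := by ring
  have hS : (1 + |κ|) ^ l ≤ Real.exp (S * |κ|) := by
    rw [Real.exp_nat_mul]
    calc (1 + |κ|) ^ l ≤ (1 + |κ|) ^ S := by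
          gcongr
          linarith [abs_nonneg κ]
      _ ≤ _ := by
          gcongr
          linarith [Real.add_one_le_exp |κ|]
  have h3 := Real.abs_exp_sub_one_le (x := S * |κ|) (by rwa [abs_of_nonneg (by positivity)])
  rw [abs_of_nonneg (a := (S : ℝ) * |κ|) (by positivity)] at h3
  linarith [le_abs_self (Real.exp (S * |κ|) - 1)]

lemma abs_dd_powRow_le {R ℓ S T t m : ℕ} (hR : 0 < R) (hRℓ : R ≤ ℓ) {A β κ ε : ℝ}
    (hm : m < R * S) (hβ : 1 ≤ β) (hβε : β - 1 ≤ ε) (hε : 0 < ε) (hε1 : ε ≤ 1) (htT : t < T)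
    (htm : t ≤ m) (hz : (S * ℓ : ℕ) * ε / T < 1) (hA : A = β ^ ℓ * (1 + κ))
    (hκ : β ^ (S * ℓ) * (2 * S * |κ|) * (2 / ε) ^ (R * S) ≤ 1) :
    |dd (node R ℓ) m (powRow R ℓ A β t)| ≤
      (2 * β ^ T * Real.exp T * (1 / (1 - (S * ℓ : ℕ) * ε / T) ^ (R * S)) *
        ((T / ε) ^ t / t.factorial)) * (ε / T) ^ m := by
  have hx := node_strictMono hR hRℓ
  have hT : 0 < T := by omega
  have hT' : (0 : ℝ) < T := by exact_mod_cast hT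
  have hnode : ∀ n < R * S, node R ℓ n ≤ S * ℓ := by
    intro n hn
    have h1 : n / R + 1 ≤ S := Nat.div_lt_of_lt_mul hn
    have h2 := Nat.mul_le_mul_right ℓ h1
    have h3 := Nat.mod_lt n hR
    rw [add_one_mul] at h2
    rw [node]
    omega
  set z : ℝ := (S * ℓ : ℕ) * ε / T with hzdef
  have hz0 : 0 ≤ z := by positivity
  have hsplit : dd (node R ℓ) m (powRow R ℓ A β t) =
      dd (node R ℓ) m (fun n => ((node R ℓ n).choose t : ℝ) * β ^ node R ℓ n) +
      dd (node R ℓ) m (fun n => ((node R ℓ n).choose t : ℝ) * β ^ node R ℓ n *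
        ((1 + κ) ^ (n / R) - 1)) := by
    rw [← dd_add]
    refine dd_congr _ _ fun n _ => ?_
    rw [powRow, hA, mul_pow, ← pow_mul, node, pow_add, mul_comm ℓ]
    ring
  have hmain := abs_dd_choose_mul_pow_le hx (hnode m hm) hβ hβε hε htm hT hz
  rw [← hzdef] at hmain
  have h2ε : 1 ≤ 2 / ε := by
    rw [le_div_iff₀ hε]
    linarith
  have hκ0 : 2 * S * |κ| ≤ 1 := by
    refine le_trans ?_ hκ
    have h1 : 1 ≤ β ^ (S * ℓ) := one_le_pow₀ hβ
    have h2 : 1 ≤ (2 / ε) ^ (R * S) := one_le_pow₀ h2ε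
    have h3 : 0 ≤ 2 * S * |κ| := by positivity
    calc 2 * S * |κ| = 1 * (2 * S * |κ|) * 1 := by ring
      _ ≤ _ := by gcongr
  have hpert : ∀ n ≤ m, |((node R ℓ n).choose t : ℝ) * β ^ node R ℓ n *
      ((1 + κ) ^ (n / R) - 1)| ≤ ((S * ℓ : ℕ) : ℝ) ^ t / t.factorial * β ^ (S * ℓ) *
        (2 * S * |κ|) := by
    intro n hn
    have hnm := hnode n (by omega)
    have hl : n / R ≤ S := (Nat.div_lt_of_lt_mul (by omega : n < R * S)).le
    have hk := abs_one_add_pow_sub_one_le hl (κ := κ) (by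
      have : 0 ≤ S * |κ| := by positivity
      linarith)
    have hch : ((node R ℓ n).choose t : ℝ) ≤ ((S * ℓ : ℕ) : ℝ) ^ t / t.factorial :=
      (Nat.choose_le_pow_div t (node R ℓ n)).trans (by gcongr)
    rw [abs_mul, abs_of_nonneg (by positivity : (0 : ℝ) ≤ ((node R ℓ n).choose t : ℝ) *
      β ^ node R ℓ n)]
    gcongr
  have hdd := abs_dd_le hx m hpert
  have hexp := Real.pow_div_factorial_le_exp (T : ℝ) hT'.le m
  have hpert' : ((S * ℓ : ℕ) : ℝ) ^ t / t.factorial * β ^ (S * ℓ) * (2 * S * |κ|) * 2 ^ m /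
      m.factorial ≤ Real.exp T * ((T / ε) ^ t / t.factorial) * (ε / T) ^ m := by
    calc ((S * ℓ : ℕ) : ℝ) ^ t / t.factorial * β ^ (S * ℓ) * (2 * S * |κ|) * 2 ^ m / m.factorial
        = (β ^ (S * ℓ) * (2 * S * |κ|) * (2 / ε) ^ m) * ((T : ℝ) ^ m / m.factorial) * z ^ t *
          (((T / ε) ^ t / t.factorial) * (ε / T) ^ m) := by
          rw [hzdef, div_pow, div_pow, div_pow, div_pow, mul_pow]
          field_simp
      _ ≤ 1 * Real.exp T * 1 * (((T / ε) ^ t / t.factorial) * (ε / T) ^ m) := by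
          gcongr
          · refine le_trans ?_ hκ
            gcongr
          · exact pow_le_one₀ hz0 hz.le
      _ = _ := by ring
  have hz1 : 0 < 1 - z := by linarith
  have hzN : 1 / (1 - z) ^ (m + 1) ≤ 1 / (1 - z) ^ (R * S) :=
    one_div_le_one_div_of_le (by positivity)
      (pow_le_pow_of_le_one hz1.le (by linarith) (by omega))
  have hz2 : 1 ≤ 1 / (1 - z) ^ (R * S) := by
    rw [le_div_iff₀ (by positivity), one_mul]
    exact pow_le_one₀ hz1.le (by linarith)
  have hβT : β ^ t ≤ β ^ T := pow_le_pow_right₀ hβ htT.le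
  have hβ1 : 1 ≤ β ^ T := one_le_pow₀ hβ
  have hψ : (0 : ℝ) ≤ ((T / ε) ^ t / t.factorial) * (ε / T) ^ m := by positivity
  have hmain' : β ^ t * (Real.exp T / t.factorial * (ε / T) ^ (m - t) *
      (1 / (1 - z) ^ (m + 1))) ≤ β ^ T * Real.exp T * (1 / (1 - z) ^ (R * S)) *
        (((T / ε) ^ t / t.factorial) * (ε / T) ^ m) := by
    have e : (ε / T) ^ (m - t) = (T / ε) ^ t * (ε / T) ^ m := by
      obtain ⟨d, rfl⟩ := Nat.exists_eq_add_of_le htm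
      rw [Nat.add_sub_cancel_left, pow_add, ← mul_assoc, ← mul_pow]
      rw [div_mul_div_comm, mul_comm (T : ℝ) ε, div_self (by positivity), one_pow, one_mul]
    rw [e]
    calc _ = β ^ t * Real.exp T * (1 / (1 - z) ^ (m + 1)) *
          (((T / ε) ^ t / t.factorial) * (ε / T) ^ m) := by ring
      _ ≤ _ := by gcongr
  have hpert'' : Real.exp T * ((T / ε) ^ t / t.factorial) * (ε / T) ^ m ≤
      β ^ T * Real.exp T * (1 / (1 - z) ^ (R * S)) *
        (((T / ε) ^ t / t.factorial) * (ε / T) ^ m) := by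
    calc _ = 1 * Real.exp T * 1 * (((T / ε) ^ t / t.factorial) * (ε / T) ^ m) := by ring
      _ ≤ _ := by gcongr
  rw [hsplit]
  refine (abs_add_le _ _).trans ?_
  linarith

lemma abs_det_rowMatrix_le {R ℓ S T M : ℕ} (hR : 0 < R) (hRℓ : R ≤ ℓ) (hTM : T + M = R * S)
    {A β κ ε : ℝ} (hβ : 1 ≤ β) (hβε : β - 1 ≤ ε) (hε : 0 < ε) (hε1 : ε ≤ 1)
    (hz : (S * ℓ : ℕ) * ε / T < 1) (hA : A = β ^ ℓ * (1 + κ))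
    (hκ : β ^ (S * ℓ) * (2 * S * |κ|) * (2 / ε) ^ (R * S) ≤ 1)
    {τ : Fin M → Fin T} (hτ : Function.Injective τ) :
    |(rowMatrix (node R ℓ) T M fun i => powRow R ℓ A β (τ i)).det| ≤
      facProd R ^ S * (∏ s ∈ range S, ((ℓ : ℝ) ^ s * s.factorial) ^ R ^ 2) *
        (∏ t ∈ range T, (1 / (t.factorial : ℝ))) * (M.factorial *
        ((2 * β ^ T * Real.exp T * (1 / (1 - (S * ℓ : ℕ) * ε / T) ^ (R * S))) ^ M *
          (∏ t ∈ range T, ((T / ε) ^ t / t.factorial)) * ∏ m ∈ range M, (ε / T) ^ (T + m))) := by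
  have hx := node_strictMono hR hRℓ
  have hz1 : 0 < 1 - (S * ℓ : ℕ) * ε / T := by linarith
  set D := 2 * β ^ T * Real.exp T * (1 / (1 - (S * ℓ : ℕ) * ε / T) ^ (R * S)) with hD
  have hD0 : 0 ≤ D := by positivity
  have hent : ∀ i m, |(of fun i (m : Fin M) =>
      dd (node R ℓ) (T + m) (powRow R ℓ A β (τ i))) i m| ≤
      (D * ((T / ε) ^ (τ i : ℕ) / (τ i : ℕ).factorial)) * (ε / T) ^ (T + m : ℕ) := fun i m =>
    abs_dd_powRow_le hR hRℓ (by omega) hβ hβε hε hε1 (τ i).2 (by omega) hz hA hκ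
  have hB := abs_det_le_factorial_mul hent
  have hψ : ∀ t : Fin T, (1 : ℝ) ≤ (T / ε) ^ (t : ℕ) / (t : ℕ).factorial := by
    intro t
    rw [le_div_iff₀ (by positivity), one_mul]
    have h1 : ((t : ℕ).factorial : ℝ) ≤ (T : ℝ) ^ (t : ℕ) := by
      exact_mod_cast (Nat.factorial_le_pow _).trans (Nat.pow_le_pow_left t.2.le _)
    refine h1.trans ?_
    gcongr
    rw [le_div_iff₀ hε]
    exact mul_le_of_le_one_right (by positivity) hε1
  have hprod : ∏ i, (D * ((T / ε) ^ (τ i : ℕ) / (τ i : ℕ).factorial)) ≤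
      D ^ M * ∏ t ∈ range T, ((T / ε) ^ t / t.factorial) := by
    rw [prod_mul_distrib, prod_const, card_univ, Fintype.card_fin,
      ← Fin.prod_univ_eq_prod_range (fun t => ((T : ℝ) / ε) ^ t / (t.factorial : ℝ)) T]
    refine mul_le_mul_of_nonneg_left ?_ (by positivity)
    refine (prod_map univ ⟨τ, hτ⟩ fun t : Fin T =>
      ((T : ℝ) / ε) ^ (t : ℕ) / ((t : ℕ).factorial : ℝ)).symm.trans_le ?_
    exact prod_le_prod_of_subset_of_one_le (subset_univ _) (fun t _ => zero_le_one.trans (hψ t))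
      fun t _ _ => hψ t
  rw [Fin.prod_univ_eq_prod_range (fun m => (ε / (T : ℝ)) ^ (T + m)) M] at hB
  rw [det_rowMatrix hx, abs_mul, abs_of_nonneg (mul_nonneg (vandermondeProd_pos hx _).le
    (prod_nonneg fun t _ => by positivity)), hTM]
  have hV := vandermondeProd_node_le hR hRℓ S
  gcongr
  · exact mul_nonneg (mul_nonneg (pow_nonneg (facProd_pos R).le _)
      (prod_nonneg fun s _ => by positivity)) (prod_nonneg fun t _ => by positivity)
  · refine hB.trans ?_
    gcongr

end CubeSum

namespace CubeSum

open Finset Real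

lemma log_factorial_le {n : ℕ} (hn : 0 < n) :
    log n.factorial ≤ (n + 1 / 2) * log n - n + 1 := by
  obtain ⟨m, rfl⟩ := Nat.exists_eq_succ_of_ne_zero hn.ne'
  have h := Stirling.log_stirlingSeq'_antitone (Nat.zero_le m)
  simp only [Function.comp_apply] at h
  rw [Stirling.log_stirlingSeq_formula, Stirling.log_stirlingSeq_formula] at h
  have hm : (0 : ℝ) < (m.succ : ℕ) := by positivity
  rw [log_mul two_ne_zero hm.ne', log_div hm.ne' (exp_ne_zero 1), log_exp] at h
  simp at h ⊢
  linarith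

/-- The main part of `log (facProd n)`. -/
noncomputable def facMain (n : ℕ) : ℝ := (n : ℝ) ^ 2 / 2 * log n - 3 / 4 * (n : ℝ) ^ 2

lemma facMain_succ {n : ℕ} (hn : 0 < n) :
    facMain (n + 1) - facMain n = (n + 1 / 2) * log n + (n + 1 : ℝ) ^ 2 / 2 * log (1 + 1 / n) -
      3 / 2 * n - 3 / 4 := by
  have hn' : (0 : ℝ) < n := by exact_mod_cast hn
  have : log (1 + 1 / n) = log ((n : ℝ) + 1) - log n := by
    rw [← log_div (by positivity) hn'.ne']
    congr 1
    field_simp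
  rw [this, facMain, facMain]
  push_cast
  ring

lemma log_facProd_succ (n : ℕ) : log (facProd (n + 1)) = log (facProd n) + log n.factorial := by
  rw [facProd, prod_range_succ, ← facProd, log_mul (facProd_pos n).ne' (by positivity)]

lemma facMain_le_log_facProd (n : ℕ) : facMain n ≤ log (facProd n) := by
  induction n with
  | zero => simp [facMain, facProd]
  | succ n ih =>
    rcases Nat.eq_zero_or_pos n with rfl | hn
    · norm_num [facMain, facProd]
    have h := facMain_succ hn
    have hn' : (1 : ℝ) ≤ n := by exact_mod_cast hn
    have h1 : log (1 + 1 / n) ≤ 1 / n := by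
      have := log_le_sub_one_of_pos (x := 1 + 1 / (n : ℝ)) (by positivity)
      linarith
    have h2 : (n + 1 : ℝ) ^ 2 / 2 * log (1 + 1 / n) ≤ (n : ℝ) / 2 + 3 / 2 := by
      calc (n + 1 : ℝ) ^ 2 / 2 * log (1 + 1 / n) ≤ (n + 1 : ℝ) ^ 2 / 2 * (1 / n) := by gcongr
        _ ≤ (n : ℝ) / 2 + 3 / 2 := by
          rw [mul_one_div, div_le_iff₀ (by linarith)]
          nlinarith
    have h3 := Stirling.le_log_factorial_stirling hn.ne'
    have h4 : (3 / 2 : ℝ) ≤ log (2 * π) := by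
      rw [le_log_iff_exp_le (by positivity)]
      have h5 : exp (3 / 2) ^ 2 = exp 1 ^ 3 := by
        rw [← exp_nat_mul, ← exp_nat_mul]
        norm_num
      have h6 : exp 1 ^ 3 ≤ 2.7182818286 ^ 3 := by
        gcongr
        exact exp_one_lt_d9.le
      have h7 := pi_gt_three
      refine le_of_sq_le_sq ?_ (by positivity)
      nlinarith
    rw [log_facProd_succ]
    linarith

lemma log_facProd_le (n : ℕ) : log (facProd n) ≤ facMain n + n := by
  induction n with
  | zero => simp [facMain, facProd]
  | succ n ih =>
    rcases Nat.eq_zero_or_pos n with rfl | hn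
    · norm_num [facMain, facProd]
    have h := facMain_succ hn
    have hn' : (1 : ℝ) ≤ n := by exact_mod_cast hn
    have h1 : 2 / (2 * n + 1) ≤ log (1 + 1 / (n : ℝ)) := by
      refine le_trans (le_of_eq ?_) (le_log_one_add_of_nonneg (x := 1 / (n : ℝ)) (by positivity))
      field_simp
      ring
    have h2 : (n : ℝ) / 2 + 3 / 4 ≤ (n + 1 : ℝ) ^ 2 / 2 * log (1 + 1 / n) := by
      calc (n : ℝ) / 2 + 3 / 4 ≤ (n + 1 : ℝ) ^ 2 / 2 * (2 / (2 * n + 1)) := by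
            rw [mul_div_assoc', le_div_iff₀ (by positivity)]
            nlinarith
        _ ≤ _ := by gcongr
    have h3 := log_factorial_le hn
    rw [log_facProd_succ]
    push_cast
    linarith

end CubeSum

namespace CubeSum

open Finset Real

lemma sum_range_cast (n : ℕ) : ∑ t ∈ range n, (t : ℝ) = n * (n - 1) / 2 := by
  induction n with
  | zero => simp
  | succ n ih => rw [sum_range_succ, ih]; push_cast; ring

lemma log_facProd (n : ℕ) : log (facProd n) = ∑ t ∈ range n, log (t.factorial : ℝ) :=
  log_prod fun t _ => by positivity

lemma log_det_bound {R ℓ S T M : ℕ} (hℓ : 0 < ℓ) (hT : 0 < T) {β ε z : ℝ} (hβ : 0 < β)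
    (hε : 0 < ε) (hz : z < 1) :
    log (facProd R ^ S * (∏ s ∈ range S, ((ℓ : ℝ) ^ s * s.factorial) ^ R ^ 2) *
        (∏ t ∈ range T, (1 / (t.factorial : ℝ))) * (M.factorial *
        ((2 * β ^ T * Real.exp T * (1 / (1 - z) ^ (R * S))) ^ M *
          (∏ t ∈ range T, ((T / ε) ^ t / t.factorial)) * ∏ m ∈ range M, (ε / T) ^ (T + m)))) =
      S * log (facProd R) + R ^ 2 * (S * (S - 1) / 2 * log ℓ + log (facProd S)) -
        2 * log (facProd T) + log M.factorial +
        M * (log 2 + T * log β + T - R * S * log (1 - z)) +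
        ((T * (T - 1) / 2 : ℝ) - (M * T + M * (M - 1) / 2)) * (log T - log ε) := by
  have hℓ' : (0 : ℝ) < ℓ := by exact_mod_cast hℓ
  have hT' : (0 : ℝ) < T := by exact_mod_cast hT
  have hz' : 0 < 1 - z := by linarith
  have h1 : log (∏ s ∈ range S, ((ℓ : ℝ) ^ s * s.factorial) ^ R ^ 2) =
      R ^ 2 * (S * (S - 1) / 2 * log ℓ + log (facProd S)) := by
    rw [log_prod fun s _ => by positivity, log_facProd, ← sum_range_cast, sum_mul,
      ← sum_add_distrib, mul_sum]
    refine sum_congr rfl fun s _ => ?_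
    rw [log_pow, log_mul (by positivity) (by positivity), log_pow]
    push_cast
    ring
  have h2 : log (∏ t ∈ range T, (1 / (t.factorial : ℝ))) = - log (facProd T) := by
    rw [log_prod fun s _ => by positivity, log_facProd, ← sum_neg_distrib]
    exact sum_congr rfl fun s _ => by rw [one_div, log_inv]
  have h3 : log (∏ t ∈ range T, ((T / ε) ^ t / (t.factorial : ℝ))) =
      T * (T - 1) / 2 * (log T - log ε) - log (facProd T) := by
    rw [log_prod fun s _ => by positivity, log_facProd, ← sum_range_cast, sum_mul,
      ← sum_sub_distrib]
    refine sum_congr rfl fun s _ => ?_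
    rw [log_div (by positivity) (by positivity), log_pow, log_div hT'.ne' hε.ne']
  have h4 : log (∏ m ∈ range M, (ε / T) ^ (T + m)) =
      - (M * T + M * (M - 1) / 2) * (log T - log ε) := by
    rw [log_prod fun s _ => by positivity, ← sum_range_cast]
    have : ∀ m ∈ range M, log ((ε / (T : ℝ)) ^ (T + m)) = (T + m) * (log ε - log T) := by
      intro m _
      rw [log_pow, log_div hε.ne' hT'.ne']
      push_cast
      ring
    rw [sum_congr rfl this, ← sum_mul, sum_add_distrib]
    simp
    ring
  have p1 : (facProd R ^ S) ≠ 0 := (pow_pos (facProd_pos R) S).ne'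
  have p2 : (∏ s ∈ range S, ((ℓ : ℝ) ^ s * s.factorial) ^ R ^ 2) ≠ 0 := by positivity
  have p3 : (∏ t ∈ range T, (1 / (t.factorial : ℝ))) ≠ 0 := by positivity
  have p4 : (∏ t ∈ range T, ((T / ε) ^ t / (t.factorial : ℝ))) ≠ 0 := by positivity
  have p5 : (∏ m ∈ range M, (ε / (T : ℝ)) ^ (T + m)) ≠ 0 := by positivity
  have p6 : (2 * β ^ T * Real.exp T * (1 / (1 - z) ^ (R * S))) ≠ 0 := by positivity
  have p7 : (M.factorial : ℝ) ≠ 0 := by positivity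
  rw [log_mul (mul_ne_zero (mul_ne_zero p1 p2) p3) (mul_ne_zero p7
      (mul_ne_zero (mul_ne_zero (pow_ne_zero _ p6) p4) p5)),
    log_mul (mul_ne_zero p1 p2) p3, log_mul p1 p2,
    log_mul p7 (mul_ne_zero (mul_ne_zero (pow_ne_zero _ p6) p4) p5),
    log_mul (mul_ne_zero (pow_ne_zero _ p6) p4) p5, log_mul (pow_ne_zero _ p6) p4,
    h1, h2, h3, h4, log_pow, log_pow, log_mul (by positivity) (by positivity),
    log_mul (by positivity) (by positivity), log_mul (by positivity) (by positivity),
    log_pow, log_exp, one_div, log_inv, log_pow]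
  push_cast
  ring

end CubeSum

namespace CubeSum

open Finset Real

lemma det_exponent_neg {c S a b lR lℓ lam H lq lz lβ l2 FR FS FT LM : ℝ}
    (hc : 2300 ≤ c) (hS : 3 ≤ S)
    (ha : 0 ≤ a) (hb : 0 ≤ b) (hlam : 6.907 ≤ lam) (hH : H ≤ 3 * S) (hlq : lq ≤ 24)
    (hlz : -0.009 ≤ lz) (hlβ : lβ ≤ 0.001) (hl2 : l2 ≤ 0.7) (hlℓ : lℓ ≤ a + 2.08)
    (hlR : lR + 1 / 2 ≤ lℓ)
    (hFR : FR ≤ (2 * c + 1) ^ 2 / 2 * lR - 3 / 4 * (2 * c + 1) ^ 2 + (2 * c + 1))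
    (hFS : FS ≤ S ^ 2 / 2 * b - 3 / 4 * S ^ 2 + S)
    (hFT : ((c + 1) * S) ^ 2 / 2 * (a + b) - 3 / 4 * ((c + 1) * S) ^ 2 ≤ FT)
    (hLM : LM ≤ c * S * (c / 1000 + 6 + S)) :
    S * FR + (2 * c + 1) ^ 2 * (S * (S - 1) / 2 * lℓ + FS) - 2 * FT + LM +
      c * S * (l2 + (c + 1) * S * lβ + (c + 1) * S - (2 * c + 1) * S * lz) +
      ((c + 1) * S * ((c + 1) * S - 1) / 2 - (c * S * ((c + 1) * S) + c * S * (c * S - 1) / 2)) *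
        (a + b + lam) + S * (c * S) * lq + S * (c * (c + 1)) * H < 0 := by
  have hc0 : 0 < c := by linarith
  have hS0 : 0 < S := by linarith
  have k1 := mul_le_mul_of_nonneg_left hFR hS0.le
  have k2 := mul_le_mul_of_nonneg_left hFS (sq_nonneg (2 * c + 1))
  have k3 := mul_le_mul_of_nonneg_left hlℓ (by positivity : 0 ≤ (2 * c + 1) ^ 2 * S ^ 2 / 2)
  have k4 := mul_le_mul_of_nonneg_left hlR (by positivity : 0 ≤ (2 * c + 1) ^ 2 * S / 2)
  have k5 := mul_le_mul_of_nonneg_left hl2 (by positivity : 0 ≤ c * S)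
  have k6 := mul_le_mul_of_nonneg_left hlβ (by positivity : 0 ≤ c * S * ((c + 1) * S))
  have k7 := mul_le_mul_of_nonneg_left hlz (by positivity : 0 ≤ c * S * ((2 * c + 1) * S))
  have k8 := mul_le_mul_of_nonneg_left hlq (by positivity : 0 ≤ S * (c * S))
  have k9 := mul_le_mul_of_nonneg_left hH (by positivity : 0 ≤ S * (c * (c + 1)))
  have k10 := mul_le_mul_of_nonneg_left hlam
    (by nlinarith : 0 ≤ S ^ 2 * (c ^ 2 - 1 / 2) + S / 2)
  have k11 := mul_nonneg ha hS0.le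
  have k12 := mul_nonneg hb hS0.le
  have m1 : 0 ≤ S * (S - 3) * (2 * c + 1) ^ 2 := by
    have : 0 ≤ S - 3 := by linarith
    positivity
  have m2 : 0 ≤ S * (S - 3) * (c ^ 2) := by
    have : 0 ≤ S - 3 := by linarith
    positivity
  have m3 : 0 ≤ S * (S - 3) * c := by
    have : 0 ≤ S - 3 := by linarith
    positivity
  have m4 : 0 ≤ S * (S - 3) := by
    have : 0 ≤ S - 3 := by linarith
    positivity
  have m5 : 0 ≤ S ^ 2 * (c * (c - 2300)) := by
    have : 0 ≤ c - 2300 := by linarith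
    positivity
  have m6 : 0 ≤ S ^ 2 * (c - 2300) := by
    have : 0 ≤ c - 2300 := by linarith
    positivity
  have m7 : 0 < S ^ 2 := by positivity
  nlinarith

end CubeSum

namespace CubeSum

open Finset Real

lemma log_thousand_bounds : 6.907 ≤ log 1000 ∧ log 1000 ≤ 6.909 := by
  have h2 := log_two_gt_d9
  have h2' := log_two_lt_d9
  have e : log 1000 = 10 * log 2 - log 1.024 := by
    rw [show (1000 : ℝ) = 2 ^ 10 / 1.024 by norm_num, log_div (by norm_num) (by norm_num), log_pow]
    norm_num
  have h3 := log_le_sub_one_of_pos (show (0 : ℝ) < 1.024 by norm_num)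
  have h4 := one_sub_inv_le_log_of_pos (show (0 : ℝ) < 1.024 by norm_num)
  norm_num at h3 h4
  constructor <;> linarith

lemma ten_pow_le_exp : 2 * (10 : ℝ) ^ 10 ≤ exp 24 := by
  have : exp 24 = exp 1 ^ 24 := by rw [← exp_nat_mul]; norm_num
  rw [this]
  refine le_trans ?_ (pow_le_pow_left₀ (by norm_num)
    (show (2.7 : ℝ) ≤ exp 1 by linarith [exp_one_gt_d9]) 24)
  norm_num

lemma exists_height_step {H : ℝ} (hH : 6.907 ≤ H) :
    ∃ S : ℕ, 3 ≤ S ∧ H ≤ 3 * S ∧ 2.25 * (S : ℝ) ≤ H := by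
  have h0 := Nat.le_ceil (H / 3)
  have h2 : 2 < ⌈H / 3⌉₊ := Nat.lt_ceil.2 (by push_cast; linarith)
  refine ⟨⌈H / 3⌉₊, h2, by linarith, ?_⟩
  rcases Nat.lt_or_ge 3 ⌈H / 3⌉₊ with h | h
  · have h1 := Nat.ceil_lt_add_one (show 0 ≤ H / 3 by linarith)
    have h2 : (4 : ℝ) ≤ ⌈H / 3⌉₊ := by exact_mod_cast h
    linarith
  · have h2 : (⌈H / 3⌉₊ : ℝ) ≤ 3 := by exact_mod_cast h
    linarith

lemma perturbation_le_one {ℓ c S Q : ℕ} (hc : 8 * c ≤ ℓ) (hℓ : 18400 ≤ ℓ) (hQ : 0 < Q)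
    (hS : 2.25 * (S : ℝ) ≤ log Q) (hS3 : 3 ≤ S) {β κ : ℝ} (hβ : 0 < β) (hβℓ : ℓ * log β ≤ 24)
    (hκ : |κ| ≤ 10 ^ 10 / (Q : ℝ) ^ ℓ) :
    β ^ (S * ℓ) * (2 * S * |κ|) * (2 / (1 / 1000 : ℝ)) ^ ((2 * c + 1) * S) ≤ 1 := by
  have hSr : (3 : ℝ) ≤ S := by exact_mod_cast hS3
  have hℓr : (18400 : ℝ) ≤ ℓ := by exact_mod_cast hℓ
  have hcr : (8 : ℝ) * c ≤ ℓ := by exact_mod_cast hc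
  have h1 : β ^ (S * ℓ) ≤ exp (24 * S) := by
    rw [← log_le_iff_le_exp (by positivity), log_pow]
    push_cast
    nlinarith
  have h2 : (2 * S * |κ|) ≤ exp (1 + S + 24 - ℓ * log Q) := by
    have e1 : (2 : ℝ) ≤ exp 1 := by linarith [add_one_le_exp (1 : ℝ)]
    have e2 : (S : ℝ) ≤ exp S := by linarith [add_one_le_exp (S : ℝ)]
    have e3 : (10 : ℝ) ^ 10 ≤ exp 24 := by linarith [ten_pow_le_exp]
    have e4 : (Q : ℝ) ^ ℓ = exp (ℓ * log Q) := by
      rw [exp_nat_mul, exp_log (by positivity)]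
    rw [e4] at hκ
    calc 2 * S * |κ| ≤ exp 1 * exp S * (exp 24 / exp (ℓ * log Q)) := by
          gcongr
          exact hκ.trans (by gcongr)
      _ = _ := by rw [← exp_sub, ← exp_add, ← exp_add]; congr 1; ring
  have h3 : (2 / (1 / 1000 : ℝ)) ^ ((2 * c + 1) * S) ≤ exp (7.608 * ((2 * c + 1) * S)) := by
    rw [← log_le_iff_le_exp (by positivity), log_pow]
    have : log (2 / (1 / 1000)) ≤ 7.608 := by
      rw [show (2 / (1 / 1000) : ℝ) = 2 * 1000 by norm_num, log_mul (by norm_num) (by norm_num)]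
      linarith [log_two_lt_d9, log_thousand_bounds.2]
    push_cast
    rw [mul_comm]
    gcongr
  calc _ ≤ exp (24 * S) * exp (1 + S + 24 - ℓ * log Q) * exp (7.608 * ((2 * c + 1) * S)) := by
        gcongr
    _ = exp (24 * S + (1 + S + 24 - ℓ * log Q) + 7.608 * ((2 * c + 1) * S)) := by
        rw [exp_add, exp_add]
    _ ≤ 1 := by
      rw [exp_le_one_iff]
      have k1 := mul_le_mul_of_nonneg_left hS (by linarith : (0 : ℝ) ≤ ℓ)
      have k2 := mul_le_mul_of_nonneg_left hcr (by linarith : (0 : ℝ) ≤ S)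
      have k3 := mul_le_mul_of_nonneg_left hℓr (by linarith : (0 : ℝ) ≤ S)
      linarith

lemma log_det_bound_nonneg {R ℓ S T M q Q K : ℕ} (hℓ : 0 < ℓ) (hT : 0 < T) (hq : 0 < q) (hQ : 0 < Q)
    {β ε z D : ℝ} (hβ : 0 < β) (hε : 0 < ε) (hz : z < 1)
    (hlow : 1 ≤ D * (q : ℝ) ^ (S * M) * (Q : ℝ) ^ K)
    (hup : D ≤ facProd R ^ S * (∏ s ∈ range S, ((ℓ : ℝ) ^ s * s.factorial) ^ R ^ 2) *
        (∏ t ∈ range T, (1 / (t.factorial : ℝ))) * (M.factorial *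
        ((2 * β ^ T * Real.exp T * (1 / (1 - z) ^ (R * S))) ^ M *
          (∏ t ∈ range T, ((T / ε) ^ t / t.factorial)) * ∏ m ∈ range M, (ε / T) ^ (T + m)))) :
    0 ≤ S * log (facProd R) + R ^ 2 * (S * (S - 1) / 2 * log ℓ + log (facProd S)) -
        2 * log (facProd T) + log M.factorial +
        M * (log 2 + T * log β + T - R * S * log (1 - z)) +
        ((T * (T - 1) / 2 : ℝ) - (M * T + M * (M - 1) / 2)) * (log T - log ε) +
        S * M * log q + K * log Q := by
  have hq' : (0 : ℝ) < q := by exact_mod_cast hq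
  have hQ' : (0 : ℝ) < Q := by exact_mod_cast hQ
  have hD : 0 < D := by
    by_contra! h
    have : D * (q : ℝ) ^ (S * M) * (Q : ℝ) ^ K ≤ 0 := by
      rw [mul_assoc]
      exact mul_nonpos_of_nonpos_of_nonneg h (by positivity)
    linarith
  have h0 := log_nonneg hlow
  rw [log_mul (by positivity) (by positivity), log_mul (by positivity) (by positivity), log_pow,
    log_pow] at h0
  have h1 := log_le_log hD hup
  rw [log_det_bound hℓ hT hβ hε hz] at h1
  push_cast at h0
  linarith

lemma no_close_power {ℓ p q P Q : ℕ} (hℓ : 18400 ≤ ℓ) (hq : 0 < q) (hq1 : q ≤ 10 ^ 10)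
    (hp : p ≤ 10 ^ 10 * q) (hQP : Q < P) (hPQ : 1000 * P ≤ 1001 * Q) {κ : ℝ}
    (hA : (p / q : ℝ) = (P / Q : ℝ) ^ ℓ * (1 + κ)) (hκ : |κ| ≤ 10 ^ 10 / (Q : ℝ) ^ ℓ) : False := by
  have hQ1 : 1000 ≤ Q := by omega
  have hQ : 0 < Q := by omega
  have hQr : (1000 : ℝ) ≤ Q := by exact_mod_cast hQ1
  have hq' : (0 : ℝ) < q := by exact_mod_cast hq
  obtain ⟨hlam1, hlam2⟩ := log_thousand_bounds
  have hH1 : 6.907 ≤ log Q := hlam1.trans (log_le_log (by norm_num) hQr)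
  obtain ⟨S, hS2, hS1, hS3⟩ := exists_height_step hH1
  have hS2r : (3 : ℝ) ≤ S := by exact_mod_cast hS2
  obtain ⟨c, hc, hc8, hc8'⟩ : ∃ c, 2300 ≤ c ∧ 8 * c ≤ ℓ ∧ ℓ ≤ 8 * (c + 1) :=
    ⟨ℓ / 8, by omega, by omega, by omega⟩
  have hcr : (2300 : ℝ) ≤ c := by exact_mod_cast hc
  have hℓr : (18400 : ℝ) ≤ ℓ := by exact_mod_cast hℓ
  have hc8r : (8 : ℝ) * c ≤ ℓ := by exact_mod_cast hc8
  have hc8r' : (ℓ : ℝ) ≤ 8 * (c + 1) := by exact_mod_cast hc8'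
  -- the perturbation is tiny
  have hκ1 : |κ| ≤ 1 / 2 := by
    refine hκ.trans ?_
    rw [div_le_iff₀ (by positivity)]
    have : (1000 : ℝ) ^ 4 ≤ Q ^ ℓ :=
      (pow_le_pow_left₀ (by norm_num) hQr 4).trans (pow_le_pow_right₀ (by linarith) (by omega))
    linarith
  have hκ2 := abs_le.1 hκ1
  set β : ℝ := P / Q with hβdef
  have hβ1 : 1 < β := by
    rw [hβdef, one_lt_div (by positivity)]
    exact_mod_cast hQP
  have hβε : β - 1 ≤ 1 / 1000 := by
    have : (1000 : ℝ) * P ≤ 1001 * Q := by exact_mod_cast hPQ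
    have : β ≤ 1001 / 1000 := by
      rw [hβdef, div_le_div_iff₀ (by positivity) (by norm_num)]
      linarith
    linarith
  have hβ0 : 0 < β := by linarith
  have hA0 : (p / q : ℝ) ≠ 0 := by
    rw [hA]
    have : 0 < 1 + κ := by linarith
    positivity
  have hlβ : log β ≤ 0.001 := by
    have := log_le_sub_one_of_pos hβ0
    linarith
  have hβℓ : ℓ * log β ≤ 24 := by
    rw [← log_pow, log_le_iff_le_exp (by positivity)]
    have h1 : (p / q : ℝ) ≤ 10 ^ 10 := by
      rw [div_le_iff₀ hq']
      exact_mod_cast hp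
    have h2 : β ^ ℓ ≤ 2 * 10 ^ 10 := by
      have : β ^ ℓ * (1 / 2) ≤ β ^ ℓ * (1 + κ) := by gcongr; linarith
      linarith
    exact h2.trans ten_pow_le_exp
  have hTM : (c + 1) * S + c * S = (2 * c + 1) * S := by ring
  have hT0 : 0 < (c + 1) * S := by positivity
  have hRℓ : 2 * c + 1 ≤ ℓ := by omega
  obtain ⟨τ, hτ, hdet⟩ := exists_rows (x := node (2 * c + 1) ℓ) (T := (c + 1) * S) (M := c * S)
    (G := fun t : Fin ((c + 1) * S) => powRow (2 * c + 1) ℓ (p / q) β t)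
    (node_strictMono (by omega) hRℓ) (by
      intro a h1 h2
      rw [hTM] at h1 h2 ⊢
      refine eq_zero_of_sum_choose_eq_zero (by omega) hRℓ (T := (c + 1) * S) (by nlinarith)
        hA0 hβ0.ne' hβ1.ne' h1 fun t ht => h2 ⟨t, ht⟩)
  have hz : ((S * ℓ : ℕ) : ℝ) * (1 / 1000) / ((c + 1) * S : ℕ) ≤ 0.008 := by
    rw [div_le_iff₀ (by positivity)]
    push_cast
    nlinarith
  have hz1 : ((S * ℓ : ℕ) : ℝ) * (1 / 1000) / ((c + 1) * S : ℕ) < 1 := hz.trans_lt (by norm_num)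
  have hlow := one_le_abs_det hTM rfl (fun i => (τ i : ℕ)) hq hQ hQP.le hdet
  have hup := abs_det_rowMatrix_le (S := S) (by omega) hRℓ hTM hβ1.le hβε (by norm_num)
    (by norm_num) hz1 hA (perturbation_le_one hc8 hℓ hQ hS3 hS2 hβ0 hβℓ hκ) hτ
  have hlog0 := log_det_bound_nonneg (by omega) hT0 hq hQ hβ0 (by norm_num) hz1 hlow hup
  refine absurd hlog0 (not_le.2 ?_)
  have hTlog : log ((c + 1) * S : ℕ) = log (c + 1) + log S := by
    push_cast
    exact log_mul (by positivity) (by positivity)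
  generalize hzdef : ((S * ℓ : ℕ) : ℝ) * (1 / 1000) / ((c + 1) * S : ℕ) = z at *
  have key := det_exponent_neg (c := c) (S := S) (a := log (c + 1)) (b := log S)
    (lR := log (2 * c + 1 : ℕ))
    (lℓ := log ℓ) (lam := log 1000) (H := log Q) (lq := log q) (lz := log (1 - z)) (lβ := log β)
    (l2 := log 2) (FR := log (facProd (2 * c + 1))) (FS := log (facProd S))
    (FT := log (facProd ((c + 1) * S)))
    (LM := log (c * S).factorial) hcr hS2r (log_nonneg (by linarith)) (log_nonneg (by linarith))
    hlam1 hS1 ?_ ?_ hlβ (by linarith [log_two_lt_d9]) ?_ ?_ ?_ ?_ ?_ ?_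
  · rw [hTlog, one_div, log_inv]
    push_cast
    linarith
  · rw [log_le_iff_le_exp hq']
    have : (q : ℝ) ≤ 10 ^ 10 := by exact_mod_cast hq1
    linarith [ten_pow_le_exp]
  · have h1 := one_sub_inv_le_log_of_pos (show 0 < 1 - z by linarith)
    have h2 : (1 - z)⁻¹ ≤ 1.009 := by
      rw [inv_le_comm₀ (by linarith) (by norm_num)]
      norm_num at hz ⊢
      linarith
    linarith
  · have h1 : log ℓ ≤ log (2 ^ 3 * (c + 1)) :=
      log_le_log (by linarith) (by linarith)
    rw [log_mul (by norm_num) (by positivity), log_pow] at h1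
    push_cast at h1
    linarith [log_two_lt_d9]
  · have h1 : log ((2 * c + 1 : ℕ) * 2) ≤ log ℓ :=
      log_le_log (by positivity) (by push_cast; linarith)
    rw [log_mul (by positivity) (by norm_num)] at h1
    linarith [log_two_gt_d9]
  · have h1 := log_facProd_le (2 * c + 1)
    rw [facMain] at h1
    push_cast at h1 ⊢
    linarith
  · have h1 := log_facProd_le S
    rw [facMain] at h1
    linarith
  · have h1 := facMain_le_log_facProd ((c + 1) * S)
    rw [facMain, hTlog] at h1
    push_cast at h1 ⊢
    linarith
  · have h0 : 0 < c * S := by positivity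
    have h1 : log (c * S).factorial ≤ c * S * log (c * S) := by
      rw [show ((c : ℝ) * S) = ((c * S : ℕ) : ℝ) by push_cast; ring, ← log_pow]
      refine log_le_log (by positivity) ?_
      exact_mod_cast Nat.factorial_le_pow _
    refine h1.trans (mul_le_mul_of_nonneg_left ?_ (by positivity))
    rw [log_mul (by positivity) (by positivity)]
    have h2 := log_le_sub_one_of_pos (show (0 : ℝ) < S by linarith)
    have h3 := log_le_sub_one_of_pos (show (0 : ℝ) < c / 1000 by linarith)
    rw [log_div (by positivity) (by norm_num)] at h3
    linarith

end CubeSum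

namespace CubeSum

/-- The numerators and denominators of the possible values of `m / u ^ ℓ`. -/
def shapes : List (ℕ × ℕ) :=
  [(1, 1), (2, 1), (1, 4)].flatMap fun e => [1, 3].flatMap fun f => [1, 13].flatMap fun g =>
    [1, 25].map fun h => (e.1, e.2 * f * g * h)

lemma exists_pow_of_mul_eq_pow {N D m k y X Y : ℕ} (hX : N * X = D * m)
    (hY : D * Y = 25 * N * (m ^ 2 + 156)) (hN : 0 < N) (hD : 0 < D)
    (hy : 25 * m * (m ^ 2 + 156) = y ^ k) (hXY : X.Coprime Y) :
    ∃ u v, D * m = N * u ^ k ∧ D * v ^ k = 25 * N * (m ^ 2 + 156) := by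
  have h : X * Y = y ^ k := by
    rw [← hy]
    refine Nat.eq_of_mul_eq_mul_left (Nat.mul_pos hN hD) ?_
    calc N * D * (X * Y) = (N * X) * (D * Y) := by ring
      _ = _ := by rw [hX, hY]; ring
  obtain ⟨u, hu⟩ := exists_eq_pow_of_mul_eq_pow (Nat.isUnit_iff.2 hXY) h
  obtain ⟨v, hv⟩ := exists_eq_pow_of_mul_eq_pow (Nat.isUnit_iff.2 hXY.symm) ((mul_comm _ _).trans h)
  exact ⟨u, v, by rw [← hX, hu], by rw [← hY, hv]⟩

lemma coprime_of_not_dvd {N D m X Y : ℕ} (hX : N * X = D * m)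
    (hY : D * Y = 25 * N * (m ^ 2 + 156)) (hN : N ∣ 2) (hD : D ∣ 3900)
    (h2 : ¬ (2 ∣ X ∧ 2 ∣ Y)) (h3 : ¬ (3 ∣ X ∧ 3 ∣ Y)) (h5 : ¬ (5 ∣ X ∧ 5 ∣ Y))
    (h13 : ¬ (13 ∣ X ∧ 13 ∣ Y)) : X.Coprime Y := by
  refine Nat.Coprime.symm (Nat.coprime_of_dvd fun p hp hpY hpX => ?_)
  by_cases e : p ∣ 3900
  · have : p ∈ (3900 : ℕ).primeFactors := by simp [hp, e]
    have e2 : (3900 : ℕ).primeFactors = {2, 3, 5, 13} := by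
      rw [show 3900 = 2 ^ 2 * (3 * (13 * 5 ^ 2)) by norm_num]
      repeat rw [Nat.primeFactors_mul (by norm_num) (by norm_num)]
      rw [Nat.primeFactors_prime_pow (by norm_num) (by norm_num),
        Nat.primeFactors_prime_pow (by norm_num) (by norm_num), Nat.Prime.primeFactors
            (by norm_num),
        Nat.Prime.primeFactors (by norm_num)]
      decide
    rw [e2] at this
    simp only [Finset.mem_insert, Finset.mem_singleton] at this
    rcases this with rfl | rfl | rfl | rfl <;> tauto
  · have hm : p ∣ m := by
      rcases hp.dvd_mul.1 ((hX ▸ hpX.mul_left N : p ∣ D * m)) with h | h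
      · exact absurd (h.trans hD) e
      · exact h
    have h1 : p ∣ 25 * N * (m ^ 2 + 156) := hY ▸ hpY.mul_left D
    rcases hp.dvd_mul.1 h1 with h | h
    · exact e (h.trans ((Nat.mul_dvd_mul_left 25 hN).trans (by norm_num)))
    · exact e (((Nat.dvd_add_right (hm.trans (dvd_pow_self m two_ne_zero))).1 h).trans
        (by norm_num))

lemma not_dvd_both_of_mul {p c N D f m X Y : ℕ} (hp : p.Prime) (hX : N * X = D * f * m)
    (hY : D * f * Y = 25 * N * (m ^ 2 + 156)) (hc : 156 = p * c) (hpc : ¬ p ∣ 25 * N * c)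
    (hD : ¬ p ∣ D) (hf : f = 1 ∧ ¬ p ∣ m ∨ f = p ∧ p ∣ m) : ¬ (p ∣ X ∧ p ∣ Y) := by
  rintro ⟨h1, h2⟩
  rcases hf with ⟨rfl, hm⟩ | ⟨rfl, n, rfl⟩
  · rcases hp.dvd_mul.1 (hX ▸ h1.mul_left N : p ∣ D * 1 * m) with h | h
    · exact hD (by simpa using h)
    · exact hm h
  · have : D * Y = 25 * N * (f * n ^ 2 + c) := by
      refine Nat.eq_of_mul_eq_mul_left hp.pos ?_
      rw [hc] at hY
      linear_combination hY
    have h3 : f ∣ 25 * N * (f * n ^ 2) + 25 * N * c := by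
      rw [← mul_add, ← this]
      exact h2.mul_left D
    exact hpc ((Nat.dvd_add_right ((Nat.dvd_mul_right f _).mul_left _)).1 h3)

lemma not_five_dvd_both {N D h m X Y : ℕ} (hX : N * X = D * h * m)
    (hY : D * h * Y = 25 * N * (m ^ 2 + 156)) (hN : ¬ 5 ∣ N) (hD : ¬ 5 ∣ D)
    (hh : h = 1 ∧ ¬ 5 ∣ m ∨ h = 25 ∧ 5 ∣ m) : ¬ (5 ∣ X ∧ 5 ∣ Y) := by
  rintro ⟨h1, h2⟩
  have h5 : Nat.Prime 5 := by norm_num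
  rcases hh with ⟨rfl, hm⟩ | ⟨rfl, n, rfl⟩
  · rcases h5.dvd_mul.1 (hX ▸ h1.mul_left N) with h | h
    · exact hD (by simpa using h)
    · exact hm h
  · have h3 : N * (25 * n ^ 2 + 156) = D * Y := by
      refine Nat.eq_of_mul_eq_mul_left (show 0 < 25 by norm_num) ?_
      linear_combination -hY
    rcases h5.dvd_mul.1 (h3 ▸ h2.mul_left _ : 5 ∣ N * (25 * n ^ 2 + 156)) with h | h
    · exact hN h
    · omega

lemma not_two_dvd_both {e : ℕ × ℕ} {D m X Y : ℕ} (hX : e.1 * X = e.2 * D * m)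
    (hY : e.2 * D * Y = 25 * e.1 * (m ^ 2 + 156)) (hD : ¬ 2 ∣ D)
    (he : e = (1, 1) ∧ m % 2 = 1 ∨ e = (2, 1) ∧ m % 4 = 2 ∨ e = (1, 4) ∧ m % 4 = 0) :
    ¬ (2 ∣ X ∧ 2 ∣ Y) := by
  rintro ⟨h1, h2⟩
  rcases he with ⟨rfl, hm⟩ | ⟨rfl, hm⟩ | ⟨rfl, hm⟩
  · have h3 : X = D * m := by linear_combination hX
    rw [h3, Nat.prime_two.dvd_mul] at h1
    omega
  · obtain ⟨n, rfl⟩ : 2 ∣ m := by omega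
    have h3 : 2 * X = 2 * (D * n) := by linear_combination hX
    rw [Nat.eq_of_mul_eq_mul_left two_pos h3, Nat.prime_two.dvd_mul] at h1
    omega
  · obtain ⟨n, rfl⟩ := Nat.dvd_of_mod_eq_zero hm
    have h3 : 4 * (25 * (4 * n ^ 2 + 39)) = 4 * (D * Y) := by linear_combination -hY
    have h4 : 2 ∣ D * Y := h2.mul_left _
    omega

lemma mem_shapes {e : ℕ × ℕ} {f g h : ℕ} (he : e ∈ [(1, 1), (2, 1), (1, 4)]) (hf : f ∈ [1, 3])
    (hg : g ∈ [1, 13]) (hh : h ∈ [1, 25]) : (e.1, e.2 * f * g * h) ∈ shapes :=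
  List.mem_flatMap.2 ⟨e, he, List.mem_flatMap.2 ⟨f, hf, List.mem_flatMap.2 ⟨g, hg,
    List.mem_map.2 ⟨h, hh, rfl⟩⟩⟩⟩

lemma shape_arith : ∀ e ∈ [(1, 1), (2, 1), (1, 4)], ∀ f ∈ [1, 3], ∀ g ∈ [1, 13], ∀ h ∈ [1, 25],
    e.1 ∣ 2 ∧ e.2 ∣ 156 ∧ f ∣ 156 ∧ g ∣ 156 ∧ h ∣ 25 * e.1 ∧ e.2 * f * g * h ∣ 3900 ∧
    Nat.Coprime e.2 f ∧ Nat.Coprime (e.2 * f) g ∧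
    ¬ 3 ∣ 25 * e.1 * 52 ∧ ¬ 3 ∣ e.2 * g * h ∧ ¬ 13 ∣ 25 * e.1 * 12 ∧ ¬ 13 ∣ e.2 * f * h ∧
    ¬ 5 ∣ e.1 ∧ ¬ 5 ∣ e.2 * f * g ∧ ¬ 2 ∣ f * g * h := by
  decide

lemma exists_shape {m k y : ℕ} (hy : 25 * m * (m ^ 2 + 156) = y ^ k) :
    ∃ c ∈ shapes, ∃ u v, c.2 * m = c.1 * u ^ k ∧ c.2 * v ^ k = 25 * c.1 * (m ^ 2 + 156) := by
  obtain ⟨e, he, hE⟩ : ∃ e ∈ [(1, 1), (2, 1), (1, 4)],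
      (e = (1, 1) ∧ m % 2 = 1 ∨ e = (2, 1) ∧ m % 4 = 2 ∨ e = (1, 4) ∧ m % 4 = 0) := by
    rcases (by omega : m % 2 = 1 ∨ m % 4 = 2 ∨ m % 4 = 0) with h | h | h
    · exact ⟨(1, 1), by simp, by simp [h]⟩
    · exact ⟨(2, 1), by simp, by simp [h]⟩
    · exact ⟨(1, 4), by simp, by simp [h]⟩
  have hfac : ∀ p q : ℕ, ∃ f ∈ [1, q], (f = 1 ∧ ¬ p ∣ m ∨ f = q ∧ p ∣ m) := by
    intro p q
    by_cases h : p ∣ m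
    · exact ⟨q, by simp, by simp [h]⟩
    · exact ⟨1, by simp, by simp [h]⟩
  obtain ⟨f, hf, hF⟩ := hfac 3 3
  obtain ⟨g, hg, hG⟩ := hfac 13 13
  obtain ⟨h, hh, hH⟩ := hfac 5 25
  refine ⟨(e.1, e.2 * f * g * h), mem_shapes he hf hg hh, ?_⟩
  obtain ⟨a1, a2, a3, a4, a5, a6, a7, a8, a9, b1, b2, b3, b4, b5, b6⟩ :=
    shape_arith e he f hf g hg h hh
  clear he hf hg hh
  have hdvd : ∀ a b, a ∣ 156 → (a = 1 ∨ a = b ∧ b ∣ m) → a ∣ m ^ 2 + 156 := by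
    rintro a b h1 (rfl | ⟨rfl, h2⟩)
    · exact one_dvd _
    · exact dvd_add (h2.trans (dvd_pow_self m two_ne_zero)) h1
  have hfd : f ∣ m ^ 2 + 156 := hdvd f 3 a3 (by tauto)
  have hgd : g ∣ m ^ 2 + 156 := hdvd g 13 a4 (by tauto)
  have hed : e.2 ∣ m ^ 2 + 156 := by
    rcases hE with ⟨rfl, -⟩ | ⟨rfl, -⟩ | ⟨rfl, h⟩
    · exact one_dvd _
    · exact one_dvd _
    · exact hdvd 4 4 a2 (Or.inr ⟨rfl, Nat.dvd_of_mod_eq_zero h⟩)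
  have hNm : e.1 ∣ m := by
    rcases hE with ⟨rfl, -⟩ | ⟨rfl, h⟩ | ⟨rfl, -⟩
    · exact one_dvd _
    · exact Nat.dvd_of_mod_eq_zero (show m % 2 = 0 by omega)
    · exact one_dvd _
  have hD : e.2 * f * g * h ∣ 25 * e.1 * (m ^ 2 + 156) := by
    rw [mul_comm _ h]
    exact Nat.mul_dvd_mul a5 (Nat.Coprime.mul_dvd_of_dvd_of_dvd a8
      (Nat.Coprime.mul_dvd_of_dvd_of_dvd a7 hed hfd) hgd)
  obtain ⟨X, hX⟩ : ∃ X, e.1 * X = e.2 * f * g * h * m := by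
    obtain ⟨n, hn⟩ := hNm
    exact ⟨e.2 * f * g * h * n, by rw [hn]; ring⟩
  obtain ⟨Y, hY⟩ := hD
  refine exists_pow_of_mul_eq_pow hX hY.symm (Nat.pos_of_dvd_of_pos a1 (by norm_num))
    (Nat.pos_of_dvd_of_pos a6 (by norm_num)) hy (coprime_of_not_dvd hX hY.symm a1 a6 ?_ ?_ ?_ ?_)
  · exact not_two_dvd_both (D := f * g * h) (by rw [hX]; ring) (by rw [hY]; ring) b6 hE
  · exact not_dvd_both_of_mul (c := 52) (f := f) (D := e.2 * g * h) (by norm_num)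
      (by rw [hX]; ring) (by rw [hY]; ring) (by norm_num) a9 b1 hF
  · exact not_five_dvd_both (h := h) (D := e.2 * f * g) hX hY.symm b4 b5 hH
  · exact not_dvd_both_of_mul (c := 12) (f := g) (D := e.2 * f * h) (by norm_num)
      (by rw [hX]; ring) (by rw [hY]; ring) (by norm_num) b2 b3 hG

lemma shape_equation {N D m k u v : ℕ} (hu : D * m = N * u ^ k)
    (hv : D * v ^ k = 25 * N * (m ^ 2 + 156)) :
    D ^ 3 * v ^ k = 25 * N * (N ^ 2 * (u ^ k) ^ 2 + 156 * D ^ 2) := by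
  calc D ^ 3 * v ^ k = D ^ 2 * (D * v ^ k) := by ring
    _ = 25 * N * ((D * m) ^ 2 + 156 * D ^ 2) := by rw [hv]; ring
    _ = _ := by rw [hu]; ring

end CubeSum

namespace CubeSum

/-- `forallBelow n f` checks `f i` for all `i < n`. -/
def forallBelow (n : ℕ) (f : ℕ → Bool) : Bool := Nat.rec true (fun i b => cond (f i) b false) n

/-- `withValue n f` is `f n`, arranged so that the kernel evaluates `n` first. -/
def withValue (n : ℕ) (f : ℕ → Bool) : Bool := Nat.rec (f 0) (fun m _ => f m.succ) n

lemma forallBelow_eq_true {n : ℕ} {f : ℕ → Bool} (h : forallBelow n f = true) :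
    ∀ i < n, f i = true := by
  induction n with
  | zero => simp
  | succ n ih =>
    change cond (f n) (forallBelow n f) false = true at h
    intro i hi
    cases hf : f n
    · simp [hf] at h
    · rw [hf] at h
      rcases Nat.lt_succ_iff_lt_or_eq.1 hi with hi | rfl
      · exact ih h i hi
      · exact hf

lemma withValue_eq (n : ℕ) (f : ℕ → Bool) : withValue n f = f n := by
  cases n <;> rfl

/-- `a ^ n` modulo `q`, in a form which the kernel evaluates quickly. -/
def powMod (a n q : ℕ) : ℕ := Nat.mod (Nat.pow a n) q

lemma powMod_eq (a n q : ℕ) : powMod a n q = a ^ n % q := rfl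

/-- A primality test for `q = 2 * k * ℓ + 1`, with `ℓ` prime. -/
def primeCheck (ℓ k q : ℕ) : Bool :=
  cond (Nat.ble (Nat.mul 2 k) ℓ)
    (and (Nat.beq (powMod (powMod 2 (Nat.mul 2 ℓ) q) k q) 1)
      (Nat.beq (Nat.gcd (Nat.pred (Nat.pow 2 (Nat.mul 2 k))) q) 1))
    (forallBelow (Nat.mul 2 k) fun i => or (Nat.beq i 0) (Nat.ble 1 (Nat.mod q (Nat.succ i))))

lemma dvd_sub_one_of_pocklington {ℓ k p : ℕ} (hℓ : ℓ.Prime) (hp : p.Prime)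
    (h1 : (2 : ZMod p) ^ (2 * ℓ * k) = 1) (h2 : (2 : ZMod p) ^ (2 * k) ≠ 1) : ℓ ∣ p - 1 := by
  have : Fact p.Prime := ⟨hp⟩
  by_contra hd
  have h0 : (2 : ZMod p) ≠ 0 := by
    rintro h0
    rw [h0] at h1
    by_cases hk : k = 0
    · simp [hk] at h2
    · rw [zero_pow (by simp [hk, hℓ.ne_zero])] at h1
      exact zero_ne_one h1
  have h3 := orderOf_dvd_of_pow_eq_one (ZMod.pow_card_sub_one_eq_one h0)
  have h4 := orderOf_dvd_of_pow_eq_one h1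
  have hc : (orderOf (2 : ZMod p)).Coprime ℓ :=
    Nat.Coprime.symm ((hℓ.coprime_iff_not_dvd).2 fun h => hd (h.trans h3))
  refine h2 (orderOf_dvd_iff_pow_eq_one.1 (hc.dvd_of_dvd_mul_right (n := ℓ) ?_))
  convert h4 using 1
  ring

lemma prime_of_primeCheck {ℓ k q : ℕ} (hℓ : ℓ.Prime) (hk : 0 < k) (hq : q = 2 * k * ℓ + 1)
    (h : primeCheck ℓ k q = true) : q.Prime := by
  have hl := hℓ.two_le
  have hq2 : 1 < q := by rw [hq]; have := Nat.mul_pos hk hℓ.pos; nlinarith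
  by_contra hn
  have hsq := Nat.minFac_sq_le_self (by omega) hn
  have hmp := Nat.minFac_prime (show q ≠ 1 by omega)
  have hmd := Nat.minFac_dvd q
  generalize q.minFac = p at *
  unfold primeCheck at h
  rcases le_or_gt (2 * k) ℓ with hkl | hkl
  · have e : Nat.ble (Nat.mul 2 k) ℓ = true := Nat.ble_eq ▸ hkl
    simp only [e, cond_true, Bool.and_eq_true, powMod_eq, Nat.beq_eq] at h
    obtain ⟨h1, h2⟩ := h
    have h1' : ((((2 : ℕ) ^ (2 * ℓ)) ^ k : ℕ) : ZMod p) = (1 : ℕ) := by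
      rw [ZMod.natCast_eq_natCast_iff]
      refine Nat.ModEq.of_dvd hmd ?_
      rw [Nat.ModEq, Nat.pow_mod, Nat.mod_eq_of_lt hq2]
      exact h1
    have := dvd_sub_one_of_pocklington (k := k) hℓ hmp (by
      rw [pow_mul]; exact_mod_cast h1') (by
      intro h3
      have h4 : (((2 : ℕ) ^ (2 * k) : ℕ) : ZMod p) = (1 : ℕ) := by exact_mod_cast h3
      rw [ZMod.natCast_eq_natCast_iff] at h4
      have h5 := (Nat.modEq_iff_dvd' Nat.one_le_two_pow).1 h4.symm
      exact hmp.one_lt.ne' (Nat.dvd_one.1 (h2 ▸ Nat.dvd_gcd h5 hmd)))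
    have := Nat.le_of_dvd (by have := hmp.two_le; omega) this
    have h3 : ℓ + 1 ≤ p := by have := hmp.two_le; omega
    nlinarith [Nat.mul_le_mul_right ℓ hkl, Nat.mul_le_mul h3 h3]
  · have e : Nat.ble (Nat.mul 2 k) ℓ = false := by
      rw [Bool.eq_false_iff]; simpa using hkl
    rw [e, cond_false] at h
    have h1 : p ≤ 2 * k := by
      by_contra!
      nlinarith
    have h2 := forallBelow_eq_true h (p - 1) (show _ < 2 * k by have := hmp.two_le; omega)
    rw [Nat.succ_eq_add_one, Nat.sub_add_cancel hmp.one_lt.le,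
      show Nat.mod q p = 0 from Nat.mod_eq_zero_of_dvd hmd] at h2
    have := hmp.two_le
    simp at h2
    omega

/-- Checks that `g` has order exactly `k` modulo `q`. -/
def orderCheck (k q g : ℕ) : Bool :=
  and (Nat.beq (powMod g k q) 1)
    (forallBelow k fun i => or (Nat.beq i 0) (not (Nat.beq (powMod g i q) 1)))

lemma natCast_pow_eq_one_iff {q g i : ℕ} (hq : 1 < q) :
    (g : ZMod q) ^ i = 1 ↔ powMod g i q = 1 := by
  rw [powMod_eq, ← Nat.cast_pow, ← Nat.cast_one, ZMod.natCast_eq_natCast_iff, Nat.ModEq,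
    Nat.mod_eq_of_lt hq]

lemma isPrimitiveRoot_of_orderCheck {k q g : ℕ} (hk : 0 < k) (hq : 1 < q)
    (h : orderCheck k q g = true) : IsPrimitiveRoot (g : ZMod q) k := by
  simp only [orderCheck, Bool.and_eq_true, Nat.beq_eq] at h
  refine IsPrimitiveRoot.mk_of_lt _ hk ((natCast_pow_eq_one_iff hq).2 h.1) fun i hi0 hik hi => ?_
  have := forallBelow_eq_true h.2 i hik
  rw [(natCast_pow_eq_one_iff hq).1 hi] at this
  simp at this
  omega

/-- Checks that `a * x + b` is neither zero nor `t` times an `ℓ`-th power modulo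
`q = 2 * k * ℓ + 1` for all `x` in `X`; here `t` is given by its power `T = t ^ (2 * k)`. -/
def residueCheck (k q a b T : ℕ) (X : List ℕ) : Bool :=
  List.rec true (fun x _ next =>
    withValue (powMod (Nat.add (Nat.mul a x) b) (Nat.mul 2 k) q)
      fun s => cond (Nat.beq s 0) false (cond (Nat.beq s T) false next)) X

lemma ne_of_residueCheck {k q a b T : ℕ} {X : List ℕ} (h : residueCheck k q a b T X = true) :
    ∀ x ∈ X, (a * x + b) ^ (2 * k) % q ≠ 0 ∧ (a * x + b) ^ (2 * k) % q ≠ T := by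
  induction X with
  | nil => simp
  | cons x X ih =>
    change (withValue (powMod (Nat.add (Nat.mul a x) b) (Nat.mul 2 k) q)
      fun s => cond (Nat.beq s 0) false (cond (Nat.beq s T) false (residueCheck k q a b T X)))
      = true at h
    rw [withValue_eq, powMod_eq] at h
    simp only [Bool.cond_eq_ite, Nat.beq_eq, Bool.ite_eq_true_distrib] at h
    change if (a * x + b) ^ (2 * k) % q = 0 then _ else if (a * x + b) ^ (2 * k) % q = T
      then _ else _ at h
    split_ifs at h with h1 h2
    · intro y hy
      rcases List.mem_cons.1 hy with rfl | hy
      · exact ⟨h1, h2⟩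
      · exact ih h y hy

/-- `residueCheck` for the equation `D ^ 3 * v = 25 * N * (N ^ 2 * x + 156 * D ^ 2)`. -/
def shapeCheck (k q : ℕ) (X : List ℕ) (c : ℕ × ℕ) : Bool :=
  withValue c.1 fun N => withValue c.2 fun D =>
    withValue (Nat.mul 25 (Nat.pow N 3)) fun a =>
      withValue (Nat.mul (Nat.mul 3900 N) (Nat.pow D 2)) fun b =>
        withValue (powMod D (Nat.mul 6 k) q) fun T => residueCheck k q a b T X

/-- Passes the list of `0` and the first `k` powers of `g` modulo `q` to `cont`. -/
def powersMod (k q g : ℕ) (cont : List ℕ → Bool) : Bool :=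
  Nat.rec cont (fun i next X => withValue (powMod g (Nat.succ i) q) fun x => next (x :: X)) k [0]

lemma exists_of_powersMod {k q g : ℕ} {cont : List ℕ → Bool} (h : powersMod k q g cont = true) :
    ∃ X, cont X = true ∧ 0 ∈ X ∧ ∀ i < k, g ^ (i + 1) % q ∈ X := by
  suffices ∀ Y, (Nat.rec cont (fun i next X => withValue (powMod g (Nat.succ i) q)
      fun x => next (x :: X)) k : List ℕ → Bool) Y = true →
      ∃ X, cont X = true ∧ Y ⊆ X ∧ ∀ i < k, g ^ (i + 1) % q ∈ X by
    obtain ⟨X, h1, h2, h3⟩ := this _ h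
    exact ⟨X, h1, h2 (by simp), h3⟩
  clear h
  induction k with
  | zero => exact fun Y h => ⟨Y, h, by simp, by simp⟩
  | succ k ih =>
    intro Y h
    simp only [withValue_eq] at h ih
    obtain ⟨X, h1, h2, h3⟩ := ih _ h
    refine ⟨X, h1, fun x hx => h2 (List.mem_cons_of_mem _ hx), fun i hi => ?_⟩
    rcases Nat.lt_succ_iff_lt_or_eq.1 hi with hi | rfl
    · exact h3 i hi
    · rw [← powMod_eq]; exact h2 (by simp)

lemma shape_impossible {ℓ k q g : ℕ} {X : List ℕ} {c : ℕ × ℕ} (hk : 0 < k)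
    (hq : q = 2 * k * ℓ + 1) (hp : q.Prime) (hg : orderCheck k q g = true) (h0 : 0 ∈ X)
    (hX : ∀ i < k, g ^ (i + 1) % q ∈ X) (h : shapeCheck k q X c = true) (u v : ℕ) :
    c.2 ^ 3 * v ^ ℓ ≠ 25 * c.1 * (c.1 ^ 2 * (u ^ ℓ) ^ 2 + 156 * c.2 ^ 2) := by
  intro he
  have : Fact q.Prime := ⟨hp⟩
  obtain ⟨N, D⟩ := c
  simp only [shapeCheck, withValue_eq] at h he
  have h1 := ne_of_residueCheck h
  have hpr := isPrimitiveRoot_of_orderCheck hk hp.one_lt hg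
  have hcard (w : ZMod q) (hw : w ≠ 0) : (w ^ ℓ) ^ (2 * k) = 1 := by
    rw [← pow_mul, ← ZMod.pow_card_sub_one_eq_one hw]
    congr 1
    rw [hq, Nat.add_sub_cancel]
    ring
  obtain ⟨x, hxX, hx⟩ : ∃ x ∈ X, (x : ZMod q) = ((u : ZMod q) ^ ℓ) ^ 2 := by
    by_cases hu : (u : ZMod q) = 0
    · have : ℓ ≠ 0 := by
        rintro rfl
        exact hp.one_lt.ne' (by simpa using hq)
      exact ⟨0, h0, by rw [hu]; simp [this]⟩
    · have hu1 : (((u : ZMod q) ^ ℓ) ^ 2) ^ k = 1 := by rw [← pow_mul]; exact hcard _ hu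
      have := NeZero.mk hk.ne'
      obtain ⟨i, hi, h2⟩ := hpr.eq_pow_of_pow_eq_one hu1
      rcases Nat.eq_zero_or_pos i with rfl | hi0
      · refine ⟨_, hX (k - 1) (by omega), ?_⟩
        rw [ZMod.natCast_mod, Nat.sub_add_cancel hk, ← h2, Nat.cast_pow, hpr.pow_eq_one, pow_zero]
      · refine ⟨_, hX (i - 1) (by omega), ?_⟩
        rw [ZMod.natCast_mod, Nat.sub_add_cancel hi0, ← h2, Nat.cast_pow]
  obtain ⟨h2, h3⟩ := h1 x hxX
  have key : ((Nat.mul 25 (Nat.pow N 3) * x + Nat.mul (Nat.mul 3900 N) (Nat.pow D 2) : ℕ) : ZMod q)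
      = (D : ZMod q) ^ 3 * (v : ZMod q) ^ ℓ := by
    have he' := congrArg (Nat.cast (R := ZMod q)) he
    simp only [Nat.mul_eq, Nat.pow_eq]
    push_cast at he' ⊢
    rw [he', hx]
    ring
  by_cases hv : (v : ZMod q) = 0
  · refine h2 (Nat.mod_eq_zero_of_dvd ((ZMod.natCast_eq_zero_iff _ _).1 ?_))
    have : ℓ ≠ 0 := by
      rintro rfl
      exact hp.one_lt.ne' (by simpa using hq)
    rw [Nat.cast_pow, key, hv, zero_pow this, mul_zero, zero_pow (by omega)]
  · refine h3 ?_
    rw [powMod_eq]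
    refine (ZMod.natCast_eq_natCast_iff _ _ _).1 ?_
    rw [Nat.cast_pow, key, mul_pow, hcard _ hv, mul_one, Nat.cast_pow, ← pow_mul]
    congr 1
    simp only [Nat.mul_eq]
    ring

/-- Applies `cont` to the list of elements of `L` which fail `check`, followed by `acc`. -/
def sift {α : Type} (check : α → Bool) (cont : List α → Bool) (L : List α) : List α → Bool :=
  List.rec cont (fun c _ ih acc => cond (check c) (ih acc) (ih (c :: acc))) L

lemma exists_of_sift {α : Type} {check : α → Bool} {cont : List α → Bool} {L acc : List α}
    (h : sift check cont L acc = true) :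
    ∃ M, cont M = true ∧ acc ⊆ M ∧ ∀ c ∈ L, check c = true ∨ c ∈ M := by
  induction L generalizing acc with
  | nil => exact ⟨acc, h, by simp, by simp⟩
  | cons c L ih =>
    change cond (check c) (sift check cont L acc) (sift check cont L (c :: acc)) = true at h
    cases hc : check c
    · rw [hc] at h
      obtain ⟨M, h1, h2, h3⟩ := ih h
      refine ⟨M, h1, fun x hx => h2 (by simp [hx]), fun d hd => ?_⟩
      rcases List.mem_cons.1 hd with rfl | hd
      · exact Or.inr (h2 (by simp))
      · exact h3 d hd
    · rw [hc] at h
      obtain ⟨M, h1, h2, h3⟩ := ih h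
      refine ⟨M, h1, h2, fun d hd => ?_⟩
      rcases List.mem_cons.1 hd with rfl | hd
      · exact Or.inl hc
      · exact h3 d hd

/-- Runs through the primes `q = 2 * k * ℓ + 1` with `k ≤ K`, starting with `k = K - n + 1`, keeping
the shapes that are not yet shown to be impossible; returns `true` if none is left. -/
def sieve (ℓ K n : ℕ) : List (ℕ × ℕ) → Bool :=
  Nat.rec List.isEmpty (fun n next L => List.rec true (fun _ _ _ =>
    withValue (Nat.sub K n) fun k => withValue (Nat.succ (Nat.mul (Nat.mul 2 k) ℓ)) fun q =>
      cond (primeCheck ℓ k q)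
        (Nat.rec (next L) (fun j other => withValue (powMod (Nat.add j 2) (Nat.mul 2 ℓ) q) fun g =>
          cond (orderCheck k q g)
            (powersMod k q g fun X => sift (shapeCheck k q X) next L []) other) 8)
        (next L)) L) n

theorem impossible_of_sieve {ℓ K n : ℕ} {L : List (ℕ × ℕ)} (hℓ : ℓ.Prime) (hn : n ≤ K)
    (h : sieve ℓ K n L = true) : ∀ c ∈ L, ∀ u v,
    c.2 ^ 3 * v ^ ℓ ≠ 25 * c.1 * (c.1 ^ 2 * (u ^ ℓ) ^ 2 + 156 * c.2 ^ 2) := by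
  induction n generalizing L with
  | zero =>
    have : L = [] := List.isEmpty_iff.1 h
    simp [this]
  | succ n ih =>
    have ih' := fun M => ih (L := M) (by omega)
    rcases L with _ | ⟨c₀, L₀⟩
    · simp
    change (withValue (Nat.sub K n) fun k => withValue (Nat.succ (Nat.mul (Nat.mul 2 k) ℓ)) fun q =>
      cond (primeCheck ℓ k q)
        (Nat.rec (sieve ℓ K n (c₀ :: L₀)) (fun j other =>
          withValue (powMod (Nat.add j 2) (Nat.mul 2 ℓ) q) fun g =>
          cond (orderCheck k q g)
            (powersMod k q g fun X => sift (shapeCheck k q X) (sieve ℓ K n) (c₀ :: L₀) []) other) 8)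
        (sieve ℓ K n (c₀ :: L₀))) = true at h
    rw [withValue_eq, withValue_eq] at h
    generalize c₀ :: L₀ = L at *
    have hk : 0 < Nat.sub K n := Nat.sub_pos_of_lt hn
    generalize Nat.sub K n = k at *
    have hq : Nat.succ (Nat.mul (Nat.mul 2 k) ℓ) = 2 * k * ℓ + 1 := rfl
    generalize Nat.succ (Nat.mul (Nat.mul 2 k) ℓ) = q at *
    cases hp : primeCheck ℓ k q
    · rw [hp] at h
      exact ih' L h
    rw [hp, cond_true] at h
    have hqp := prime_of_primeCheck hℓ hk hq hp
    generalize 8 = t at h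
    induction t with
    | zero => exact ih' L h
    | succ t iht =>
      simp only [withValue_eq] at h iht
      cases hg : orderCheck k q (powMod (Nat.add t 2) (Nat.mul 2 ℓ) q)
      · rw [hg] at h
        exact iht h
      · rw [hg, cond_true] at h
        obtain ⟨X, hX, h0, hX'⟩ := exists_of_powersMod h
        obtain ⟨M, hM, -, hL⟩ := exists_of_sift hX
        intro c hc u v
        rcases hL c hc with h1 | h1
        · exact shape_impossible hk hq hqp hg h0 hX' h1 u v
        · exact ih' M hM c h1 u v

/-- The shapes other than the one which allows `m = 0`. -/
def nontrivialShapes : List (ℕ × ℕ) :=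
  [(1, 1), (1, 25), (1, 13), (1, 325), (1, 3), (1, 75), (1, 39), (1, 975), (2, 1), (2, 25), (2, 13),
    (2, 325), (2, 3), (2, 75), (2, 39), (2, 975), (1, 4), (1, 100), (1, 52), (1, 1300), (1, 12),
    (1, 300), (1, 156)]

lemma mem_shapes_iff {c : ℕ × ℕ} : c ∈ shapes ↔ c = (1, 3900) ∨ c ∈ nontrivialShapes := by
  have h1 : ∀ c ∈ shapes, c = (1, 3900) ∨ c ∈ nontrivialShapes := by decide
  have h2 : ∀ c ∈ (1, 3900) :: nontrivialShapes, c ∈ shapes := by decide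
  exact ⟨h1 c, fun h => h2 c (by simpa using h)⟩

/-- Applies the sieve to all odd numbers `s + 2 * i`, `i < n`, without a prime factor below
`132`. -/
def sieveRange (s n : ℕ) : Bool :=
  forallBelow n fun i => withValue (Nat.add s (Nat.mul 2 i)) fun l =>
    cond ([3, 5, 7, 11, 13, 17, 19, 23, 29, 31, 37, 41, 43, 47, 53, 59, 61, 67, 71, 73, 79, 83, 89,
      97, 101, 103, 107, 109, 113, 127, 131].any fun p =>
        and (Nat.blt p l) (Nat.beq (Nat.mod l p) 0))
      true (sieve l 60 60 nontrivialShapes)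

set_option maxRecDepth 100000 in
lemma sieveRange_eq_true : ∀ b < 16, sieveRange (1150 * b + 7) 575 = true := by
  intro b hb
  interval_cases b <;> decide +kernel

theorem impossible_of_lt {ℓ : ℕ} (hℓ : ℓ.Prime) (h7 : 7 ≤ ℓ) (h : ℓ < 18400) {c : ℕ × ℕ}
    (hc : c ∈ nontrivialShapes) (u v : ℕ) :
    c.2 ^ 3 * v ^ ℓ ≠ 25 * c.1 * (c.1 ^ 2 * (u ^ ℓ) ^ 2 + 156 * c.2 ^ 2) := by
  obtain ⟨j, hj⟩ := hℓ.odd_of_ne_two (by omega)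
  have h1 := forallBelow_eq_true (sieveRange_eq_true ((j - 3) / 575) (by omega)) ((j - 3) % 575)
    (by omega)
  rw [withValue_eq, show Nat.add (1150 * ((j - 3) / 575) + 7) (Nat.mul 2 ((j - 3) % 575)) = ℓ by
    simp only [Nat.add_eq, Nat.mul_eq]; omega] at h1
  rw [show (List.any _ _) = false from ?_, cond_false] at h1
  · exact impossible_of_sieve hℓ le_rfl h1 c hc u v
  · rw [List.any_eq_false]
    intro p hp h2
    simp only [Bool.and_eq_true, Nat.blt_eq, Nat.beq_eq] at h2
    have hp1 : ∀ p ∈ [3, 5, 7, 11, 13, 17, 19, 23, 29, 31, 37, 41, 43, 47, 53, 59, 61, 67, 71, 73,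
      79, 83, 89, 97, 101, 103, 107, 109, 113, 127, 131], 1 < p := by decide
    rcases (Nat.dvd_prime hℓ).1 (Nat.dvd_of_mod_eq_zero h2.2) with h3 | h3
    · exact (hp1 p hp).ne' h3
    · exact h2.1.ne h3

lemma impossible_of_eq_five {c : ℕ × ℕ} (hc : c ∈ nontrivialShapes) (u v : ℕ)
    (h : c.2 ^ 3 * v ^ 5 = 25 * c.1 * (c.1 ^ 2 * (u ^ 5) ^ 2 + 156 * c.2 ^ 2)) :
    c = (1, 4) ∨ c = (1, 39) ∨ c = (2, 3) := by
  have h1 : sieve 5 60 60 ((nontrivialShapes.erase (1, 4)).erase (1, 39) |>.erase (2, 3))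
      = true := by
    decide +kernel
  by_contra! h2
  refine impossible_of_sieve Nat.prime_five le_rfl h1 c ?_ u v h
  simp [List.mem_erase_of_ne, h2, hc]

end CubeSum

namespace CubeSum

lemma pow_1001_ge {ℓ : ℕ} (hℓ : 18400 ≤ ℓ) : 9 * 10 ^ 7 * 1000 ^ ℓ ≤ 1001 ^ ℓ := by
  have h1 : (9 * 10 ^ 7 : ℝ) ≤ (1001 / 1000) ^ ℓ := by
    have h2 : (12212 / 10000 : ℝ) ≤ (1001 / 1000) ^ 200 := by norm_num
    have h3 : (9 * 10 ^ 7 : ℝ) ≤ (12212 / 10000) ^ 92 := by norm_num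
    calc (9 * 10 ^ 7 : ℝ) ≤ (12212 / 10000) ^ 92 := h3
      _ ≤ ((1001 / 1000) ^ 200) ^ 92 := by gcongr
      _ = (1001 / 1000) ^ 18400 := by rw [← pow_mul]
      _ ≤ (1001 / 1000) ^ ℓ := pow_le_pow_right₀ (by norm_num) hℓ
  rw [div_pow, le_div_iff₀ (by positivity)] at h1
  exact_mod_cast h1

lemma le_of_pow_le {ℓ P Q : ℕ} (hℓ : 18400 ≤ ℓ) (h0 : 0 < Q) (h : P ^ ℓ ≤ 89000000 * Q ^ ℓ) :
    1000 * P ≤ 1001 * Q := by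
  by_contra! h1
  have h2 : (1001 * Q) ^ ℓ ≤ (1000 * P) ^ ℓ := Nat.pow_le_pow_left h1.le ℓ
  rw [mul_pow, mul_pow] at h2
  have h3 := pow_1001_ge hℓ
  have h4 : 0 < 1000 ^ ℓ := by positivity
  have h5 : 0 < Q ^ ℓ := by positivity
  have h6 : 9 * 10 ^ 7 * 1000 ^ ℓ * Q ^ ℓ ≤ 1001 ^ ℓ * Q ^ ℓ := Nat.mul_le_mul_right _ h3
  have h7 : 1000 ^ ℓ * P ^ ℓ ≤ 1000 ^ ℓ * (89000000 * Q ^ ℓ) := Nat.mul_le_mul_left _ h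
  have h8 : 0 < 1000 ^ ℓ * Q ^ ℓ := by positivity
  linarith

theorem impossible_of_ge {ℓ : ℕ} (hℓ : 18400 ≤ ℓ) {c : ℕ × ℕ} (hc : c ∈ nontrivialShapes)
    {m u v : ℕ} (hm : 3 ≤ m) (hu : c.2 * m = c.1 * u ^ ℓ)
    (hv : c.2 * v ^ ℓ = 25 * c.1 * (m ^ 2 + 156)) : False := by
  have hE := shape_equation hu hv
  obtain ⟨hN, hN', hD, hD', hA⟩ : 0 < c.1 ∧ c.1 ≤ 2 ∧ 0 < c.2 ∧ c.2 ≤ 1300 ∧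
      25 * c.1 ^ 3 ≠ c.2 ^ 3 := by
    clear hE hu hv
    revert c
    decide
  obtain ⟨N, D⟩ := c
  simp only at *
  have hu2 : 2 ≤ u := by
    by_contra! h
    have : u ^ ℓ ≤ 1 := pow_le_one' (by omega) _
    nlinarith
  have hU : 10 ^ 11 ≤ (u ^ 2) ^ ℓ := by
    calc 10 ^ 11 ≤ 2 ^ 40 := by norm_num
      _ ≤ 2 ^ (2 * ℓ) := Nat.pow_le_pow_right (by norm_num) (by omega)
      _ ≤ u ^ (2 * ℓ) := Nat.pow_le_pow_left hu2 _
      _ = _ := pow_mul _ _ _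
  have hl0 : ℓ ≠ 0 := by omega
  rw [show (u ^ ℓ) ^ 2 = (u ^ 2) ^ ℓ by ring] at hE
  generalize u ^ 2 = U at *
  have hE' : D ^ 3 * v ^ ℓ = 25 * N ^ 3 * U ^ ℓ + 3900 * N * D ^ 2 := by rw [hE]; ring
  have hD3 : D ^ 3 ≤ 1300 ^ 3 := Nat.pow_le_pow_left hD' 3
  have hD2 : D ^ 2 ≤ 1300 ^ 2 := Nat.pow_le_pow_left hD' 2
  have hN3 : N ^ 3 ≤ 2 ^ 3 := Nat.pow_le_pow_left hN' 3
  have hN3' : 0 < N ^ 3 := by positivity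
  have hD3' : 0 < D ^ 3 := by positivity
  have hND : N * D ^ 2 ≤ 2 * 1300 ^ 2 := Nat.mul_le_mul hN' hD2
  have hER : (D : ℝ) ^ 3 * (v : ℝ) ^ ℓ = 25 * N ^ 3 * (U : ℝ) ^ ℓ + 3900 * N * D ^ 2 := by
    exact_mod_cast hE'
  have hU0 : 0 < U := Nat.pos_of_ne_zero fun h => by simp [h, hl0] at hU
  have hNR : (0 : ℝ) < N := by exact_mod_cast hN
  have hDR : (0 : ℝ) < D := by exact_mod_cast hD
  have hUR : (0 : ℝ) < (U : ℝ) ^ ℓ := by positivity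
  have hv0 : 0 < v := Nat.pos_of_ne_zero fun h => by
    rw [h, zero_pow hl0] at hE'
    have : 0 < 25 * N ^ 3 * U ^ ℓ := by positivity
    omega
  have hvR : (0 : ℝ) < (v : ℝ) ^ ℓ := by positivity
  rcases Nat.lt_or_gt_of_ne hA with h | h
  · have hlt : v < U := by
      refine lt_of_pow_lt_pow_left₀ ℓ (Nat.zero_le _) (Nat.lt_of_mul_lt_mul_left (a := D ^ 3) ?_)
      nlinarith
    have h9 : 1000 * U ≤ 1001 * v := by
      refine le_of_pow_le hℓ hv0 ?_
      nlinarith [Nat.mul_le_mul_right (v ^ ℓ) hD3]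
    refine no_close_power hℓ (p := D ^ 3) (q := 25 * N ^ 3) (by positivity) (by omega) (by omega)
      hlt h9 (κ := 156 * D ^ 2 / (N ^ 2 * U ^ ℓ)) ?_ ?_
    · rw [div_pow]
      push_cast
      field_simp
      linear_combination hER
    · rw [abs_of_nonneg (by positivity), div_le_div_iff₀ (by positivity) hvR]
      have h1 : (v : ℝ) ^ ℓ ≤ U ^ ℓ := by gcongr
      have h2 : (156 : ℝ) * D ^ 2 ≤ 10 ^ 10 * N ^ 2 := by
        have : 156 * D ^ 2 ≤ 10 ^ 10 * N ^ 2 := by nlinarith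
        exact_mod_cast this
      calc (156 : ℝ) * D ^ 2 * v ^ ℓ ≤ (10 ^ 10 * N ^ 2) * U ^ ℓ := by gcongr
        _ = _ := by ring
  · have hlt : U < v := by
      refine lt_of_pow_lt_pow_left₀ ℓ (Nat.zero_le _) (Nat.lt_of_mul_lt_mul_left (a := D ^ 3) ?_)
      have := Nat.mul_le_mul_right (U ^ ℓ) h.le
      have : 0 < N * D ^ 2 := by positivity
      nlinarith
    have h9 : 1000 * v ≤ 1001 * U := by
      refine le_of_pow_le hℓ hU0 ?_
      have : v ^ ℓ ≤ D ^ 3 * v ^ ℓ := Nat.le_mul_of_pos_left _ hD3'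
      nlinarith [Nat.mul_le_mul_right (U ^ ℓ) hN3]
    refine no_close_power hℓ (p := 25 * N ^ 3) (q := D ^ 3) (by positivity) (by omega) (by omega)
      hlt h9 (κ := -(3900 * N / (D * v ^ ℓ))) ?_ ?_
    · rw [div_pow]
      push_cast
      field_simp
      linear_combination -hER
    · rw [abs_neg, abs_of_nonneg (by positivity), div_le_div_iff₀ (by positivity) hUR]
      have h1 : (U : ℝ) ^ ℓ ≤ v ^ ℓ := by gcongr
      have h2 : (3900 : ℝ) * N ≤ 10 ^ 10 * D := by
        have : 3900 * N ≤ 10 ^ 10 * D := by omega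
        exact_mod_cast this
      calc (3900 : ℝ) * N * U ^ ℓ ≤ (10 ^ 10 * D) * v ^ ℓ := by gcongr
        _ = _ := by ring

end CubeSum

namespace CubeSum

/-- The ring of integers of `ℚ(√-39)`; its element `ω` satisfies `ω ^ 2 = ω - 10`. -/
abbrev W := QuadraticAlgebra ℤ (-10) 1

namespace W

lemma norm_eq (z : W) : z.norm = z.re ^ 2 + z.re * z.im + 10 * z.im ^ 2 := by
  rw [QuadraticAlgebra.norm_def]; ring

/-- The value of `z` under `ω ↦ -r`, a ring homomorphism modulo `r ^ 2 + r + 10`. -/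
def resid (r : ℤ) (z : W) : ℤ := z.re - r * z.im

lemma dvd_resid_mul_sub (r : ℤ) (a b : W) :
    r ^ 2 + r + 10 ∣ resid r (a * b) - resid r a * resid r b := by
  refine ⟨-(a.im * b.im), ?_⟩
  simp only [resid, QuadraticAlgebra.re_mul, QuadraticAlgebra.im_mul]
  ring

lemma dvd_resid_pow_sub (r : ℤ) (a : W) (n : ℕ) :
    r ^ 2 + r + 10 ∣ resid r (a ^ n) - resid r a ^ n := by
  induction n with
  | zero => simp [resid, QuadraticAlgebra.re_one, QuadraticAlgebra.im_one]
  | succ n ih =>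
    rw [pow_succ a, pow_succ (resid r a)]
    have := dvd_add (dvd_resid_mul_sub r (a ^ n) a) (ih.mul_right (resid r a))
    rwa [sub_mul, sub_add_sub_cancel] at this

lemma dvd_resid_mul {r M K : ℤ} {a b : W} (h : M * K ∣ r ^ 2 + r + 10) (ha : M ∣ resid r a)
    (hb : K ∣ resid r b) : M * K ∣ resid r (a * b) :=
  (dvd_iff_dvd_of_dvd_sub (h.trans (dvd_resid_mul_sub r a b))).2 (mul_dvd_mul ha hb)

lemma dvd_resid_pow {r M : ℤ} {a : W} {n : ℕ} (h : M ^ n ∣ r ^ 2 + r + 10) (ha : M ∣ resid r a) :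
    M ^ n ∣ resid r (a ^ n) :=
  (dvd_iff_dvd_of_dvd_sub (h.trans (dvd_resid_pow_sub r a n))).2 (pow_dvd_pow_of_dvd ha n)

/-- A generator of an ideal divides the elements of the ideal. -/
lemma exists_eq_mul {r M K : ℤ} {a b : W} (h : M * K ∣ r ^ 2 + r + 10)
    (ha : M * K ∣ resid r a) (hb : K ∣ resid r b) (hN : b.norm = K) (hK : K ≠ 0) :
    ∃ c, a = c * b ∧ M ∣ resid r c := by
  obtain ⟨f, hf⟩ := h
  obtain ⟨k, hk⟩ := ha
  obtain ⟨l, hl⟩ := hb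
  rw [norm_eq] at hN
  unfold resid at hk hl
  refine ⟨⟨a.im * b.im * M * f + l * a.im * r + M * k * (b.re + b.im), l * a.im - M * k * b.im⟩,
    ?_, ⟨a.im * b.im * f + k * (b.re + b.im + r * b.im), by simp only [resid]; ring⟩⟩
  obtain ⟨x, y⟩ := a
  obtain ⟨x', y'⟩ := b
  obtain rfl : x = r * y + M * K * k := by simp only at hk; linarith
  obtain rfl : x' = r * y' + K * l := by simp only at hl; linarith
  simp only at hN
  ext
  · refine mul_left_cancel₀ hK ?_
    simp only [QuadraticAlgebra.re_mul]
    linear_combination (-r * y - M * K * k) * hN + y * y' * (r * y' + K * l) * hf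
  · refine mul_left_cancel₀ hK ?_
    simp only [QuadraticAlgebra.im_mul]
    linear_combination (-y) * hN + y * y' ^ 2 * hf

lemma exists_norm_eq (M : ℕ) (hM : 0 < M) (r : ℤ) (h : (M : ℤ) ∣ r ^ 2 + r + 10) :
    ∃ b : W, (M : ℤ) ∣ resid r b ∧ ∃ j : ℤ, (j = 1 ∨ j = 2 ∨ j = 3) ∧ b.norm = j * M := by
  induction M using Nat.strong_induction_on generalizing r with
  | _ M ih =>
    rcases le_or_gt M 3 with h3 | h3
    · exact ⟨⟨M, 0⟩, by simp [resid], M, by omega, by simp [norm_eq]; ring⟩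
    · have hM0 : (0 : ℤ) < M := by exact_mod_cast hM
      have h3' : (4 : ℤ) ≤ M := by exact_mod_cast h3
      have h1 := Int.emod_nonneg (2 * r + 1 + M) (show (2 * M : ℤ) ≠ 0 by positivity)
      have h2 := Int.emod_lt_of_pos (2 * r + 1 + M) (show (0 : ℤ) < 2 * M by positivity)
      rw [Int.emod_def] at h1 h2
      generalize (2 * r + 1 + M) / (2 * M : ℤ) = t at h1 h2
      obtain ⟨r, rfl⟩ : ∃ r', r = r' + M * t := ⟨r - M * t, by ring⟩
      have hr : (M : ℤ) ∣ r ^ 2 + r + 10 := by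
        refine (Int.dvd_iff_dvd_of_dvd_sub ?_).1 h
        exact ⟨t * (2 * r + M * t + 1), by ring⟩
      obtain ⟨K, hK⟩ := hr
      have hK0 : 0 < K := by nlinarith [sq_nonneg (2 * r + 1)]
      have hKM : K < M := by nlinarith [mul_nonneg h1 (show 0 ≤ 2 * (M : ℤ) -
        (2 * (r + M * t) + 1 + M - 2 * M * t) by linarith)]
      obtain ⟨K, rfl⟩ := Int.eq_ofNat_of_zero_le hK0.le
      obtain ⟨⟨x, y⟩, ⟨k, hk⟩, j, hj, hb⟩ := ih K (by exact_mod_cast hKM) (by exact_mod_cast hK0)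
        (-1 - r) ⟨M, by linear_combination hK⟩
      refine ⟨⟨k * r - y * M, k⟩, ⟨-y - k * t, by simp only [resid]; ring⟩, j, hj, ?_⟩
      simp only [resid, norm_eq] at hk hb ⊢
      obtain rfl : x = (-1 - r) * y + K * k := by linarith
      refine mul_left_cancel₀ hK0.ne' ?_
      linear_combination (M : ℤ) * hb + (K * k ^ 2 - M * y ^ 2) * hK

lemma exists_div {r M n : ℤ} {a : W} (hn : IsCoprime M n) (h1 : n ∣ a.re) (h2 : n ∣ a.im)
    (ha : M ∣ resid r a) : ∃ z : W, M ∣ resid r z ∧ a.norm = n ^ 2 * z.norm := by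
  obtain ⟨x, hx⟩ := h1
  obtain ⟨y, hy⟩ := h2
  refine ⟨⟨x, y⟩, hn.dvd_of_dvd_mul_left ?_, ?_⟩
  · rwa [show n * resid r ⟨x, y⟩ = resid r a by simp only [resid, hx, hy]; ring]
  · rw [norm_eq, norm_eq, hx, hy]
    ring

lemma mk_mul_mk (x y x' y' : ℤ) :
    (⟨x, y⟩ * ⟨x', y'⟩ : W) = ⟨x * x' - 10 * y * y', x * y' + y * x' + y * y'⟩ := by
  ext
  · simp only [QuadraticAlgebra.re_mul]; ring
  · simp only [QuadraticAlgebra.im_mul]; ring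

lemma sixteen_dvd (b : W) (h : b.norm % 4 = 2) :
    (16 ∣ (b ^ 4 * (⟨2, 1⟩ : W)).re ∧ 16 ∣ (b ^ 4 * (⟨2, 1⟩ : W)).im) ∨
      (16 ∣ (b ^ 4 * (⟨3, -1⟩ : W)).re ∧ 16 ∣ (b ^ 4 * (⟨3, -1⟩ : W)).im) := by
  have key : ∀ x y : ZMod 16, 4 * (x ^ 2 + x * y + 10 * y ^ 2) = 8 →
      ∀ p q, p = x * x - 10 * y * y → q = x * y + y * x + y * y →
      ∀ P Q, P = p * p - 10 * q * q → Q = p * q + q * p + q * q →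
      (2 * P - 10 * Q = 0 ∧ P + 3 * Q = 0) ∨ (3 * P + 10 * Q = 0 ∧ 2 * Q - P = 0) := by
    intro x y h p q hp hq P Q hP hQ
    subst hP hQ hp hq
    revert x y
    decide
  obtain ⟨x, y⟩ := b
  rw [norm_eq] at h
  change (x ^ 2 + x * y + 10 * y ^ 2) % 4 = 2 at h
  have h' : (16 : ℤ) ∣ 4 * (x ^ 2 + x * y + 10 * y ^ 2) - 8 := by omega
  have hk := key x y (by
    have := (ZMod.intCast_zmod_eq_zero_iff_dvd _ 16).2 h'
    push_cast at this
    linear_combination this) _ _ rfl rfl _ _ rfl rfl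
  rw [show (⟨x, y⟩ : W) ^ 4 = ⟨x, y⟩ * ⟨x, y⟩ * (⟨x, y⟩ * ⟨x, y⟩) by ring]
  simp only [mk_mul_mk]
  refine hk.imp (fun h => ⟨?_, ?_⟩) fun h => ⟨?_, ?_⟩ <;>
    refine (ZMod.intCast_zmod_eq_zero_iff_dvd _ 16).1 ?_ <;> push_cast
  · linear_combination h.1
  · linear_combination h.2
  · linear_combination h.1
  · linear_combination h.2

lemma three_dvd (b : W) (h : 3 ∣ b.norm) : 3 ∣ (b ^ 2).re ∧ 3 ∣ (b ^ 2).im := by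
  have key : ∀ x y : ZMod 3, x ^ 2 + x * y + 10 * y ^ 2 = 0 →
      x ^ 2 - 10 * y ^ 2 = 0 ∧ 2 * x * y + y ^ 2 = 0 := by decide
  obtain ⟨x, y⟩ := b
  rw [norm_eq] at h
  have hk := key x y (by exact_mod_cast (ZMod.intCast_zmod_eq_zero_iff_dvd _ 3).2 h)
  rw [pow_two, mk_mul_mk]
  refine ⟨(ZMod.intCast_zmod_eq_zero_iff_dvd _ 3).1 ?_,
      (ZMod.intCast_zmod_eq_zero_iff_dvd _ 3).1 ?_⟩
  · push_cast
    linear_combination hk.1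
  · push_cast
    linear_combination hk.2

/-- The fourth power of an ideal of norm prime to `6` is principal. -/
lemma exists_norm_eq_pow_four {w : ℕ} {r : ℤ} (hw2 : ¬ 2 ∣ w) (hw3 : ¬ 3 ∣ w)
    (h : (w : ℤ) ^ 4 ∣ r ^ 2 + r + 10) :
    ∃ a : W, (w : ℤ) ^ 4 ∣ resid r a ∧ a.norm = (w : ℤ) ^ 4 := by
  have hw0 : 0 < w := Nat.pos_of_ne_zero fun h => by simp [h] at hw2
  obtain ⟨b, hb, j, hj, hN⟩ := exists_norm_eq w hw0 r ((dvd_pow_self _ (by norm_num)).trans h)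
  rcases hj with rfl | rfl | rfl
  · exact ⟨b ^ 4, dvd_resid_pow h hb, by rw [map_pow, hN, one_mul]⟩
  · have hc : IsCoprime ((w : ℤ) ^ 4) 16 := by
      refine IsCoprime.pow_left ?_
      rw [Int.isCoprime_iff_gcd_eq_one]
      exact (Nat.Coprime.pow_right 4 ((Nat.Prime.coprime_iff_not_dvd Nat.prime_two).2 hw2).symm)
    obtain ⟨e, he, h1, h2⟩ : ∃ e : W, e.norm = 16 ∧ 16 ∣ (b ^ 4 * e).re ∧ 16 ∣ (b ^ 4 * e).im := by
      rcases sixteen_dvd b (by omega) with h | h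
      · exact ⟨⟨2, 1⟩, by rw [norm_eq]; norm_num, h⟩
      · exact ⟨⟨3, -1⟩, by rw [norm_eq]; norm_num, h⟩
    obtain ⟨z, hz, hzN⟩ := exists_div hc h1 h2 (r := r) (by
      simpa using dvd_resid_mul (K := 1) (by simpa using h) (dvd_resid_pow h hb) (one_dvd _))
    refine ⟨z, hz, ?_⟩
    rw [map_mul, map_pow, hN, he] at hzN
    linarith
  · have hc : IsCoprime ((w : ℤ) ^ 2) 3 := by
      refine IsCoprime.pow_left ?_
      rw [Int.isCoprime_iff_gcd_eq_one]
      exact ((Nat.Prime.coprime_iff_not_dvd Nat.prime_three).2 hw3).symm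
    obtain ⟨h1, h2⟩ := three_dvd b (hN ▸ dvd_mul_right _ _)
    obtain ⟨z, hz, hzN⟩ := exists_div hc h1 h2 (r := r)
      (dvd_resid_pow ((pow_dvd_pow _ (by norm_num)).trans h) hb)
    refine ⟨z ^ 2, ?_, ?_⟩
    · rw [show (w : ℤ) ^ 4 = (w ^ 2) ^ 2 by ring] at h ⊢
      exact dvd_resid_pow h hz
    · rw [map_pow, hN] at hzN
      rw [map_pow, show z.norm = (w : ℤ) ^ 2 by linarith]
      ring

end W
end CubeSum

namespace CubeSum

namespace W

lemma eq_one_or_of_norm_eq_one {z : W} (h : z.norm = 1) : z = 1 ∨ z = -1 := by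
  obtain ⟨x, y⟩ := z
  rw [norm_eq] at h
  change x ^ 2 + x * y + 10 * y ^ 2 = 1 at h
  obtain rfl : y = 0 := by
    by_contra hy
    nlinarith [sq_nonneg (2 * x + y), sq_pos_of_ne_zero hy]
  rcases sq_eq_sq_iff_eq_or_eq_neg.1 (by linarith : x ^ 2 = 1 ^ 2) with rfl | rfl
  · exact Or.inl rfl
  · exact Or.inr rfl

lemma exists_unit_mul {r K : ℤ} {a b : W} (h : K ∣ r ^ 2 + r + 10) (ha : K ∣ resid r a)
    (hb : K ∣ resid r b) (hNa : a.norm = K) (hNb : b.norm = K) (hK : K ≠ 0) :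
    ∃ c, (c = 1 ∨ c = -1) ∧ a = c * b := by
  obtain ⟨c, hc, -⟩ := exists_eq_mul (a := a) (M := 1) (by rwa [one_mul]) (by rwa [one_mul])
    hb hNb hK
  rw [hc, map_mul, hNb] at hNa
  exact ⟨c, eq_one_or_of_norm_eq_one (mul_right_cancel₀ hK (by rw [hNa, one_mul])), hc⟩

lemma exists_root {z : W} {w : ℤ} (hz : w ∣ z.norm) (hc : IsCoprime z.im w) :
    ∃ r, w ∣ r ^ 2 + r + 10 ∧ w ∣ resid r z := by
  obtain ⟨a, b, hab⟩ := hc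
  have h : w ∣ resid (a * z.re) z :=
    ⟨z.re * b, by simp only [resid]; linear_combination (-z.re) * hab⟩
  refine ⟨a * z.re, ?_, h⟩
  have h2 : IsCoprime w (z.im ^ 2) := IsCoprime.pow_right ⟨b, a, by linear_combination hab⟩
  refine h2.dvd_of_dvd_mul_left ?_
  rw [norm_eq] at hz
  refine (Int.dvd_iff_dvd_of_dvd_sub (h.trans ?_)).1 hz
  exact ⟨z.re + a * z.re * z.im + z.im, by simp only [resid]; ring⟩

lemma exists_eq_pow {z : W} {w ℓ : ℕ} (hℓ : Odd ℓ) (h4 : 4 ≤ ℓ) (hw2 : ¬ 2 ∣ w) (hw3 : ¬ 3 ∣ w)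
    (hz : z.norm = (w : ℤ) ^ ℓ) (hc : IsCoprime z.im w) : ∃ g : W, z = g ^ ℓ := by
  have hw0 : (w : ℤ) ≠ 0 := by
    rintro h
    simp [Int.natCast_eq_zero.1 h] at hw2
  obtain ⟨r, hr, hrz⟩ := exists_root (hz ▸ dvd_rfl : (w : ℤ) ^ ℓ ∣ z.norm) hc.pow_right
  have hr4 := (pow_dvd_pow (w : ℤ) h4).trans hr
  obtain ⟨α, hα, hαN⟩ := exists_norm_eq_pow_four hw2 hw3 hr4
  suffices ∃ g c : W, ∃ n, (c = 1 ∨ c = -1) ∧ z = c ^ n * g ^ ℓ by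
    obtain ⟨g, c, n, hc, h⟩ := this
    refine ⟨c ^ n * g, ?_⟩
    rw [h, mul_pow, ← pow_mul, mul_comm n, pow_mul c ℓ n]
    rcases hc with rfl | rfl
    · simp
    · rw [hℓ.neg_one_pow]
  obtain ⟨j, i, hi, rfl⟩ : ∃ j i, (i = 1 ∨ i = 3) ∧ ℓ = i + 4 * j := by
    obtain ⟨k, rfl⟩ := hℓ
    exact ⟨k / 2, 2 * (k % 2) + 1, by omega, by omega⟩
  rw [pow_add, pow_mul] at hz hr hrz
  have hαj : ((w : ℤ) ^ 4) ^ j ∣ resid r (α ^ j) := dvd_resid_pow ((dvd_mul_left _ _).trans hr) hα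
  obtain ⟨g, rfl, hg⟩ := exists_eq_mul hr hrz hαj (by rw [map_pow, hαN]) (by positivity)
  have hgN : g.norm = (w : ℤ) ^ i := by
    rw [map_mul, map_pow, hαN] at hz
    exact mul_right_cancel₀ (by positivity) hz
  rcases hi with rfl | rfl
  · rw [pow_one] at hg hgN
    obtain ⟨c, hc2, h⟩ := exists_unit_mul hr4 (dvd_resid_pow hr4 hg) hα
      (by rw [map_pow, hgN]) hαN (by positivity)
    refine ⟨g, c, j, hc2, ?_⟩
    have hα' : α = c * g ^ 4 := by
      rw [h]
      rcases hc2 with rfl | rfl <;> ring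
    rw [hα']
    ring
  · rw [show (w : ℤ) ^ 4 = w * w ^ 3 by ring] at hα hr4 hαN
    obtain ⟨f, rfl, hf⟩ := exists_eq_mul hr4 hα hg hgN (by positivity)
    have hfN : f.norm = w := by
      rw [map_mul, hgN] at hαN
      exact mul_right_cancel₀ (by positivity) hαN
    have hr3 := (dvd_mul_left _ _).trans hr4
    obtain ⟨c, hc2, h⟩ := exists_unit_mul hr3 (dvd_resid_pow hr3 hf) hg
      (by rw [map_pow, hfN]) hgN (by positivity)
    refine ⟨f, c, j + 1, hc2, ?_⟩
    have hα' : g = c * f ^ 3 := by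
      rw [h]
      rcases hc2 with rfl | rfl <;> ring
    rw [hα']
    rcases hc2 with rfl | rfl <;> ring

/-- The element `a + b * √-39`. -/
def ofSqrt (a b : ℤ) : W := ⟨a - b, 2 * b⟩

lemma ofSqrt_mul (a b c d : ℤ) :
    ofSqrt a b * ofSqrt c d = ofSqrt (a * c - 39 * (b * d)) (a * d + b * c) := by
  simp only [ofSqrt, mk_mul_mk]
  ext <;> ring

lemma ofSqrt_inj {a b c d : ℤ} (h : ofSqrt a b = ofSqrt c d) : a = c ∧ b = d := by
  have h1 := congrArg QuadraticAlgebra.re h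
  have h2 := congrArg QuadraticAlgebra.im h
  simp only [ofSqrt] at h1 h2
  omega

lemma ofSqrt_pow_odd (a b : ℤ) (n : ℕ) :
    ∃ A B, ofSqrt a b ^ (2 * n + 1) = ofSqrt (a * A) B := by
  induction n with
  | zero => exact ⟨1, b, by simp⟩
  | succ n ih =>
    obtain ⟨A, B, h⟩ := ih
    refine ⟨(a ^ 2 - 39 * b ^ 2) * A - 78 * b * B, (a ^ 2 - 39 * b ^ 2) * B + 2 * a ^ 2 * A * b, ?_⟩
    rw [show 2 * (n + 1) + 1 = 2 * n + 1 + 1 + 1 by ring, pow_succ, pow_succ, h, ofSqrt_mul,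
      ofSqrt_mul]
    congr 1 <;> ring

lemma ofSqrt_pow_even {b : ℤ} (hb : 2 ∣ b) (s : ℕ) : ∀ n : ℕ, 2 ^ s ∣ n →
    ∃ A B, ofSqrt 1 b ^ (2 * n) = ofSqrt (1 - 39 * b ^ 2 * A) (b * B) ∧
      (2 : ℤ) ^ (s + 1) ∣ B ∧ (2 : ℤ) ^ (s + 1) ∣ A - n := by
  obtain ⟨d, rfl⟩ := hb
  induction s with
  | zero =>
    intro n _
    induction n with
    | zero => exact ⟨0, 0, by simp [ofSqrt]; rfl, by simp, by simp⟩
    | succ n ih =>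
      obtain ⟨A, B, h, ⟨B, rfl⟩, k, hk⟩ := ih (one_dvd _)
      obtain rfl : A = n + 2 * k := by linear_combination hk
      refine ⟨1 + (n + 2 * k) * (1 - 39 * (2 * d) ^ 2) + 4 * B,
        2 * (1 - 39 * (2 * d) ^ 2 * (n + 2 * k)) + 2 * B * (1 - 39 * (2 * d) ^ 2), ?_, ?_, ?_⟩
      · rw [show 2 * (n + 1) = 2 * n + 1 + 1 by ring, pow_succ, pow_succ, h, ofSqrt_mul,
          ofSqrt_mul]
        congr 1 <;> ring
      · exact ⟨(1 - 39 * (2 * d) ^ 2 * (n + 2 * k)) + B * (1 - 39 * (2 * d) ^ 2), by ring⟩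
      · exact ⟨k - 78 * d ^ 2 * (n + 2 * k) + 2 * B, by push_cast; ring⟩
  | succ s ih =>
    rintro n ⟨k, rfl⟩
    obtain ⟨A, B, h, ⟨B, rfl⟩, ⟨l, hl⟩⟩ := ih (2 ^ s * k) (dvd_mul_right _ _)
    push_cast at hl
    obtain rfl : A = 2 ^ s * (k + 2 * l) := by linear_combination hl
    refine ⟨2 * (2 ^ s * (k + 2 * l)) - 39 * (2 * d) ^ 2 * (2 ^ s * (k + 2 * l)) ^ 2
      + (2 ^ (s + 1) * B) ^ 2, 2 * (1 - 39 * (2 * d) ^ 2 * (2 ^ s * (k + 2 * l))) *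
      (2 ^ (s + 1) * B), ?_, ?_, ?_⟩
    · rw [show 2 * (2 ^ (s + 1) * k) = 2 * (2 ^ s * k) + 2 * (2 ^ s * k) by ring, pow_add, h,
        ofSqrt_mul]
      congr 1 <;> ring
    · exact ⟨(1 - 39 * (2 * d) ^ 2 * (2 ^ s * (k + 2 * l))) * B, by ring⟩
    · exact ⟨l - 39 * d ^ 2 * 2 ^ s * (k + 2 * l) ^ 2 + 2 ^ s * B ^ 2, by push_cast; ring⟩

lemma eq_zero_of_ofSqrt_pow {b B c : ℤ} {n : ℕ} (hn : n ≠ 0) (hb : 2 ∣ b) (hc : c = 1 ∨ c = -1)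
    (h : ofSqrt 1 b ^ (2 * n + 1) = ofSqrt c B) : B = 0 := by
  obtain ⟨k, l, hl, hkl⟩ := Nat.exists_eq_pow_mul_and_not_dvd hn 2 (by norm_num)
  obtain ⟨A, C, hAC, ⟨C, rfl⟩, t, ht⟩ := ofSqrt_pow_even hb k n ⟨_, hkl⟩
  obtain ⟨d, rfl⟩ := hb
  rw [pow_succ, hAC, ofSqrt_mul] at h
  obtain ⟨h1, h2⟩ := ofSqrt_inj h
  have h3 : d ^ 2 * (A + 2 ^ (k + 1) * C) = 0 := by
    have : 156 * (d ^ 2 * (A + 2 ^ (k + 1) * C)) = 1 - c := by linear_combination -h1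
    omega
  rcases mul_eq_zero.1 h3 with h3 | h3
  · rw [pow_eq_zero_iff two_ne_zero] at h3
    rw [← h2, h3]
    ring
  · refine absurd ?_ hl
    have h4 : (2 : ℤ) ^ k * l = 2 ^ k * (2 * (-t - C)) := by
      have : (n : ℤ) = 2 ^ k * l := by exact_mod_cast hkl
      rw [← this]
      linear_combination h3 - ht
    have := mul_left_cancel₀ (by positivity) h4
    omega

lemma eq_zero_of_norm_eq_pow {ℓ w : ℕ} (hℓ : Odd ℓ) (h4 : 4 ≤ ℓ) {B : ℤ} (hB : 2 ∣ B)
    (h : 1 + 39 * B ^ 2 = (w : ℤ) ^ ℓ) : B = 0 := by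
  obtain ⟨M, rfl⟩ := hB
  have hM := h
  have hw : ∀ p : ℕ, (p : ℤ) ∣ 39 * (2 * M) ^ 2 → (p : ℤ) ∣ w → p = 1 := by
    intro p h1 h2
    have h3 : (p : ℤ) ∣ (1 + 39 * (2 * M) ^ 2) - 39 * (2 * M) ^ 2 :=
      dvd_sub (h ▸ dvd_pow h2 (by omega)) h1
    rw [add_sub_cancel_right] at h3
    exact Nat.dvd_one.1 (by exact_mod_cast h3)
  obtain ⟨g, hg⟩ := exists_eq_pow (z := ofSqrt 1 (2 * M)) hℓ h4 (w := w)
    (fun h2 => by simpa using hw 2 ⟨78 * M ^ 2, by push_cast; ring⟩ (by exact_mod_cast h2))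
    (fun h2 => by simpa using hw 3 ⟨52 * M ^ 2, by push_cast; ring⟩ (by exact_mod_cast h2))
    (by rw [← h, norm_eq]; simp only [ofSqrt]; ring) (by
      rw [Int.isCoprime_iff_gcd_eq_one]
      refine hw _ ?_ (Int.gcd_dvd_right ..)
      exact (Int.gcd_dvd_left ..).trans ⟨39 * M, by simp only [ofSqrt]; ring⟩)
  have hgw : g.norm = w := by
    refine hℓ.strictMono_pow.injective ?_
    rw [← map_pow, ← hg, ← h, norm_eq]
    simp only [ofSqrt]
    ring
  have hw4 : (w : ZMod 4) = 1 := by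
    obtain ⟨k, rfl⟩ := hℓ
    have h5 : (1 + 39 * (2 * M) ^ 2 : ZMod 4) = w * (w ^ 2) ^ k := by
      rw [← pow_mul, ← pow_succ']
      exact_mod_cast congrArg (Int.cast (R := ZMod 4)) h
    have h6 : ∀ a : ZMod 4, a ^ 2 = 0 ∨ a ^ 2 = 1 := by decide
    generalize (M : ZMod 4) = b at h5
    generalize (w : ZMod 4) = a at h5 ⊢
    rcases h6 a with h6 | h6 <;> rw [h6] at h5
    · rw [zero_pow (by omega)] at h5
      revert a b
      decide
    · rw [one_pow] at h5
      revert a b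
      decide
  have h2 (n : ℤ) (hn : 2 * (n : ZMod 4) = 0) : 2 ∣ n := by
    have := (ZMod.intCast_zmod_eq_zero_iff_dvd (2 * n) 4).1 (by exact_mod_cast hn)
    omega
  obtain ⟨x, y⟩ := g
  rw [norm_eq] at hgw
  change x ^ 2 + x * y + 10 * y ^ 2 = w at hgw
  obtain ⟨a, b, rfl, rfl⟩ : ∃ a b, x = a - b ∧ y = 2 * b := by
    have key : ∀ x y : ZMod 4, x ^ 2 + x * y + 10 * y ^ 2 = 1 → 2 * y = 0 := by decide
    obtain ⟨b, rfl⟩ := h2 y (key x y (by rw [← hw4]; exact_mod_cast congrArg _ hgw))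
    exact ⟨x + b, b, by ring, rfl⟩
  have hb : 2 ∣ b := by
    have key : ∀ a b : ZMod 4, a ^ 2 + 39 * b ^ 2 = 1 → 2 * b = 0 := by decide
    refine h2 b (key a b ?_)
    rw [← hw4]
    have := congrArg (Int.cast (R := ZMod 4)) hgw
    push_cast at this
    linear_combination this
  change _ = ofSqrt a b ^ ℓ at hg
  obtain ⟨n, rfl⟩ := hℓ
  obtain ⟨A, C, hAC⟩ := ofSqrt_pow_odd a b n
  have ha : a = 1 ∨ a = -1 := by
    rw [hAC] at hg
    exact Int.isUnit_iff.1 (isUnit_of_dvd_one ⟨A, (ofSqrt_inj hg).1⟩)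
  rcases ha with rfl | rfl
  · exact eq_zero_of_ofSqrt_pow (by omega) hb (Or.inl rfl) hg.symm
  · have := eq_zero_of_ofSqrt_pow (b := -b) (B := -(2 * M)) (n := n) (by omega) (by omega)
      (Or.inr rfl) (by
      have h1 : ∀ a b, ofSqrt (-a) (-b) = - ofSqrt a b := by
        intro a b
        ext <;> simp [ofSqrt]
        ring
      rw [h1, hg, ← (odd_two_mul_add_one n).neg_pow, ← h1, neg_neg])
    omega

end W

lemma eq_zero_of_trivial_shape {ℓ m u v : ℕ} (hℓ : Odd ℓ) (h4 : 4 ≤ ℓ) (hu : 3900 * m = u ^ ℓ)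
    (hv : 3900 * v ^ ℓ = 25 * (m ^ 2 + 156)) : m = 0 := by
  have hm : ∀ p, p.Prime → p ∣ 156 → p ∣ m := by
    intro p hp h
    refine hp.dvd_of_dvd_pow (n := 2) ((Nat.dvd_add_left h).1 ?_)
    rw [show m ^ 2 + 156 = 156 * v ^ ℓ by omega]
    exact h.mul_right _
  have h2 := hm 2 (by norm_num) (by norm_num)
  have h3 := hm 3 (by norm_num) (by norm_num)
  have h13 := hm 13 (by norm_num) (by norm_num)
  obtain ⟨B, rfl⟩ : 78 ∣ m := by omega
  have hB : 2 ∣ B := by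
    have h : 2 ∣ u := Nat.prime_two.dvd_of_dvd_pow (Dvd.intro (1950 * (78 * B))
        (by rw [← hu]; ring))
    have h16 : 2 ^ 3 * 2 ∣ 2 ^ 3 * (38025 * B) := by
      rw [← pow_succ, show 2 ^ 3 * (38025 * B) = 3900 * (78 * B) by ring, hu]
      exact (pow_dvd_pow_of_dvd h 4).trans (pow_dvd_pow u h4)
    exact (by norm_num : Nat.Coprime 2 38025).dvd_of_dvd_mul_left
      (Nat.dvd_of_mul_dvd_mul_left (by norm_num) h16)
  have := W.eq_zero_of_norm_eq_pow (B := B) (w := v) hℓ h4 (by exact_mod_cast hB) (by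
    have : v ^ ℓ = 1 + 39 * B ^ 2 := by nlinarith
    exact_mod_cast this.symm)
  omega

end CubeSum

namespace CubeSum

namespace W

lemma norm_mk (x y : ℤ) : QuadraticAlgebra.norm (⟨x, y⟩ : W) = x ^ 2 + x * y + 10 * y ^ 2 :=
  norm_eq _

lemma intCast_mul (n : ℤ) (b : W) : (n : W) * b = ⟨n * b.re, n * b.im⟩ := by
  obtain ⟨x, y⟩ := b
  rw [show (n : W) = ⟨n, 0⟩ from rfl, mk_mul_mk]
  ext <;> ring

lemma eq_mul_of_dvd {n : ℤ} {a : W} (h1 : n ∣ a.re) (h2 : n ∣ a.im) : ∃ b : W, a = n * b := by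
  obtain ⟨x, hx⟩ := h1
  obtain ⟨y, hy⟩ := h2
  exact ⟨⟨x, y⟩, by rw [intCast_mul, ← hx, ← hy]⟩

lemma exists_eq_three_mul {a : W} (h : 9 ∣ a.norm) : ∃ b : W, a = (3 : ℤ) * b := by
  have key : ∀ x y : ZMod 9, x ^ 2 + x * y + 10 * y ^ 2 = 0 → 3 * x = 0 ∧ 3 * y = 0 := by decide
  have hk := key a.re a.im (by
    have := (ZMod.intCast_zmod_eq_zero_iff_dvd _ 9).2 (norm_eq a ▸ h)
    exact_mod_cast this)
  have h3 (n : ℤ) (hn : 3 * (n : ZMod 9) = 0) : 3 ∣ n := by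
    have := (ZMod.intCast_zmod_eq_zero_iff_dvd (3 * n) 9).1 (by exact_mod_cast hn)
    omega
  exact eq_mul_of_dvd (h3 _ hk.1) (h3 _ hk.2)

lemma five_dvd_of_dvd_pow {a : W} (h1 : 5 ∣ (a ^ 5).re) (h2 : 5 ∣ (a ^ 5).im) :
    5 ∣ a.re ∧ 5 ∣ a.im := by
  have key : ∀ x y : ZMod 5, ∀ p q, p = x * x - 10 * y * y → q = x * y + y * x + y * y →
      ∀ P Q, P = p * p - 10 * q * q → Q = p * q + q * p + q * q →
      P * x - 10 * Q * y = x ∧ P * y + Q * x + Q * y = y := by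
    intro x y p q hp hq P Q hP hQ
    subst hP hQ hp hq
    revert x y
    decide
  obtain ⟨x, y⟩ := a
  have hk := key x y _ _ rfl rfl _ _ rfl rfl
  rw [show (⟨x, y⟩ : W) ^ 5 = ⟨x, y⟩ * ⟨x, y⟩ * (⟨x, y⟩ * ⟨x, y⟩) * ⟨x, y⟩ by ring] at h1 h2
  simp only [mk_mul_mk] at h1 h2
  have h1 := (ZMod.intCast_zmod_eq_zero_iff_dvd _ 5).2 h1
  have h2 := (ZMod.intCast_zmod_eq_zero_iff_dvd _ 5).2 h2
  push_cast at h1 h2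
  rw [hk.1] at h1
  rw [hk.2] at h2
  exact ⟨(ZMod.intCast_zmod_eq_zero_iff_dvd _ 5).1 h1, (ZMod.intCast_zmod_eq_zero_iff_dvd _ 5).1 h2⟩

lemma dvd_norm_of_dvd_resid {r M : ℤ} {a : W} (h : M ∣ r ^ 2 + r + 10) (ha : M ∣ resid r a) :
    M ∣ a.norm := by
  obtain ⟨x, y⟩ := a
  obtain ⟨k, hk⟩ := ha
  obtain ⟨f, hf⟩ := h
  simp only [resid] at hk
  obtain rfl : x = M * k + r * y := by linarith
  rw [norm_mk]
  exact ⟨M * k ^ 2 + k * (2 * r * y + y) + y ^ 2 * f, by linear_combination y ^ 2 * hf⟩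

lemma norm_ne {c : W} : c.norm ≠ 2 ^ 5 ∧ c.norm ≠ 3 ^ 5 := by
  obtain ⟨x, y⟩ := c
  rw [norm_mk]
  constructor
  · intro h
    have : ∀ x y : ZMod 13, x ^ 2 + x * y + 10 * y ^ 2 ≠ 6 := by decide
    exact this x y (by exact_mod_cast congrArg (Int.cast (R := ZMod 13)) h)
  · intro h
    have h1 : y ≤ 4 := by nlinarith [sq_nonneg (2 * x + y)]
    have h2 : -4 ≤ y := by nlinarith [sq_nonneg (2 * x + y)]
    have h3 : x ≤ 18 := by nlinarith
    have h4 : -18 ≤ x := by nlinarith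
    interval_cases y <;> interval_cases x <;> omega

/-- An element of norm `5 ^ 12 * j ^ 5` prime to `5` is a unit times the cube of an element of
norm `5 ^ 4`. -/
lemma exists_eq_unit_mul_cube {a : W} {j : ℤ} (hj : j = 1 ∨ j = 2 ∨ j = 3)
    (ha : a.norm = 5 ^ 12 * j ^ 5) (h5 : ¬ (5 ∣ a.re ∧ 5 ∣ a.im)) :
    ∃ c p : W, (c = 1 ∨ c = -1) ∧ (p = ⟨-3, 8⟩ ∨ p = ⟨5, -8⟩) ∧ a = c * p ^ 3 := by
  have hp5 : Prime (5 : ℤ) := Int.prime_iff_natAbs_prime.2 (by norm_num)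
  have him : ¬ 5 ∣ a.im := by
    rintro ⟨y, hy⟩
    refine h5 ⟨hp5.dvd_of_dvd_pow (n := 2) ?_, y, hy⟩
    rw [norm_eq, hy] at ha
    exact ⟨5 ^ 11 * j ^ 5 - a.re * y - 50 * y ^ 2, by linear_combination ha⟩
  obtain ⟨r, hr, hra⟩ := exists_root (w := 5 ^ 12) (Dvd.intro _ ha.symm)
    ((hp5.coprime_iff_not_dvd.2 him).symm.pow_right)
  rw [show (5 : ℤ) ^ 12 = (5 ^ 4) ^ 3 by norm_num] at hr hra
  obtain ⟨p, hp, hrp, hpN⟩ : ∃ p : W, (p = ⟨-3, 8⟩ ∨ p = ⟨5, -8⟩) ∧ 5 ^ 4 ∣ resid r p ∧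
      p.norm = 5 ^ 4 := by
    have key : ∀ r : ZMod 625, r ^ 2 + r + 10 = 0 → -3 - r * 8 = 0 ∨ 5 - r * (-8) = 0 := by
      decide +kernel
    have := (ZMod.intCast_zmod_eq_zero_iff_dvd _ 625).2
      ((dvd_pow_self ((5 : ℤ) ^ 4) three_ne_zero).trans hr)
    rcases key r (by exact_mod_cast this) with h | h
    · exact ⟨_, Or.inl rfl, (ZMod.intCast_zmod_eq_zero_iff_dvd _ 625).1 (by exact_mod_cast h),
        by rw [norm_mk]; norm_num⟩
    · exact ⟨_, Or.inr rfl, (ZMod.intCast_zmod_eq_zero_iff_dvd _ 625).1 (by exact_mod_cast h),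
        by rw [norm_mk]; norm_num⟩
  obtain ⟨c, rfl, -⟩ := exists_eq_mul (M := 1) (by rwa [one_mul]) (by rwa [one_mul])
    (dvd_resid_pow hr hrp) (by rw [map_pow, hpN]) (by norm_num)
  refine ⟨c, p, ?_, hp, rfl⟩
  have hc : c.norm = j ^ 5 := by
    rw [map_mul, map_pow, hpN] at ha
    linarith
  rcases hj with rfl | rfl | rfl
  · exact eq_one_or_of_norm_eq_one (by rw [hc]; norm_num)
  · exact absurd hc norm_ne.1
  · exact absurd hc norm_ne.2

lemma exists_pow_five_eq {z : W} {k w e : ℤ} (hk : k = 125 ∧ e = 1 ∨ k = 375 ∧ e = 9) (hw : 0 < w)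
    (hz : z.norm = k * w ^ 5) (hc : IsCoprime z.im (k * w ^ 5)) :
    ∃ g p : W, (p = ⟨-3, 8⟩ ∨ p = ⟨5, -8⟩) ∧ g ^ 5 = z * (e * p ^ 3) := by
  have hk0 : 0 < k := by omega
  obtain ⟨r, hr, hrz⟩ := exists_root (hz ▸ dvd_rfl : k * w ^ 5 ∣ z.norm) hc
  have hkw : k * w ∣ k * w ^ 5 := mul_dvd_mul_left _ (dvd_pow_self _ (by norm_num))
  obtain ⟨n, hn⟩ := Int.eq_ofNat_of_zero_le (mul_pos hk0 hw).le
  obtain ⟨d, hd, j, hj, hdN⟩ := exists_norm_eq n (by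
    have := mul_pos hk0 hw
    omega) r (hn ▸ hkw.trans hr)
  rw [← hn] at hd hdN
  obtain ⟨a, ha, -⟩ := exists_eq_mul (a := d ^ 5) (b := z) (M := 1) (by rwa [one_mul]) (by
    rw [one_mul]
    refine (dvd_iff_dvd_of_dvd_sub (hr.trans (dvd_resid_pow_sub r d 5))).2 ?_
    exact (Dvd.intro (k ^ 4) (by ring) : k * w ^ 5 ∣ (k * w) ^ 5).trans
        (pow_dvd_pow_of_dvd hd 5)) hrz hz
    (by positivity)
  have haN : a.norm = k ^ 4 * j ^ 5 := by
    have := congrArg QuadraticAlgebra.norm ha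
    rw [map_pow, map_mul, hdN, hz] at this
    refine mul_right_cancel₀ (b := k * w ^ 5) (by positivity) ?_
    linear_combination -this
  have ha5 : ¬ (5 ∣ a.re ∧ 5 ∣ a.im) := by
    rintro ⟨h1, h2⟩
    obtain ⟨a, rfl⟩ := eq_mul_of_dvd h1 h2
    have h3 := five_dvd_of_dvd_pow (a := d)
        (by rw [ha, mul_assoc, intCast_mul]; exact dvd_mul_right _ _)
      (by rw [ha, mul_assoc, intCast_mul]; exact dvd_mul_right _ _)
    obtain ⟨d, rfl⟩ := eq_mul_of_dvd h3.1 h3.2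
    have hd' : 25 * w ∣ resid r d := by
      rw [show resid r (((5 : ℤ) : W) * d) = 5 * resid r d by
        rw [intCast_mul]; simp only [resid]; ring] at hd
      obtain ⟨t, ht⟩ := hd
      rcases hk with ⟨rfl, -⟩ | ⟨rfl, -⟩
      · exact ⟨t, by linarith⟩
      · exact ⟨3 * t, by linarith⟩
    have h4 : 25 * w ∣ d.norm :=
      dvd_norm_of_dvd_resid (Dvd.dvd.trans (by
        rcases hk with ⟨rfl, -⟩ | ⟨rfl, -⟩
        · exact ⟨5, by ring⟩
        · exact ⟨15, by ring⟩) (hkw.trans hr)) hd'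
    obtain ⟨l, hl⟩ := h4
    rw [map_mul, QuadraticAlgebra.norm_intCast, Int.cast_id, hl] at hdN
    have h5 : 625 * l = j * k := mul_right_cancel₀ hw.ne' (by linear_combination hdN)
    rcases hk with ⟨rfl, -⟩ | ⟨rfl, -⟩ <;> omega
  obtain ⟨b, rfl, hbN⟩ : ∃ b : W, a = e * b ∧ b.norm = 5 ^ 12 * j ^ 5 := by
    rcases hk with ⟨rfl, rfl⟩ | ⟨rfl, rfl⟩
    · exact ⟨a, by simp, by rw [haN]; norm_num⟩
    · obtain ⟨b, rfl⟩ := exists_eq_three_mul (a := a) ⟨9 * 5 ^ 12 * j ^ 5, by rw [haN]; ring⟩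
      rw [map_mul, QuadraticAlgebra.norm_intCast, Int.cast_id] at haN
      obtain ⟨b, rfl⟩ := exists_eq_three_mul (a := b) ⟨5 ^ 12 * j ^ 5, by linarith⟩
      rw [map_mul, QuadraticAlgebra.norm_intCast, Int.cast_id] at haN
      exact ⟨b, by push_cast; ring, by linarith⟩
  obtain ⟨c, p, hc1, hp, rfl⟩ := exists_eq_unit_mul_cube hj hbN (by
    rintro ⟨h1, h2⟩
    exact ha5 (by simp [h1.mul_left, h2.mul_left]))
  refine ⟨c * d, p, hp, ?_⟩
  rw [mul_pow, ha]
  rcases hc1 with rfl | rfl <;> ring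

lemma cast_resid_mul {q : ℕ} {r : ℤ} (hr : (q : ℤ) ∣ r ^ 2 + r + 10) (a b : W) :
    (resid r (a * b) : ZMod q) = resid r a * resid r b := by
  have := (ZMod.intCast_zmod_eq_zero_iff_dvd _ q).2 (hr.trans (dvd_resid_mul_sub r a b))
  push_cast at this
  exact sub_eq_zero.1 this

lemma cast_resid_pow {q : ℕ} {r : ℤ} (hr : (q : ℤ) ∣ r ^ 2 + r + 10) (a : W) (n : ℕ) :
    (resid r (a ^ n) : ZMod q) = resid r a ^ n := by
  have := (ZMod.intCast_zmod_eq_zero_iff_dvd _ q).2 (hr.trans (dvd_resid_pow_sub r a n))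
  push_cast at this
  exact sub_eq_zero.1 this

lemma resid_pow_five {q : ℕ} {r : ℤ} (hr : (q : ℤ) ∣ r ^ 2 + r + 10) {g z p : W} {e : ℤ}
    (h : g ^ 5 = z * (e * p ^ 3)) :
    (resid r g : ZMod q) ^ 5 = resid r z * (e * resid r p ^ 3) := by
  rw [← cast_resid_pow hr, h, cast_resid_mul hr, cast_resid_mul hr, cast_resid_pow hr]
  simp [resid]

end W

lemma impossible_one_four {m u v : ℕ} (hu : 4 * m = u ^ 5) (hv : 4 * v ^ 5 = 25 * (m ^ 2 + 156)) :
    False := by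
  have h5 : 5 ∣ v := by
    refine Nat.prime_five.dvd_of_dvd_pow (n := 5) ?_
    omega
  obtain ⟨w, rfl⟩ := h5
  have key : ∀ u : ZMod 25, u ^ 10 + 2496 ≠ 0 := by decide +kernel
  refine key u ?_
  have h : u ^ 10 + 2496 = 25 * (320 * w ^ 5) := by
    have : (u ^ 5) ^ 2 = u ^ 10 := by ring
    rw [← this, ← hu]
    ring_nf at hv ⊢
    omega
  have := congrArg (Nat.cast (R := ZMod 25)) h
  push_cast at this
  rw [this, show (25 : ZMod 25) = 0 from rfl, zero_mul]

lemma impossible_one_thirtynine {m u v : ℕ} (hu : 39 * m = u ^ 5)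
    (hv : 39 * v ^ 5 = 25 * (m ^ 2 + 156)) : False := by
  have h3 := Nat.prime_three.dvd_of_dvd_pow (hu ▸ ⟨13 * m, by ring⟩ : 3 ∣ u ^ 5)
  have h13 := (by norm_num : Nat.Prime 13).dvd_of_dvd_pow (hu ▸ ⟨3 * m, by ring⟩ : 13 ∣ u ^ 5)
  have h5 : 5 ∣ v := Nat.prime_five.dvd_of_dvd_pow (n := 5) (by omega)
  obtain ⟨t, rfl⟩ : 39 ∣ u := by omega
  obtain ⟨w, rfl⟩ := h5
  obtain rfl : m = 39 ^ 4 * t ^ 5 := by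
    rw [mul_pow] at hu
    omega
  have h : 125 * (w : ℤ) ^ 5 = 39 * (59319 * t ^ 5) ^ 2 + 4 := by
    have := congrArg (Nat.cast (R := ℤ)) hv
    push_cast at this
    exact mul_left_cancel₀ (by norm_num : (975 : ℤ) ≠ 0) (by linear_combination this)
  have hw : 0 < w := Nat.pos_of_ne_zero fun h0 => by
    rw [h0] at h
    norm_num at h
    have : (0 : ℤ) ≤ 39 * (59319 * t ^ 5) ^ 2 := by positivity
    omega
  have ht : Odd (59319 * (t : ℤ) ^ 5) := by
    refine (by decide : Odd (59319 : ℤ)).mul (Odd.pow ?_)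
    rw [← Int.not_even_iff_odd]
    rintro ⟨s, hs⟩
    have h2 : 2 ∣ (w : ℤ) := by
      refine (Int.prime_iff_natAbs_prime.2 (by norm_num)).dvd_of_dvd_pow (n := 5) ?_
      have : Even (125 * (w : ℤ) ^ 5) := by
        rw [h, hs]
        exact ⟨39 * (59319 * 16 * s ^ 5) * (59319 * 32 * s ^ 5) + 2, by ring⟩
      rcases Int.even_mul.1 this with h2 | h2
      · exact absurd h2 (by decide)
      · exact h2.two_dvd
    obtain ⟨x, hx⟩ := h2
    rw [hs, hx] at h
    ring_nf at h
    omega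
  set A := 59319 * (t : ℤ) ^ 5 with hA
  have hc : IsCoprime (2 * A) (125 * (w : ℤ) ^ 5) := by
    obtain ⟨k, hk⟩ := ht
    have hA2 : IsCoprime A 2 := ⟨1, -k, by rw [hk]; ring⟩
    rw [h]
    refine IsCoprime.mul_left ?_ ?_
    · exact ⟨-(78 * k ^ 2 + 78 * k + 21), 1, by rw [hk]; ring⟩
    · rw [show 39 * A ^ 2 + 4 = 2 ^ 2 + A * (39 * A) by ring]
      exact hA2.pow_right.add_mul_left_right _
  obtain ⟨g, p, hp, hg⟩ := W.exists_pow_five_eq (z := W.ofSqrt 2 A) (k := 125) (e := 1) (w := w)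
    (Or.inl ⟨rfl, rfl⟩) (by exact_mod_cast hw) (by
      rw [h, W.ofSqrt, W.norm_mk]
      ring) hc
  have key : ∀ t : ZMod 11, ∀ p ∈ [(-3, 8), (5, -8)], ¬ ∀ r ∈ [3, 7],
      ((2 - 59319 * t ^ 5 - r * (2 * (59319 * t ^ 5))) * (1 * (p.1 - r * p.2) ^ 3)) ^ 3 =
        (2 - 59319 * t ^ 5 - r * (2 * (59319 * t ^ 5))) * (1 * (p.1 - r * p.2) ^ 3) := by
    decide +kernel
  refine key t (p.re, p.im) (by rcases hp with rfl | rfl <;> simp) ?_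
  intro r hmem
  obtain ⟨r, rfl, hr⟩ : ∃ r' : ℤ, r = r' ∧ ((11 : ℕ) : ℤ) ∣ r' ^ 2 + r' + 10 := by
    simp only [List.mem_cons, List.not_mem_nil, or_false] at hmem
    rcases hmem with rfl | rfl
    · exact ⟨3, by norm_num, by norm_num⟩
    · exact ⟨7, by norm_num, by norm_num⟩
  have h5 := W.resid_pow_five hr hg
  have hx : ∀ x : ZMod 11, (x ^ 5) ^ 3 = x ^ 5 := by decide
  simp only [W.resid, W.ofSqrt, hA] at h5
  push_cast at h5
  dsimp only
  rw [← h5, hx]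

lemma impossible_two_three {m u v : ℕ} (hu : 3 * m = 2 * u ^ 5)
    (hv : 3 * v ^ 5 = 50 * (m ^ 2 + 156)) : False := by
  have h3 : 3 ∣ u := Nat.prime_three.dvd_of_dvd_pow (n := 5) (by omega)
  have h5 : 5 ∣ v := Nat.prime_five.dvd_of_dvd_pow (n := 5) (by omega)
  have h2 : 2 ∣ v := Nat.prime_two.dvd_of_dvd_pow (n := 5) (by omega)
  obtain ⟨t, rfl⟩ := h3
  obtain ⟨w, rfl⟩ : 10 ∣ v := by omega
  obtain rfl : m = 162 * t ^ 5 := by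
    rw [mul_pow] at hu
    omega
  have h : 500 * (w : ℤ) ^ 5 = 2187 * (t ^ 5) ^ 2 + 13 := by
    have := congrArg (Nat.cast (R := ℤ)) hv
    push_cast at this
    exact mul_left_cancel₀ (by norm_num : (600 : ℤ) ≠ 0) (by linear_combination this)
  have hw : 0 < w := Nat.pos_of_ne_zero fun h0 => by
    rw [h0] at h
    norm_num at h
    have : (0 : ℤ) ≤ 2187 * (t ^ 5) ^ 2 := by positivity
    omega
  have ht : Odd ((t : ℤ) ^ 5) := by
    rw [← Int.not_even_iff_odd]
    rintro ⟨s, hs⟩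
    rw [hs] at h
    ring_nf at h
    omega
  obtain ⟨n, hn⟩ : ∃ n : ℤ, 81 * (t : ℤ) ^ 5 = 2 * n + 1 := (by decide : Odd (81 : ℤ)).mul ht
  obtain ⟨g, p, hp, hg⟩ := W.exists_pow_five_eq (z := ⟨n, 1⟩) (k := 375) (e := 9) (w := w)
    (Or.inr ⟨rfl, rfl⟩) (by exact_mod_cast hw) (by
      rw [W.norm_mk]
      have : (81 * (t : ℤ) ^ 5) ^ 2 = (2 * n + 1) ^ 2 := by rw [hn]
      linarith) isCoprime_one_left
  have key : ∀ p ∈ [((-3 : ZMod 281), (8 : ZMod 281)), (5, -8)], ∀ t : ZMod 281, ¬ ∀ r ∈ [23, 257],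
      ((141 * (81 * t ^ 5 - 1) - r * 1) * (9 * (p.1 - r * p.2) ^ 3)) ^ 57 =
        (141 * (81 * t ^ 5 - 1) - r * 1) * (9 * (p.1 - r * p.2) ^ 3) := by
    simp only [List.forall_mem_cons, List.not_mem_nil, false_implies, implies_true, and_true]
    constructor <;> decide +kernel
  refine key (p.re, p.im) (by rcases hp with rfl | rfl <;> simp) t ?_
  intro r hmem
  obtain ⟨r, rfl, hr⟩ : ∃ r' : ℤ, r = r' ∧ ((281 : ℕ) : ℤ) ∣ r' ^ 2 + r' + 10 := by
    simp only [List.mem_cons, List.not_mem_nil, or_false] at hmem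
    rcases hmem with rfl | rfl
    · exact ⟨23, by norm_num, by norm_num⟩
    · exact ⟨257, by norm_num, by norm_num⟩
  have h5 := W.resid_pow_five hr hg
  have hz : (141 * (81 * t ^ 5 - 1) : ZMod 281) = n := by
    have : (81 * t ^ 5 : ZMod 281) = 2 * n + 1 := by
      exact_mod_cast congrArg (Int.cast (R := ZMod 281)) hn
    rw [this, show 141 * (2 * n + 1 - 1) = 282 * (n : ZMod 281) by ring,
      show (282 : ZMod 281) = 1 by decide, one_mul]
  have hx : ∀ x : ZMod 281, (x ^ 5) ^ 57 = x ^ 5 := by decide +kernel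
  simp only [W.resid] at h5
  push_cast at h5
  dsimp only
  rw [hz, ← h5, hx]

end CubeSum

namespace CubeSum

/-- The ring `ℤ[∛5]`; `⟨a, b, d⟩` stands for `a + b∛5 + d(∛5)²`. -/
@[ext]
structure CubicRing where
  a : ℤ
  b : ℤ
  d : ℤ

namespace CubicRing

instance : DecidableEq CubicRing := fun _ _ => decidable_of_iff _ CubicRing.ext_iff.symm

instance : Zero CubicRing := ⟨⟨0, 0, 0⟩⟩
instance : One CubicRing := ⟨⟨1, 0, 0⟩⟩
instance : Add CubicRing := ⟨fun x y => ⟨x.a + y.a, x.b + y.b, x.d + y.d⟩⟩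
instance : Neg CubicRing := ⟨fun x => ⟨-x.a, -x.b, -x.d⟩⟩
instance : Mul CubicRing := ⟨fun x y => ⟨x.a * y.a + 5 * (x.b * y.d + x.d * y.b),
  x.a * y.b + x.b * y.a + 5 * x.d * y.d, x.a * y.d + x.b * y.b + x.d * y.a⟩⟩

lemma zero_def : (0 : CubicRing) = ⟨0, 0, 0⟩ := rfl
lemma one_def : (1 : CubicRing) = ⟨1, 0, 0⟩ := rfl
lemma add_def (x y : CubicRing) : x + y = ⟨x.a + y.a, x.b + y.b, x.d + y.d⟩ := rfl
lemma neg_def (x : CubicRing) : -x = ⟨-x.a, -x.b, -x.d⟩ := rfl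
lemma mul_def (x y : CubicRing) : x * y = ⟨x.a * y.a + 5 * (x.b * y.d + x.d * y.b),
  x.a * y.b + x.b * y.a + 5 * x.d * y.d, x.a * y.d + x.b * y.b + x.d * y.a⟩ := rfl

instance : CommRing CubicRing where
  add_assoc x y z := by simp only [add_def, add_assoc]
  zero_add x := by simp only [add_def, zero_def, zero_add]
  add_zero x := by simp only [add_def, zero_def, add_zero]
  add_comm x y := by simp only [add_def, add_comm]
  neg_add_cancel x := by simp only [add_def, neg_def, zero_def, neg_add_cancel]
  mul_assoc x y z := by simp only [mul_def]; ext <;> ring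
  one_mul x := by simp [mul_def, one_def]
  mul_one x := by simp [mul_def, one_def]
  zero_mul x := by simp [mul_def, zero_def]
  mul_zero x := by simp [mul_def, zero_def]
  mul_comm x y := by simp only [mul_def]; ext <;> ring
  left_distrib x y z := by simp only [mul_def, add_def]; ext <;> ring
  right_distrib x y z := by simp only [mul_def, add_def]; ext <;> ring
  nsmul := nsmulRec
  zsmul := zsmulRec

/-- The coefficient of `∛5`. -/
def coeffB : CubicRing →+ ℤ := ⟨⟨b, rfl⟩, fun _ _ => rfl⟩

/-- The coefficient of `(∛5)²`. -/
def coeffD : CubicRing →+ ℤ := ⟨⟨d, rfl⟩, fun _ _ => rfl⟩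

/-- The norm to `ℤ`. -/
def norm : CubicRing →* ℤ where
  toFun x := x.a ^ 3 + 5 * x.b ^ 3 + 25 * x.d ^ 3 - 15 * x.a * x.b * x.d
  map_one' := rfl
  map_mul' x y := by simp only [mul_def]; ring

lemma norm_def (x : CubicRing) :
    norm x = x.a ^ 3 + 5 * x.b ^ 3 + 25 * x.d ^ 3 - 15 * x.a * x.b * x.d := rfl

/-- The real embedding. -/
def val {θ : ℝ} (h : θ ^ 3 = 5) : CubicRing →+* ℝ where
  toFun x := x.a + x.b * θ + x.d * θ ^ 2
  map_one' := by simp [one_def]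
  map_zero' := by simp [zero_def]
  map_add' x y := by simp only [add_def]; push_cast; ring
  map_mul' x y := by
    simp only [mul_def]
    push_cast
    linear_combination -(x.b * y.d + x.d * y.b + x.d * y.d * θ : ℝ) * h

lemma val_def {θ : ℝ} (h : θ ^ 3 = 5) (x : CubicRing) :
    val h x = x.a + x.b * θ + x.d * θ ^ 2 := rfl

/-- The fundamental unit. -/
def ε : CubicRingˣ := ⟨⟨1, -4, 2⟩, ⟨41, 24, 14⟩, rfl, rfl⟩

lemma norm_ε_zpow (n : ℤ) : norm ((ε ^ n : CubicRingˣ) : CubicRing) = 1 := by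
  have h : Units.map norm ε = 1 := by ext; rfl
  have := congrArg (fun u : ℤˣ => (u : ℤ)) (map_zpow (Units.map norm) ε n)
  rw [h, one_zpow] at this
  exact this

lemma abs_bounds_of_norm_le {x y z : ℝ} (h1 : 0.35 ≤ x + y + z) (h2 : x + y + z ≤ 43.05)
    (h : x ^ 3 + y ^ 3 + z ^ 3 - 3 * x * y * z ≤ 156) : -43 < 3 * x ∧ 3 * x < 48 := by
  obtain ⟨r, hr⟩ : ∃ r, r = x + y + z := ⟨_, rfl⟩
  rw [← hr] at h1 h2
  have key : r * (3 * x - r) ^ 2 ≤ 624 := by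
    have : r * (3 * x - r) ^ 2 =
        4 * (x ^ 3 + y ^ 3 + z ^ 3 - 3 * x * y * z) - 3 * (r * (y - z) ^ 2) := by
      subst hr; ring
    have h3 : 0 ≤ r * (y - z) ^ 2 := mul_nonneg (by linarith) (sq_nonneg _)
    linarith
  constructor <;> by_contra! hc
  · have : (43 + r) ^ 2 ≤ (3 * x - r) ^ 2 := by nlinarith
    nlinarith
  · have : (48 - r) ^ 2 ≤ (3 * x - r) ^ 2 := by nlinarith
    have h3 := mul_nonneg (mul_nonneg (sub_nonneg.2 h1) (sub_nonneg.2 h2))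
      (show 0 ≤ 52.6 - r by linarith)
    nlinarith

lemma exists_cube_root : ∃ θ : ℝ, θ ^ 3 = 5 ∧ 1.7099 < θ ∧ θ < 1.71 := by
  refine ⟨(5 : ℝ) ^ (1 / 3 : ℝ), ?_, ?_⟩
  · rw [← Real.rpow_natCast, ← Real.rpow_mul (by norm_num)]
    norm_num
  · generalize hθ : (5 : ℝ) ^ (1 / 3 : ℝ) = θ
    have h : θ ^ 3 = 5 := by
      rw [← hθ, ← Real.rpow_natCast, ← Real.rpow_mul (by norm_num)]
      norm_num
    constructor <;> by_contra! hc
    · have := pow_le_pow_left₀ (hθ ▸ by positivity : 0 ≤ θ) hc 3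
      norm_num [h] at this
    · have := pow_le_pow_left₀ (by norm_num) hc 3
      norm_num [h] at this

lemma exists_zpow_mul_mem {x y : ℝ} (hx : 0 < x) (hy : 1 < y) (hy' : y ≤ 123) :
    ∃ n : ℤ, 0.35 ≤ x * y⁻¹ ^ n ∧ x * y⁻¹ ^ n ≤ 43.05 := by
  obtain ⟨n, h1, h2⟩ := exists_mem_Ico_zpow (show 0 < x / 0.35 by positivity) hy
  have hyn : 0 < y ^ n := zpow_pos (by linarith) n
  rw [zpow_add_one₀ (by linarith)] at h2
  rw [le_div_iff₀ (by norm_num)] at h1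
  rw [div_lt_iff₀ (by norm_num)] at h2
  refine ⟨n, ?_⟩
  rw [inv_zpow, ← div_eq_mul_inv, le_div_iff₀ hyn, div_le_iff₀ hyn]
  constructor
  · linarith
  · nlinarith

lemma exists_mul_zpow_mem_box {u : CubicRing} (h0 : 0 < norm u) (h : norm u ≤ 156) :
    ∃ n : ℤ, ∃ α : CubicRing, α = u * (ε ^ n : CubicRingˣ) ∧ norm α = norm u ∧
      α.a ∈ Set.Icc (-14) 15 ∧ α.b ∈ Set.Icc (-8) 9 ∧ α.d ∈ Set.Icc (-4) 5 := by
  obtain ⟨θ, hθ, h1, h2⟩ := exists_cube_root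
  have hnorm (x : CubicRing) : (norm x : ℝ) = (x.a : ℝ) ^ 3 + (x.b * θ) ^ 3 + (x.d * θ ^ 2) ^ 3
      - 3 * x.a * (x.b * θ) * (x.d * θ ^ 2) := by
    rw [norm_def]
    push_cast
    linear_combination (-(x.b : ℝ) ^ 3 - x.d ^ 3 * (θ ^ 3 + 5) + 3 * x.a * x.b * x.d) * hθ
  have hu : 0 < val hθ u := by
    have h3 : (0 : ℝ) < norm u := by exact_mod_cast h0
    rw [hnorm] at h3
    rw [val_def]
    nlinarith [sq_nonneg (u.a - u.b * θ), sq_nonneg (u.a - u.d * θ ^ 2),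
      sq_nonneg (u.b * θ - u.d * θ ^ 2)]
  have hy : ((ε⁻¹ : CubicRingˣ) : CubicRing) = ⟨41, 24, 14⟩ := rfl
  obtain ⟨n, h3, h4⟩ := exists_zpow_mul_mem hu
    (y := val hθ ((ε⁻¹ : CubicRingˣ) : CubicRing))
    (by rw [hy, val_def]; push_cast; nlinarith) (by rw [hy, val_def]; push_cast; nlinarith)
  have hN : norm (u * (ε ^ n : CubicRingˣ)) = norm u := by rw [map_mul, norm_ε_zpow, mul_one]
  refine ⟨n, _, rfl, hN, ?_⟩
  have hv : val hθ u * (val hθ ((ε⁻¹ : CubicRingˣ) : CubicRing))⁻¹ ^ n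
      = val hθ (u * (ε ^ n : CubicRingˣ)) := by
    have e1 : val hθ ((ε⁻¹ : CubicRingˣ) : CubicRing) = (val hθ (ε : CubicRing))⁻¹ :=
      eq_inv_of_mul_eq_one_left (by rw [← map_mul, ε.inv_mul, map_one])
    have e2 := congrArg Units.val (map_zpow (Units.map (val hθ : CubicRing →* ℝ)) ε n)
    rw [Units.val_zpow_eq_zpow_val] at e2
    rw [map_mul, e1, inv_inv]
    exact congrArg _ e2.symm
  rw [hv, val_def] at h3 h4
  have hN' : (norm (u * (ε ^ n : CubicRingˣ)) : ℝ) ≤ 156 := by exact_mod_cast hN ▸ h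
  rw [hnorm] at hN'
  generalize u * (ε ^ n : CubicRingˣ) = α at *
  obtain ⟨a1, a2⟩ := abs_bounds_of_norm_le h3 h4 hN'
  obtain ⟨b1, b2⟩ := abs_bounds_of_norm_le (x := α.b * θ) (y := α.a) (z := α.d * θ ^ 2)
    (by linarith) (by linarith) (by linarith)
  obtain ⟨d1, d2⟩ := abs_bounds_of_norm_le (x := α.d * θ ^ 2) (y := α.a) (z := α.b * θ)
    (by linarith) (by linarith) (by linarith)
  have up {t : ℝ} {c : ℤ} (k : ℤ) (ht : 0 < t) (h : 3 * (c * t) < 48) (hk : 16 ≤ (k + 1) * t) :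
      c ≤ k := by
    have : (c : ℝ) * t < (k + 1) * t := by linarith
    exact Int.lt_add_one_iff.1 (by exact_mod_cast lt_of_mul_lt_mul_right this ht.le)
  have down {t : ℝ} {c : ℤ} (k : ℤ) (ht : 0 < t) (h : -43 < 3 * (c * t))
      (hk : 43 / 3 ≤ (1 - k) * t) :
      k ≤ c := by
    have : ((k : ℝ) - 1) * t < c * t := by linarith
    have : ((k - 1 : ℤ) : ℝ) < c := by push_cast; exact lt_of_mul_lt_mul_right this ht.le
    have : k - 1 < c := by exact_mod_cast this
    omega
  have ht : 2.9237 < θ ^ 2 := by nlinarith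
  have ht' : 0 < θ := by linarith
  refine ⟨⟨down (t := 1) _ one_pos (by simpa using a1) (by norm_num),
    up (t := 1) _ one_pos (by simpa using a2) (by norm_num)⟩,
    ⟨down _ ht' b1 ?_, up _ ht' b2 ?_⟩, ⟨down _ (by linarith) d1 ?_, up _ (by linarith) d2 ?_⟩⟩ <;>
  · push_cast
    linarith

/-- The elements of the box with the norms of interest, preceded by their norm. -/
def boxed : List (ℤ × CubicRing) :=
  [(156, ⟨-9, 4, 1⟩), (156, ⟨1, -3, 2⟩), (156, ⟨1, 3, -1⟩), (156, ⟨6, 1, 1⟩),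
    (156, ⟨11, -1, -3⟩), (156, ⟨11, 5, 3⟩), (12, ⟨-7, -1, 3⟩), (12, ⟨-2, 3, -1⟩), (12, ⟨3, 1, 1⟩),
    (12, ⟨8, 5, 3⟩), (39, ⟨-6, 7, -2⟩), (39, ⟨-1, 2, 0⟩), (39, ⟨4, 0, -1⟩), (39, ⟨4, 3, 2⟩),
    (13, ⟨-3, 2, 0⟩), (13, ⟨2, 1, 0⟩), (13, ⟨2, 2, 1⟩), (13, ⟨2, 4, -3⟩), (13, ⟨12, -7, 0⟩),
    (1, ⟨1, -4, 2⟩), (1, ⟨1, 0, 0⟩)]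

lemma mem_boxed : ∀ i : Fin 30, ∀ j : Fin 18, ∀ k : Fin 10,
    norm ⟨i - 14, j - 8, k - 4⟩ ∈ [156, 12, 39, 13, 1] →
    (norm ⟨i - 14, j - 8, k - 4⟩, (⟨i - 14, j - 8, k - 4⟩ : CubicRing)) ∈ boxed := by
  decide +kernel

lemma exists_boxed {u : CubicRing} (h : norm u ∈ [156, 12, 39, 13, 1]) :
    ∃ c ∈ boxed, ∃ n : ℤ, norm u = c.1 ∧ u = c.2 * (ε ^ n : CubicRingˣ) := by
  have h0 : 0 < norm u ∧ norm u ≤ 156 := by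
    simp only [List.mem_cons, List.not_mem_nil, or_false] at h
    omega
  obtain ⟨n, α, h1, h2, ⟨ha, ha'⟩, ⟨hb, hb'⟩, hd, hd'⟩ := exists_mul_zpow_mem_box h0.1 h0.2
  have := mem_boxed ⟨(α.a + 14).toNat, by omega⟩ ⟨(α.b + 8).toNat, by omega⟩
    ⟨(α.d + 4).toNat, by omega⟩
  have e : (⟨((α.a + 14).toNat : ℤ) - 14, ((α.b + 8).toNat : ℤ) - 8, ((α.d + 4).toNat : ℤ) - 4⟩ :
      CubicRing) = α := by
    ext <;> dsimp only <;> omega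
  simp only [e, h2] at this
  refine ⟨_, this h, -n, rfl, ?_⟩
  rw [h1, mul_assoc, ← Units.val_mul, ← zpow_add, add_neg_cancel, zpow_zero, Units.val_one, mul_one]

end CubicRing
end CubeSum

namespace CubeSum

namespace CubicRing

lemma map_intCast_mul (φ : CubicRing →+ ℤ) (n : ℤ) (x : CubicRing) :
    φ ((n : CubicRing) * x) = n * φ x := by
  rw [← zsmul_eq_mul, map_zsmul, smul_eq_mul]

lemma zpow_congr {k : ℕ} {M : ℤ} (hk : 0 < k)
    (hM : ∃ δ : CubicRing, (ε : CubicRing) ^ k = 1 + M * δ)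
    (n : ℤ) : ∃ r : Fin k, ∃ q : ℤ, ∃ δ : CubicRing, n = k * q + (r : ℕ) ∧
      ((ε ^ n : CubicRingˣ) : CubicRing) = (ε : CubicRing) ^ (r : ℕ) + M * δ := by
  obtain ⟨δ, hδ⟩ := hM
  have hr : 0 ≤ n % k := Int.emod_nonneg _ (by omega)
  have hr' : n % k < k := Int.emod_lt_of_pos _ (by omega)
  have hn := Int.mul_ediv_add_emod n k
  refine ⟨⟨(n % k).toNat, by omega⟩, n / k, ?_⟩
  have e : ((n % k).toNat : ℤ) = n % k := Int.toNat_of_nonneg hr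
  let f := Ideal.Quotient.mk (Ideal.span {(M : CubicRing)})
  have hf : Units.map f.toMonoidHom (ε ^ k) = 1 := by
    ext
    change f ((ε : CubicRing) ^ k) = 1
    rw [hδ, map_add, map_one, add_eq_left]
    exact Ideal.Quotient.eq_zero_iff_mem.2 (Ideal.mul_mem_right _ _
        (Ideal.mem_span_singleton_self _))
  have h1 : Units.map f.toMonoidHom (ε ^ n) = Units.map f.toMonoidHom (ε ^ (n % k).toNat) := by
    rw [show ε ^ n = (ε ^ k) ^ (n / k) * ε ^ (n % k).toNat by
      rw [← zpow_natCast, ← zpow_natCast, ← zpow_mul, ← zpow_add, e, hn], map_mul, map_zpow, hf,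
      one_zpow, one_mul]
  have h2 : f ((ε ^ n : CubicRingˣ) : CubicRing) = f ((ε : CubicRing) ^ (n % k).toNat) :=
    congrArg Units.val h1
  obtain ⟨x, hx⟩ := Ideal.mem_span_singleton.1 (Ideal.Quotient.eq.1 h2)
  exact ⟨x, by rw [e, hn], by rw [← hx]; ring⟩

lemma exists_residue {k : ℕ} {M : ℤ} (hk : 0 < k)
    (hM : ∃ δ : CubicRing, (ε : CubicRing) ^ k = 1 + M * δ) (φ : CubicRing →+ ℤ) (α : CubicRing)
    {n : ℤ} (h : M ∣ φ (α * (ε ^ n : CubicRingˣ))) :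
    ∃ r : Fin k, M ∣ φ (α * (ε : CubicRing) ^ (r : ℕ)) ∧ ∃ q : ℤ, n = k * q + (r : ℕ) := by
  obtain ⟨r, q, δ, hn, e⟩ := zpow_congr hk hM n
  refine ⟨r, ?_, q, hn⟩
  rw [e, mul_add, show α * (M * δ) = M * (α * δ) by ring, map_add, map_intCast_mul] at h
  exact (dvd_add_left (dvd_mul_right _ _)).1 h

lemma exists_pow_eq_of_two_pow_dvd (μ : CubicRing) (s n : ℕ) :
    ∃ ξ : CubicRing, (1 + 4 * μ) ^ (2 ^ s * n) = 1 + 4 * (2 ^ s * n) * μ + 2 ^ (s + 3) * ξ := by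
  induction s with
  | zero =>
    induction n with
    | zero => exact ⟨0, by simp⟩
    | succ n ih =>
      obtain ⟨ξ, h⟩ := ih
      refine ⟨ξ * (1 + 4 * μ) + 2 * n * μ ^ 2, ?_⟩
      rw [mul_add_one, pow_add, h]
      push_cast
      ring
  | succ s ih =>
    obtain ⟨ξ, h⟩ := ih
    refine ⟨ξ * (1 + 4 * (2 ^ s * n) * μ) + 2 ^ s * n ^ 2 * μ ^ 2 + 2 ^ (s + 2) * ξ ^ 2, ?_⟩
    rw [show 2 ^ (s + 1) * n = 2 ^ s * n * 2 by ring, pow_mul, h]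
    ring

lemma eq_zero_of_map_mul_pow_eq_zero {φ : CubicRing →+ ℤ} {β μ : CubicRing} (hβ : φ β = 0)
    (h1 : Odd (φ (β * μ))) {j : ℕ} (h : φ (β * (1 + 4 * μ) ^ j) = 0) : j = 0 := by
  by_contra hj
  obtain ⟨s, n, hn, rfl⟩ := Nat.exists_eq_two_pow_mul_odd hj
  obtain ⟨ξ, e⟩ := exists_pow_eq_of_two_pow_dvd μ s n
  have e2 : β * (1 + 4 * μ) ^ (2 ^ s * n) = β + ((4 * 2 ^ s * n : ℤ) : CubicRing) * (β * μ) +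
      ((4 * 2 ^ s * 2 : ℤ) : CubicRing) * (β * ξ) := by
    rw [e]
    push_cast
    ring
  rw [e2, map_add, map_add, hβ, map_intCast_mul, map_intCast_mul, zero_add] at h
  have h2 : n * φ (β * μ) + 2 * φ (β * ξ) = 0 := by
    refine (mul_eq_zero.1 ?_ : (4 * 2 ^ s : ℤ) = 0 ∨ _).resolve_left (by positivity)
    linear_combination h
  have h3 : Odd ((n : ℤ) * φ (β * μ)) := Odd.mul (by exact_mod_cast hn) h1
  rw [Int.odd_iff] at h3
  omega

lemma eq_zero_of_map_mul_zpow_eq_zero {φ : CubicRing →+ ℤ} {β : CubicRing} (hβ : φ β = 0)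
    (h1 : Odd (φ (β * ⟨-20, 3, 5⟩))) (h2 : Odd (φ (β * ⟨1260, 737, 431⟩))) {j : ℤ}
    (h : φ (β * (ε ^ (2 * j) : CubicRingˣ)) = 0) : j = 0 := by
  obtain ⟨n, rfl | rfl⟩ := j.eq_nat_or_neg
  · rw [zpow_mul, zpow_natCast, Units.val_pow_eq_pow_val,
      show ((ε ^ (2 : ℤ) : CubicRingˣ) : CubicRing) = 1 + 4 * ⟨-20, 3, 5⟩ from rfl] at h
    exact_mod_cast eq_zero_of_map_mul_pow_eq_zero hβ h1 h
  · rw [mul_neg, ← neg_mul, zpow_mul, zpow_natCast, Units.val_pow_eq_pow_val,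
      show ((ε ^ (-2 : ℤ) : CubicRingˣ) : CubicRing) = 1 + 4 * ⟨1260, 737, 431⟩ from rfl] at h
    simpa using eq_zero_of_map_mul_pow_eq_zero hβ h2 h

end CubicRing
end CubeSum

namespace CubeSum

namespace CubicRing

lemma ε_pow_four : ∃ δ : CubicRing, (ε : CubicRing) ^ 4 = 1 + (8 : ℤ) * δ :=
  ⟨⟨1080, 13, -377⟩, by decide +kernel⟩

lemma ε_pow_five : ∃ δ : CubicRing, (ε : CubicRing) ^ 5 = 1 + (10 : ℤ) * δ :=
  ⟨⟨7000, -6462, 1385⟩, by decide +kernel⟩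

lemma ε_pow_twelve : ∃ δ : CubicRing, (ε : CubicRing) ^ 12 = 1 + (13 : ℤ) * δ :=
  ⟨⟨-9382052160, 92447536344, -50855030520⟩, by decide +kernel⟩

lemma ne_of_cube_add {C X w : ℤ} (hC : C = 156 ∨ C = 12) : X ^ 3 + C ≠ 5 * w ^ 3 := by
  intro h
  have hN : norm ⟨-X, w, 0⟩ = C := by rw [norm_def]; linear_combination -h
  obtain ⟨c, hc, n, h1, h2⟩ := exists_boxed (u := ⟨-X, w, 0⟩)
      (by rcases hC with rfl | rfl <;> simp [hN])
  have h3 : (10 : ℤ) ∣ coeffD (c.2 * (ε ^ n : CubicRingˣ)) := by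
    rw [← h2]
    exact dvd_zero _
  obtain ⟨r, hr, -⟩ := exists_residue (by norm_num) ε_pow_five coeffD c.2 h3
  rw [hN] at h1
  revert h1 hr r
  clear h2 h3
  rcases hC with rfl | rfl <;> revert c <;> decide +kernel

lemma eq_one_of_cube_add {X w : ℤ} (h : X ^ 3 + 39 = 5 * w ^ 3) : X = 1 := by
  have hN : norm ⟨-X, w, 0⟩ = 39 := by rw [norm_def]; linear_combination -h
  obtain ⟨c, hc, n, h1, h2⟩ := exists_boxed (u := ⟨-X, w, 0⟩) (by simp [hN])
  have h3 : coeffD (c.2 * (ε ^ n : CubicRingˣ)) = 0 := by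
    rw [← h2]
    rfl
  obtain ⟨r, hr, q, hn⟩ := exists_residue (by norm_num) ε_pow_four coeffD c.2 (h3 ▸ dvd_zero _)
  rw [hN] at h1
  have key : ∀ c ∈ boxed, 39 = c.1 → ∀ r : Fin 4, 8 ∣ coeffD (c.2 * (ε : CubicRing) ^ (r : ℕ)) →
      c.2 = ⟨-1, 2, 0⟩ ∧ r = 0 := by decide +kernel
  obtain ⟨e, rfl⟩ := key c hc h1 r hr
  obtain rfl : n = 2 * (2 * q) := by simpa [← mul_assoc] using hn
  rw [e] at h2 h3
  have h4 := eq_zero_of_map_mul_zpow_eq_zero rfl (by decide +kernel) (by decide +kernel) h3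
  have := congrArg CubicRing.a h2
  simp [h4] at this
  omega

lemma mem_of_cube_add {X w : ℤ} (h : X ^ 3 + 13 = 5 * w ^ 3) : X = 3 ∨ X = -2 ∨ X = -12 := by
  have hN : norm ⟨-X, w, 0⟩ = 13 := by rw [norm_def]; linear_combination -h
  obtain ⟨c, hc, n, h1, h2⟩ := exists_boxed (u := ⟨-X, w, 0⟩) (by simp [hN])
  obtain ⟨α, n, h2, hα⟩ : ∃ α : CubicRing, ∃ n : ℤ, ⟨-X, w, 0⟩ = α * (ε ^ n : CubicRingˣ) ∧
      α ∈ ([⟨-3, 2, 0⟩, ⟨2, 1, 0⟩, ⟨2, 2, 1⟩, ⟨2, 4, -3⟩] : List CubicRing) := by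
    by_cases e : c.2 = ⟨12, -7, 0⟩
    · refine ⟨⟨2, 1, 0⟩, n + 1, ?_, by decide +kernel⟩
      rw [h2, e, add_comm, zpow_add, Units.val_mul, ← mul_assoc]
      rfl
    · refine ⟨c.2, n, h2, ?_⟩
      rw [hN] at h1
      revert h1 e
      clear h2
      revert c
      decide +kernel
  have h3 : coeffD (α * (ε ^ n : CubicRingˣ)) = 0 := by
    rw [← h2]
    rfl
  obtain ⟨r, hr, q, hn⟩ := exists_residue (by norm_num) ε_pow_four coeffD α (h3 ▸ dvd_zero _)
  have key : ∀ α ∈ ([⟨-3, 2, 0⟩, ⟨2, 1, 0⟩, ⟨2, 2, 1⟩, ⟨2, 4, -3⟩] : List CubicRing), ∀ r : Fin 4,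
      8 ∣ coeffD (α * (ε : CubicRing) ^ (r : ℕ)) →
      α * (ε : CubicRing) ^ (r : ℕ) ∈ ([⟨-3, 2, 0⟩, ⟨2, 1, 0⟩, ⟨12, -7, 0⟩] : List CubicRing) := by
    decide +kernel
  have hk := key α hα r hr
  have e : α * (ε ^ n : CubicRingˣ) =
      α * (ε : CubicRing) ^ (r : ℕ) * (ε ^ (2 * (2 * q)) : CubicRingˣ) := by
    rw [hn, add_comm, zpow_add, Units.val_mul, ← mul_assoc, zpow_natCast, Units.val_pow_eq_pow_val]
    norm_num [← mul_assoc]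
  rw [e] at h2 h3
  have key2 : ∀ β ∈ ([⟨-3, 2, 0⟩, ⟨2, 1, 0⟩, ⟨12, -7, 0⟩] : List CubicRing), coeffD β = 0 ∧
      Odd (coeffD (β * ⟨-20, 3, 5⟩)) ∧ Odd (coeffD (β * ⟨1260, 737, 431⟩)) ∧
      (-β.a = 3 ∨ -β.a = -2 ∨ -β.a = -12) := by decide +kernel
  obtain ⟨k1, k2, k3, k4⟩ := key2 _ hk
  have h4 := eq_zero_of_map_mul_zpow_eq_zero k1 k2 k3 h3
  rw [h4, mul_zero, zpow_zero, Units.val_one, mul_one] at h2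
  rw [← h2] at k4
  simpa using k4

lemma ne_of_twentyfive_mul_cube_add {C X w : ℤ} (hC : C = 156 ∨ C = 12) :
    25 * X ^ 3 + C ≠ w ^ 3 := by
  intro h
  have hN : norm ⟨w, 0, -X⟩ = C := by rw [norm_def]; linear_combination -h
  obtain ⟨c, hc, n, h1, h2⟩ := exists_boxed (u := ⟨w, 0, -X⟩)
      (by rcases hC with rfl | rfl <;> simp [hN])
  have h3 : (8 : ℤ) ∣ coeffB (c.2 * (ε ^ n : CubicRingˣ)) := by
    rw [← h2]
    exact dvd_zero _
  obtain ⟨r, hr, -⟩ := exists_residue (by norm_num) ε_pow_four coeffB c.2 h3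
  rw [hN] at h1
  revert h1 hr r
  clear h2 h3
  rcases hC with rfl | rfl <;> revert c <;> decide +kernel

lemma eq_one_of_twentyfive_mul_cube_add {X w : ℤ} (h : 25 * X ^ 3 + 39 = w ^ 3) : X = 1 := by
  have hN : norm ⟨w, 0, -X⟩ = 39 := by rw [norm_def]; linear_combination -h
  obtain ⟨c, hc, n, h1, h2⟩ := exists_boxed (u := ⟨w, 0, -X⟩) (by simp [hN])
  have h3 : coeffB (c.2 * (ε ^ n : CubicRingˣ)) = 0 := by
    rw [← h2]
    rfl
  obtain ⟨r, hr, q, hn⟩ := exists_residue (by norm_num) ε_pow_four coeffB c.2 (h3 ▸ dvd_zero _)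
  rw [hN] at h1
  have key : ∀ c ∈ boxed, 39 = c.1 → ∀ r : Fin 4, 8 ∣ coeffB (c.2 * (ε : CubicRing) ^ (r : ℕ)) →
      c.2 = ⟨4, 0, -1⟩ ∧ r = 0 := by decide +kernel
  obtain ⟨e, rfl⟩ := key c hc h1 r hr
  obtain rfl : n = 2 * (2 * q) := by simpa [← mul_assoc] using hn
  rw [e] at h2 h3
  have h4 := eq_zero_of_map_mul_zpow_eq_zero rfl (by decide +kernel) (by decide +kernel) h3
  have := congrArg CubicRing.d h2
  simp [h4] at this
  omega

lemma eq_zero_of_twentyfive_mul_cube_add {X w : ℤ} (hX : 13 ∣ X) (h : 25 * X ^ 3 + 1 = w ^ 3) :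
    X = 0 := by
  have hN : norm ⟨w, 0, -X⟩ = 1 := by rw [norm_def]; linear_combination -h
  obtain ⟨c, hc, n, h1, h2⟩ := exists_boxed (u := ⟨w, 0, -X⟩) (by simp [hN])
  obtain ⟨n, h2⟩ : ∃ n : ℤ, (⟨w, 0, -X⟩ : CubicRing) = 1 * (ε ^ n : CubicRingˣ) := by
    have key : ∀ c ∈ boxed, 1 = c.1 → c.2 = 1 ∨ c.2 = (ε : CubicRing) := by decide +kernel
    rcases key c hc (hN ▸ h1) with e | e
    · exact ⟨n, by rw [h2, e]⟩
    · exact ⟨n + 1, by rw [h2, e, add_comm, zpow_add, zpow_one, Units.val_mul, one_mul]⟩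
  have h3 : coeffB (1 * (ε ^ n : CubicRingˣ)) = 0 := by
    rw [← h2]
    rfl
  have h4 : 13 ∣ coeffD (1 * (ε ^ n : CubicRingˣ)) := by
    rw [← h2]
    exact (dvd_neg (a := (13 : ℤ))).2 hX
  obtain ⟨r, hr, q, hn⟩ := exists_residue (by norm_num) ε_pow_twelve coeffD 1 h4
  have key : ∀ r : Fin 12, 13 ∣ coeffD (1 * (ε : CubicRing) ^ (r : ℕ)) →
    (r : ℕ) % 2 = 0 := by decide +kernel
  obtain ⟨j, rfl⟩ : 2 ∣ n := by
    have := key r hr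
    omega
  have h5 := eq_zero_of_map_mul_zpow_eq_zero rfl (by decide +kernel) (by decide +kernel) h3
  rw [h5, mul_zero, zpow_zero, Units.val_one, mul_one] at h2
  exact neg_eq_zero.1 (congrArg CubicRing.d h2)

end CubicRing
end CubeSum

namespace CubeSum

lemma exists_eq_mul_cube {m y : ℕ} (hy : 25 * m * (m ^ 2 + 156) = y ^ 3) :
    ∃ s ∈ [1, 2, 9, 18, 169, 338, 1521, 3042, 5, 10, 45, 90, 845, 1690, 7605, 15210], ∃ t,
      m = s * t ^ 3 := by
  have key : ∀ c ∈ shapes, ∃ s ∈ [1, 2, 9, 18, 169, 338, 1521, 3042, 5, 10, 45, 90, 845, 1690,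
      7605, 15210], ∃ R ∈ [1, 2, 3, 6, 13, 26, 39, 78, 5, 10, 15, 30, 65, 130, 195, 390],
      R ∣ 390 ∧ R ∣ c.2 ∧ c.2.Coprime c.1 ∧ 0 < c.2 ∧ c.2 * s = c.1 * R ^ 3 := by decide +kernel
  obtain ⟨c, hc, u, v, hu, -⟩ := exists_shape hy
  obtain ⟨s, hs, R, -, hR, hRc, hcop, hpos, e⟩ := key c hc
  have h390 : Squarefree 390 := by decide +kernel
  have hd : R ∣ u :=
    ((h390.squarefree_of_dvd hR).dvd_pow_iff_dvd three_ne_zero).1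
      (hRc.trans (hcop.dvd_of_dvd_mul_left (hu ▸ dvd_mul_right _ _)))
  obtain ⟨t, rfl⟩ := hd
  refine ⟨s, hs, t, Nat.eq_of_mul_eq_mul_left hpos ?_⟩
  rw [hu, ← mul_assoc, e]
  ring

lemma exists_eq_cube_of_mul {K F z : ℕ} (hK : 0 < K) (h : K ^ 3 * F = z ^ 3) : ∃ w, F = w ^ 3 := by
  obtain ⟨w, rfl⟩ := (Nat.pow_dvd_pow_iff three_ne_zero).1 (Dvd.intro _ h)
  exact ⟨w, Nat.eq_of_mul_eq_mul_left (pow_pos hK 3) (by rw [h, mul_pow])⟩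

lemma exists_eq_five_mul_cube {K F z : ℕ} (hK : 0 < K) (h : K ^ 3 * (25 * F) = z ^ 3) :
    ∃ w, F = 5 * w ^ 3 := by
  obtain ⟨z, hz⟩ := exists_eq_cube_of_mul hK h
  obtain ⟨w, rfl⟩ : 5 ∣ z := Nat.Prime.dvd_of_dvd_pow (by norm_num : Nat.Prime 5)
      (n := 3) (by omega)
  exact ⟨w, by linarith⟩

lemma mod_nine : ∀ X w : ZMod 9, 27 * X ^ 3 + 52 ≠ 5 * w ^ 3 ∧ 59319 * X ^ 3 + 1 ≠ 5 * w ^ 3 ∧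
    675 * X ^ 3 + 52 ≠ w ^ 3 ∧ 675 * X ^ 3 + 13 ≠ w ^ 3 ∧ 1482975 * X ^ 3 + 4 ≠ w ^ 3 := by
  decide +kernel

lemma mod_thirteen : ∀ X w : ZMod 13, 2197 * X ^ 3 + 3 ≠ 5 * w ^ 3 ∧ 59319 * X ^ 3 + 4 ≠ 5 * w ^ 3 ∧
    54925 * X ^ 3 + 3 ≠ w ^ 3 := by
  decide +kernel

open CubicRing in
lemma eq_of_eq_cube {m y : ℕ} (hm : 11 ≤ m) (hy : 25 * m * (m ^ 2 + 156) = y ^ 3) : m = 18 := by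
  obtain ⟨s, hs, t, rfl⟩ := exists_eq_mul_cube hy
  have ht : 0 < t := by
    by_contra! h
    obtain rfl : t = 0 := by omega
    omega
  obtain ⟨z, rfl⟩ : t ∣ y := (Nat.pow_dvd_pow_iff three_ne_zero).1
    ⟨25 * s * ((s * t ^ 3) ^ 2 + 156), by rw [← hy]; ring⟩
  obtain ⟨X, hX⟩ : ∃ X, X = t ^ 2 := ⟨_, rfl⟩
  have hz : 25 * s * (s ^ 2 * X ^ 3 + 156) = z ^ 3 := by
    refine Nat.eq_of_mul_eq_mul_left (pow_pos ht 3) ?_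
    rw [← mul_pow, ← hy, hX]
    ring
  have h5 (K F : ℕ) (hK : 0 < K) (e : 25 * s * (s ^ 2 * X ^ 3 + 156) = K ^ 3 * (25 * F)) :
      ∃ w, F = 5 * w ^ 3 := exists_eq_five_mul_cube hK (e ▸ hz)
  have h1 (K F : ℕ) (hK : 0 < K) (e : 25 * s * (s ^ 2 * X ^ 3 + 156) = K ^ 3 * F) :
      ∃ w, F = w ^ 3 := exists_eq_cube_of_mul hK (e ▸ hz)
  have hX1 (h : (X : ℤ) = 1) : t = 1 := by
    have : X = 1 := by exact_mod_cast h
    rw [hX] at this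
    simpa using this
  have h9 {a b : ℕ} (h : a = b) : (a : ZMod 9) = b := by rw [h]
  have h13 {a b : ℕ} (h : a = b) : (a : ZMod 13) = b := by rw [h]
  simp only [List.mem_cons, List.not_mem_nil, or_false] at hs
  rcases hs with rfl | rfl | rfl | rfl | rfl | rfl | rfl | rfl | rfl | rfl | rfl | rfl | rfl | rfl |
    rfl | rfl
  · obtain ⟨w, h⟩ := h5 1 (X ^ 3 + 156) (by norm_num) (by ring)
    exact absurd (by exact_mod_cast h) (ne_of_cube_add (X := X) (w := w) (.inl rfl))
  · obtain ⟨w, h⟩ := h5 2 (X ^ 3 + 39) (by norm_num) (by ring)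
    have := hX1 (eq_one_of_cube_add (w := w) (by exact_mod_cast h))
    subst this
    omega
  · obtain ⟨w, h⟩ := h5 3 (27 * X ^ 3 + 52) (by norm_num) (by ring)
    exact absurd (by exact_mod_cast h9 h) (mod_nine X w).1
  · obtain ⟨w, h⟩ := h5 6 ((3 * X) ^ 3 + 13) (by norm_num) (by ring)
    have := mem_of_cube_add (X := 3 * X) (w := w) (by exact_mod_cast h)
    rw [hX1 (by omega), one_pow, mul_one]
  · obtain ⟨w, h⟩ := h5 13 ((13 * X) ^ 3 + 12) (by norm_num) (by ring)
    exact absurd (by exact_mod_cast h) (ne_of_cube_add (X := 13 * X) (w := w) (.inr rfl))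
  · obtain ⟨w, h⟩ := h5 26 (2197 * X ^ 3 + 3) (by norm_num) (by ring)
    exact absurd (by exact_mod_cast h13 h) (mod_thirteen X w).1
  · obtain ⟨w, h⟩ := h5 39 (59319 * X ^ 3 + 4) (by norm_num) (by ring)
    exact absurd (by exact_mod_cast h13 h) (mod_thirteen X w).2.1
  · obtain ⟨w, h⟩ := h5 78 (59319 * X ^ 3 + 1) (by norm_num) (by ring)
    exact absurd (by exact_mod_cast h9 h) (mod_nine X w).2.1
  · obtain ⟨w, h⟩ := h1 5 (25 * X ^ 3 + 156) (by norm_num) (by ring)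
    exact absurd (by exact_mod_cast h) (ne_of_twentyfive_mul_cube_add (X := X) (w := w) (.inl rfl))
  · obtain ⟨w, h⟩ := h1 10 (25 * X ^ 3 + 39) (by norm_num) (by ring)
    have := hX1 (eq_one_of_twentyfive_mul_cube_add (w := w) (by exact_mod_cast h))
    subst this
    omega
  · obtain ⟨w, h⟩ := h1 15 (675 * X ^ 3 + 52) (by norm_num) (by ring)
    exact absurd (by exact_mod_cast h9 h) (mod_nine X w).2.2.1
  · obtain ⟨w, h⟩ := h1 30 (675 * X ^ 3 + 13) (by norm_num) (by ring)
    exact absurd (by exact_mod_cast h9 h) (mod_nine X w).2.2.2.1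
  · obtain ⟨w, h⟩ := h1 65 (25 * (13 * X) ^ 3 + 12) (by norm_num) (by ring)
    exact absurd (by exact_mod_cast h)
        (ne_of_twentyfive_mul_cube_add (X := 13 * X) (w := w) (.inr rfl))
  · obtain ⟨w, h⟩ := h1 130 (54925 * X ^ 3 + 3) (by norm_num) (by ring)
    exact absurd (by exact_mod_cast h13 h) (mod_thirteen X w).2.2
  · obtain ⟨w, h⟩ := h1 195 (1482975 * X ^ 3 + 4) (by norm_num) (by ring)
    exact absurd (by exact_mod_cast h9 h) (mod_nine X w).2.2.2.2
  · obtain ⟨w, h⟩ := h1 390 (25 * (39 * X) ^ 3 + 1) (by norm_num) (by ring)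
    have := eq_zero_of_twentyfive_mul_cube_add (X := 39 * X) (w := w) ⟨3 * X, by ring⟩
      (by exact_mod_cast h)
    have : 0 < X := hX ▸ pow_pos ht 2
    omega

end CubeSum

namespace CubeSum

/-- The sequence with `s (n + 2) = p * s (n + 1) - s n` starting from `a` and `b`. -/
def recur (p a b : ℤ) : ℕ → ℤ
  | 0 => a
  | 1 => b
  | n + 2 => p * recur p a b (n + 1) - recur p a b n

variable (p a b : ℤ)

lemma recur_add_two (n : ℕ) : recur p a b (n + 2) = p * recur p a b (n + 1) - recur p a b n := rfl

lemma recur_add_recur (k : ℕ) : ∀ n,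
    recur p a b (n + 2 * k) + recur p a b n = recur p 2 p k * recur p a b (n + k) := by
  induction k using Nat.twoStepInduction with
  | zero => intro n; simp only [recur, mul_zero, add_zero]; ring
  | one => intro n; rw [mul_one, recur_add_two, recur]; ring
  | more k h0 h1 =>
    intro n
    have e1 := h1 (n + 1)
    have e0 := h0 (n + 2)
    have f1 := recur_add_two p a b (n + 2 + 2 * k)
    have f2 := recur_add_two p a b n
    rw [show n + 1 + 2 * (k + 1) = n + 2 + 2 * k + 1 by ring,
      show n + 1 + (k + 1) = n + (k + 2) by ring] at e1
    rw [show n + 2 + k = n + (k + 2) by ring] at e0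
    rw [show n + 2 * (k + 2) = n + 2 + 2 * k + 2 by ring, recur_add_two p 2 p k]
    linear_combination p * e1 - e0 + f1 + f2

lemma recur_two_mul (k : ℕ) : recur p 2 p (2 * k) = recur p 2 p k ^ 2 - 2 := by
  have h := recur_add_recur p 2 p k 0
  simp only [zero_add] at h
  rw [show recur p 2 p 0 = 2 from rfl] at h
  linear_combination h

lemma recur_dvd_add (k n t : ℕ) :
    recur p 2 p k ∣ recur p a b (n + 2 * k * (2 * t + 1)) + recur p a b n := by
  induction t with
  | zero => simp [recur_add_recur]
  | succ t ih =>
    have h1 := recur_add_recur p a b k (n + 2 * k * (2 * t + 1))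
    have h2 := recur_add_recur p a b k (n + 2 * k * (2 * t + 1) + 2 * k)
    rw [show n + 2 * k * (2 * (t + 1) + 1) = n + 2 * k * (2 * t + 1) + 2 * k + 2 * k by ring]
    have e : recur p a b (n + 2 * k * (2 * t + 1) + 2 * k + 2 * k) + recur p a b n =
      recur p 2 p k * recur p a b (n + 2 * k * (2 * t + 1) + 2 * k + k) -
      recur p 2 p k * recur p a b (n + 2 * k * (2 * t + 1) + k) +
      (recur p a b (n + 2 * k * (2 * t + 1)) + recur p a b n) := by
      linear_combination h2 - h1
    rw [e]
    exact dvd_add (dvd_sub (dvd_mul_right _ _) (dvd_mul_right _ _)) ih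

lemma recur_modEq {p a b m : ℤ} {r : ℕ} (h0 : recur p a b r ≡ a [ZMOD m])
    (h1 : recur p a b (r + 1) ≡ b [ZMOD m]) (n : ℕ) :
    recur p a b (n + r) ≡ recur p a b n [ZMOD m] := by
  induction n using Nat.twoStepInduction with
  | zero => simpa [recur] using h0
  | one => rw [add_comm 1 r]; exact h1
  | more n h2 h3 =>
    rw [show n + 2 + r = n + r + 2 by ring, recur_add_two, recur_add_two]
    rw [show n + 1 + r = n + r + 1 by ring] at h3
    exact (h3.mul_left p).sub h2

lemma recur_modEq_mod {p a b m : ℤ} {r : ℕ} (h0 : recur p a b r ≡ a [ZMOD m])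
    (h1 : recur p a b (r + 1) ≡ b [ZMOD m]) (n : ℕ) :
    recur p a b n ≡ recur p a b (n % r) [ZMOD m] := by
  have : ∀ t s, recur p a b (s + r * t) ≡ recur p a b s [ZMOD m] := by
    intro t
    induction t with
    | zero => intro s; rfl
    | succ t ih =>
      intro s
      rw [show s + r * (t + 1) = s + r * t + r by ring]
      exact (recur_modEq h0 h1 _).trans (ih s)
  conv_lhs => rw [← Nat.mod_add_div n r]
  exact this _ _

lemma exists_two_pow_mul_odd {n : ℕ} (hn : n ≠ 0) (h2 : 2 ∣ n) :
    ∃ h t, n = 2 * 2 ^ h * (2 * t + 1) := by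
  obtain ⟨m, rfl⟩ := h2
  obtain ⟨h, t, ht, e⟩ := Nat.exists_eq_two_pow_mul_odd (n := m) (by omega)
  obtain ⟨t, rfl⟩ := ht
  exact ⟨h, t, by rw [e]; ring⟩

lemma not_sq_of_dvd_add_one {a v : ℤ} (hv : v % 4 = 3) (h0 : 0 < v)
    (h : v ∣ a ^ 2 + 1) : False := by
  lift v to ℕ using h0.le
  have hodd : Odd v := Nat.odd_iff.2 (by omega)
  have h1 : jacobiSym (-1) v = -1 := by
    rw [jacobiSym.at_neg_one hodd, ZMod.χ₄_nat_three_mod_four (by omega)]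
  have h2 : jacobiSym (-1) v = jacobiSym (a ^ 2) v :=
    jacobiSym.mod_left' (Int.modEq_iff_dvd.2 (by simpa using h))
  rw [jacobiSym.pow_left] at h2
  nlinarith [sq_nonneg (jacobiSym a v)]

lemma exists_recur_of_thirteen (e : ℕ) : ∀ b : ℕ, 0 < e → b ^ 2 = 13 * e ^ 2 + 12 →
    ∃ n, ((e : ℤ) = recur 11 1 13 n ∧ 2 * recur 11 1 13 (n + 1) = 11 * e + 3 * b) ∨
      ((e : ℤ) = recur 11 2 23 n ∧ 2 * recur 11 2 23 (n + 1) = 11 * e + 3 * b) := by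
  induction e using Nat.strong_induction_on with
  | _ e ih =>
  intro b he hb
  by_cases h6 : e < 6
  · have hb20 : b < 20 := by nlinarith
    refine ⟨0, ?_⟩
    interval_cases e <;> interval_cases b <;> simp_all [recur]
  · have h1 : b % 2 = e % 2 := by
      have : Even (b ^ 2) ↔ Even (13 * e ^ 2 + 12) := by rw [hb]
      have h13 : ¬ Even 13 := by decide
      have h12 : Even 12 := by decide
      rw [Nat.even_add, Nat.even_mul, Nat.even_pow' two_ne_zero, Nat.even_pow' two_ne_zero] at this
      simp only [h13, h12, false_or, iff_true, Nat.even_iff] at this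
      omega
    have h2 : 3 * b < 11 * e := by nlinarith
    have h3 : 39 * e < 11 * b := by nlinarith
    obtain ⟨f, hf⟩ : ∃ f, 11 * e = 3 * b + 2 * f := ⟨(11 * e - 3 * b) / 2, by omega⟩
    obtain ⟨c, hc⟩ : ∃ c, 11 * b = 39 * e + 2 * c := ⟨(11 * b - 39 * e) / 2, by omega⟩
    have hfc : c ^ 2 = 13 * f ^ 2 + 12 := by
      zify at hf hc hb ⊢
      refine mul_left_cancel₀ (four_ne_zero (α := ℤ)) ?_
      linear_combination 4 * hb - (2 * c + 11 * b - 39 * e) * hc +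
          13 * (2 * f + 11 * e - 3 * b) * hf
    obtain ⟨n, h | h⟩ := ih f (by nlinarith) c (by omega) hfc
    · refine ⟨n + 1, .inl ⟨?_, ?_⟩⟩
      · zify at hf hc; linarith
      · rw [recur_add_two]; zify at hf hc; linarith
    · refine ⟨n + 1, .inr ⟨?_, ?_⟩⟩
      · zify at hf hc; linarith
      · rw [recur_add_two]; zify at hf hc; linarith

lemma eq_one_of_thirteen {t b : ℕ} (h0 : 0 < t) (h : 13 * t ^ 4 + 12 = b ^ 2) : t = 1 := by
  obtain ⟨n, h | h⟩ := exists_recur_of_thirteen (t ^ 2) b (by positivity) (by rw [← h]; ring)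
  · have h1 := h.1
    by_cases hn : n = 0
    · subst hn
      have : t ^ 2 = 1 := by rw [recur] at h1; exact_mod_cast h1
      simpa using this
    · have h8 := recur_modEq_mod (p := 11) (a := 1) (b := 13) (m := 8) (r := 6) (by decide)
        (by decide) n
      rw [← h1] at h8
      have h8' : (t : ℤ) ^ 2 % 8 = 0 ∨ (t : ℤ) ^ 2 % 8 = 1 ∨ (t : ℤ) ^ 2 % 8 = 4 := by
        have : (t : ℤ) % 8 = 0 ∨ (t : ℤ) % 8 = 1 ∨ (t : ℤ) % 8 = 2 ∨ (t : ℤ) % 8 = 3 ∨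
          (t : ℤ) % 8 = 4 ∨ (t : ℤ) % 8 = 5 ∨ (t : ℤ) % 8 = 6 ∨ (t : ℤ) % 8 = 7 := by omega
        rcases this with h | h | h | h | h | h | h | h <;> simp [pow_two, Int.mul_emod, h]
      have h2 : 2 ∣ n := by
        by_contra h2
        push_cast [Int.ModEq] at h8
        rcases (by omega : n % 6 = 1 ∨ n % 6 = 3 ∨ n % 6 = 5) with h | h | h <;> rw [h] at h8 <;>
          norm_num [recur] at h8 <;> omega
      obtain ⟨k, s, rfl⟩ := exists_two_pow_mul_odd hn h2
      have hd := recur_dvd_add 11 1 13 (2 ^ k) 0 s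
      rw [zero_add, ← h1] at hd
      have hv : ∀ k, recur 11 2 11 (2 ^ k) % 4 = 3 ∧ 0 < recur 11 2 11 (2 ^ k) := by
        intro k
        induction k with
        | zero => decide
        | succ k ih =>
          rw [pow_succ', recur_two_mul]
          generalize recur 11 2 11 (2 ^ k) = w at ih
          obtain ⟨j, rfl⟩ : ∃ j, w = 4 * j + 3 := ⟨w / 4, by omega⟩
          constructor
          · ring_nf; omega
          · have : 0 ≤ j := by omega
            nlinarith
      exact (not_sq_of_dvd_add_one (hv k).1 (hv k).2
        (by push_cast at hd; exact hd)).elim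
  · have h1 := h.1
    have h3 := recur_modEq_mod (p := 11) (a := 2) (b := 23) (m := 3) (r := 1) (by decide)
        (by decide) n
    rw [← h1, Nat.mod_one, Int.ModEq] at h3
    push_cast at h3
    rcases (by omega : (t : ℤ) % 3 = 0 ∨ (t : ℤ) % 3 = 1 ∨ (t : ℤ) % 3 = 2) with h | h | h <;>
      simp [pow_two, Int.mul_emod, h, recur] at h3

end CubeSum

namespace CubeSum

lemma jacobiSym_sq_nonneg (c : ℤ) (n : ℕ) : 0 ≤ jacobiSym (c ^ 2) n := by
  rw [jacobiSym.pow_left]; positivity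

lemma jacobiSym_eq_jacobiSym_twentynine {X Y : ℤ} {N d : ℕ} (h : X ^ 2 - 1200 * Y ^ 2 = 1)
    (hN : (N : ℤ) = 1 + 4800 * Y ^ 2) (hd : (d : ℤ) = X + 24 * Y ∨ (d : ℤ) = X - 24 * Y) :
    jacobiSym d N = jacobiSym d 29 := by
  have hN4 : N % 4 = 1 := by zify; rw [hN]; omega
  have hXo : X % 2 = 1 := by
    rcases Int.even_or_odd X with ⟨a, ha⟩ | ⟨a, ha⟩
    · subst ha; ring_nf at h; omega
    · omega
  have hdo : Odd d := by rw [Nat.odd_iff]; omega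
  have hcop : IsCoprime (12 * Y) (d : ℤ) := by
    rcases hd with h' | h' <;> rw [h']
    · exact ⟨-52 * Y, X - 24 * Y, by linear_combination h⟩
    · exact ⟨-52 * Y, X + 24 * Y, by linear_combination h⟩
  rw [jacobiSym.quadratic_reciprocity_one_mod_four' hdo hN4,
    jacobiSym.mod_left' (a₂ := 29 * (12 * Y) ^ 2), jacobiSym.mul_left,
    jacobiSym.sq_one' (Int.isCoprime_iff_gcd_eq_one.1 hcop), mul_one,
    show (29 : ℤ) = ((29 : ℕ) : ℤ) by rfl,
    jacobiSym.quadratic_reciprocity_one_mod_four (by norm_num) hdo]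
  apply Int.ModEq.symm
  rw [Int.modEq_iff_dvd, hN]
  rcases hd with h' | h' <;> rw [h']
  · exact ⟨X - 24 * Y, by linear_combination -h⟩
  · exact ⟨X + 24 * Y, by linear_combination -h⟩

lemma jacobiSym_eq_one_of_pell {X Y : ℤ} {N : ℕ} (h : X ^ 2 - 1200 * Y ^ 2 = 1)
    (hN : (N : ℤ) = 1 + 4800 * Y ^ 2) : jacobiSym Y N = 1 := by
  have hXo : Odd X := by
    rcases Int.even_or_odd X with ⟨a, ha⟩ | h
    · subst ha; ring_nf at h; omega
    · exact h
  have hNo : Odd N := by rw [Nat.odd_iff]; zify; rw [hN]; omega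
  have e : N % (4 * Y.natAbs) = (X.natAbs ^ 2) % (4 * Y.natAbs) := by
    zify
    rw [sq_abs]
    apply Int.ModEq.symm
    rw [Int.modEq_iff_dvd, hN]
    rcases abs_choice Y with h' | h' <;> rw [h']
    · exact ⟨900 * Y, by linear_combination -h⟩
    · exact ⟨-900 * Y, by linear_combination -h⟩
  rw [jacobiSym.mod_right Y hNo, e, ← jacobiSym.mod_right Y (hXo.natAbs.pow), jacobiSym.pow_right,
    jacobiSym.sq_one]
  rw [Int.natCast_natAbs, ← Int.isCoprime_iff_gcd_eq_one]
  have : IsCoprime Y X := ⟨-1200 * Y, X, by linear_combination h⟩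
  rcases abs_choice X with h' | h' <;> rw [h']
  · exact this
  · exact this.neg_right

lemma not_dvd_sq_sub {X Y c s d : ℤ} (hX : 0 < X) (h : X ^ 2 - 1200 * Y ^ 2 = 1)
    (hs : s = 1 ∨ s = -1) (hd : d = X + 24 * Y ∨ d = X - 24 * Y) (hJ : jacobiSym d 29 = -1) :
    ¬ 1 + 4800 * Y ^ 2 ∣ c ^ 2 - s * 10 ^ 2 * Y * d := by
  intro hdvd
  have hd0 : 0 ≤ d := by rcases hd with h' | h' <;> nlinarith [sq_nonneg Y]
  lift d to ℕ using hd0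
  obtain ⟨N, hN⟩ : ∃ N : ℕ, (N : ℤ) = 1 + 4800 * Y ^ 2 :=
    ⟨(1 + 4800 * Y ^ 2).toNat, Int.toNat_of_nonneg (by positivity)⟩
  have hN4 : N % 4 = 1 := by zify; rw [hN]; omega
  rw [← jacobiSym_eq_jacobiSym_twentynine h hN hd] at hJ
  have hJs : jacobiSym s N = 1 := by
    rcases hs with rfl | rfl
    · exact jacobiSym.one_left N
    · rw [jacobiSym.at_neg_one (Nat.odd_iff.2 (by omega)), ZMod.χ₄_nat_one_mod_four hN4]
  have h10 : IsCoprime 10 (N : ℤ) := ⟨-480 * Y ^ 2, 1, by rw [hN]; ring⟩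
  rw [← hN] at hdvd
  have e : jacobiSym (s * 10 ^ 2 * Y * d) N = jacobiSym (c ^ 2) N :=
    jacobiSym.mod_left' (Int.modEq_iff_dvd.2 hdvd)
  rw [jacobiSym.mul_left, jacobiSym.mul_left, jacobiSym.mul_left, hJs, hJ,
    jacobiSym_eq_one_of_pell h hN, jacobiSym.sq_one' (Int.isCoprime_iff_gcd_eq_one.1 h10)] at e
  linarith [jacobiSym_sq_nonneg c N]

lemma exists_recur_of_twelve (e : ℕ) : ∀ d : ℕ, 0 < e → d ^ 2 = 12 * e ^ 2 + 13 →
    ∃ n, ((e : ℤ) = recur 14 1 17 n ∧ recur 14 1 17 (n + 1) = 7 * e + 2 * d) ∨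
      ((e : ℤ) = recur 14 3 43 n ∧ recur 14 3 43 (n + 1) = 7 * e + 2 * d) := by
  induction e using Nat.strong_induction_on with
  | _ e ih =>
  intro d he hd
  by_cases h8 : e < 8
  · have hd20 : d < 28 := by nlinarith
    refine ⟨0, ?_⟩
    interval_cases e <;> interval_cases d <;> simp_all [recur]
  · have h2 : 2 * d < 7 * e := by nlinarith
    have h3 : 24 * e < 7 * d := by nlinarith
    obtain ⟨f, hf⟩ := Nat.exists_eq_add_of_lt h2
    obtain ⟨c, hc⟩ := Nat.exists_eq_add_of_lt h3
    have hfc : (c + 1) ^ 2 = 12 * (f + 1) ^ 2 + 13 := by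
      zify at hf hc hd ⊢
      linear_combination hd - (c + 1 + 7 * d - 24 * e) * hc + 12 * (f + 1 + 7 * e - 2 * d) * hf
    obtain ⟨n, h | h⟩ := ih (f + 1) (by nlinarith) (c + 1) (by omega) hfc
    · refine ⟨n + 1, .inl ⟨?_, ?_⟩⟩
      · zify at hf hc h; linarith
      · rw [recur_add_two]; zify at hf hc h; linarith
    · refine ⟨n + 1, .inr ⟨?_, ?_⟩⟩
      · zify at hf hc h; linarith
      · rw [recur_add_two]; zify at hf hc h; linarith

end CubeSum

namespace CubeSum

lemma recur_add_mul (p a b c a' b' : ℤ) (n : ℕ) :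
    recur p (a + c * a') (b + c * b') n = recur p a b n + c * recur p a' b' n := by
  induction n using Nat.twoStepInduction with
  | zero => rfl
  | one => rfl
  | more n h0 h1 => simp only [recur_add_two, h0, h1]; ring

lemma recur_succ (p a b : ℤ) (n : ℕ) : recur p a b (n + 1) = recur p b (p * b - a) n := by
  induction n using Nat.twoStepInduction with
  | zero => rfl
  | one => rfl
  | more n h0 h1 => rw [recur_add_two p b, ← h0, ← h1]; rfl

lemma recur_pell_succ (k : ℕ) :
    recur 14 1 7 (k + 1) = 7 * recur 14 1 7 k + 48 * recur 14 0 1 k ∧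
      recur 14 0 1 (k + 1) = recur 14 1 7 k + 7 * recur 14 0 1 k := by
  induction k with
  | zero => decide
  | succ k ih => constructor <;> rw [recur_add_two] <;> linarith

lemma recur_pell (k : ℕ) : recur 14 1 7 k ^ 2 - 48 * recur 14 0 1 k ^ 2 = 1 := by
  induction k with
  | zero => decide
  | succ k ih => rw [(recur_pell_succ k).1, (recur_pell_succ k).2]; linarith

lemma recur_pell_pos (k : ℕ) : 0 < recur 14 1 7 k ∧ 0 ≤ recur 14 0 1 k := by
  induction k with
  | zero => decide
  | succ k ih => rw [(recur_pell_succ k).1, (recur_pell_succ k).2]; constructor <;> linarith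

lemma recur_two_fourteen (k : ℕ) : recur 14 2 14 k = 2 * recur 14 1 7 k := by
  rw [show (2 : ℤ) = 1 + 1 * 1 by rfl, show (14 : ℤ) = 7 + 1 * 7 by rfl, recur_add_mul]
  ring

lemma recur_one_seventeen (k : ℕ) : recur 14 1 17 k = recur 14 1 7 k + 10 * recur 14 0 1 k :=
  recur_add_mul 14 1 7 10 0 1 k

lemma exists_dvd_recur_sub (k n q : ℕ) : ∃ s : ℤ, (s = 1 ∨ s = -1) ∧
    recur 14 2 14 (2 * k) - 1 ∣ recur 14 1 17 (n + 6 * k * q) - s * recur 14 1 17 n := by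
  induction q with
  | zero => exact ⟨1, .inl rfl, by simp⟩
  | succ q ih =>
    obtain ⟨s, hs, h⟩ := ih
    refine ⟨-s, by omega, ?_⟩
    have h0 := recur_add_recur 14 1 17 (2 * k) (n + 6 * k * q)
    have h1 := recur_add_recur 14 1 17 (2 * k) (n + 6 * k * q + 2 * k)
    rw [show n + 6 * k * q + 2 * k + 2 * (2 * k) = n + 6 * k * (q + 1) by ring,
      show n + 6 * k * q + 2 * k + 2 * k = n + 6 * k * q + 2 * (2 * k) by ring] at h1
    have e : recur 14 1 17 (n + 6 * k * (q + 1)) - -s * recur 14 1 17 n =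
      (recur 14 2 14 (2 * k) - 1) * (recur 14 1 17 (n + 6 * k * q + 2 * (2 * k)) +
        recur 14 1 17 (n + 6 * k * q + 2 * k)) -
      (recur 14 1 17 (n + 6 * k * q) - s * recur 14 1 17 n) := by
      linear_combination h1 + h0
    rw [e]
    exact dvd_sub (dvd_mul_right _ _) h

lemma jacobiSym_recur_twentynine {k : ℕ} (hk : k % 30 ∈ [6, 9, 21, 24]) {Y d : ℤ}
    (hY : recur 14 0 1 k = 5 * Y)
    (hd : d = recur 14 1 7 k + 24 * Y ∨ d = recur 14 1 7 k - 24 * Y) : jacobiSym d 29 = -1 := by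
  have h1 := recur_modEq_mod (p := 14) (a := 1) (b := 8) (m := 29) (r := 30) (by decide +kernel)
    (by decide +kernel) k
  have h2 := recur_modEq_mod (p := 14) (a := 1) (b := 6) (m := 29) (r := 30) (by decide +kernel)
    (by decide +kernel) k
  have e1 : recur 14 1 8 k = recur 14 1 7 k + 5 * Y := by
    rw [← hY]; simpa using recur_add_mul 14 1 7 1 0 1 k
  have e2 : recur 14 1 6 k = recur 14 1 7 k - 5 * Y := by
    rw [← hY]; have := recur_add_mul 14 1 7 (-1) 0 1 k; norm_num at this; linarith
  rw [e1] at h1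
  rw [e2] at h2
  have key : ∀ r ∈ [6, 9, 21, 24], (recur 14 1 8 r) % 29 ∈
      [2, 3, 8, 10, 11, 12, 14, 15, 17, 18, 19, 21, 26, 27] ∧
    (recur 14 1 6 r) % 29 ∈ [2, 3, 8, 10, 11, 12, 14, 15, 17, 18, 19, 21, 26, 27] := by
    decide +kernel
  have hJ : ∀ c : ℤ, c ∈ [2, 3, 8, 10, 11, 12, 14, 15, 17, 18, 19, 21, 26, 27] →
      jacobiSym c 29 = -1 := by
    intro c hc
    simp only [List.mem_cons, List.not_mem_nil, or_false] at hc
    rcases hc with rfl | rfl | rfl | rfl | rfl | rfl | rfl | rfl | rfl | rfl | rfl | rfl | rfl |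
      rfl <;> norm_num
  rw [jacobiSym.mod_left]
  apply hJ
  rcases hd with rfl | rfl
  · have : (recur 14 1 7 k + 24 * Y) % 29 = recur 14 1 6 (k % 30) % 29 := by
      rw [← h2]; omega
    rw [Nat.cast_ofNat, this]
    exact (key _ hk).2
  · have : (recur 14 1 7 k - 24 * Y) % 29 = recur 14 1 8 (k % 30) % 29 := by
      rw [← h1]; omega
    rw [Nat.cast_ofNat, this]
    exact (key _ hk).1

lemma exists_eq_two_mul_mul {n : ℕ} (hn : n ≠ 0) (h3 : 3 ∣ n) (h4 : 4 ∣ n) :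
    ∃ k t, n = 2 * k * t ∧ ¬ 3 ∣ t ∧ k % 30 ∈ [6, 9, 21, 24] ∧ 3 ∣ k := by
  obtain ⟨f, m, hm, rfl⟩ := Nat.exists_eq_pow_mul_and_not_dvd hn 3 (by norm_num)
  have h4' : 4 ∣ m :=
      (Nat.Coprime.pow_right f (by norm_num : Nat.Coprime 4 3)).dvd_of_dvd_mul_left h4
  obtain ⟨j, rfl⟩ := h4'
  have h9 : ∀ g, 9 ^ (g + 1) % 30 = 9 ∨ 9 ^ (g + 1) % 30 = 21 := by
    intro g
    induction g with
    | zero => decide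
    | succ g ih => rw [pow_succ]; omega
  rcases Nat.even_or_odd' f with ⟨g, rfl | rfl⟩
  · obtain _ | g := g
    · simp at h3; omega
    · refine ⟨9 ^ (g + 1), 2 * j, ?_, by omega, ?_, ?_⟩
      · rw [pow_mul]; norm_num; ring
      · rcases h9 g with h | h <;> simp [h]
      · exact Dvd.dvd.trans (by norm_num) (dvd_pow_self 9 (Nat.succ_ne_zero g))
  · refine ⟨6 * 9 ^ g, j, ?_, by omega, ?_, by omega⟩
    · rw [pow_succ, pow_mul]; norm_num; ring
    · have : 6 * 9 ^ g % 30 = 6 ∨ 6 * 9 ^ g % 30 = 24 := by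
        obtain _ | g := g
        · simp
        · have := h9 g; omega
      rcases this with h | h <;> simp [h]

lemma sq_ne_recur_of_dvd {n : ℕ} (hn : n ≠ 0) (h3 : 3 ∣ n) (h4 : 4 ∣ n) (c : ℤ) :
    c ^ 2 ≠ recur 14 1 17 n := by
  intro hc
  obtain ⟨k, t, rfl, ht, hk, hk3⟩ := exists_eq_two_mul_mul hn h3 h4
  obtain ⟨Y, hY⟩ : (5 : ℤ) ∣ recur 14 0 1 k := by
    have := recur_modEq_mod (p := 14) (a := 0) (b := 1) (m := 5) (r := 3) (by decide) (by decide) k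
    rw [Nat.mod_eq_zero_of_dvd hk3] at this
    exact Int.dvd_of_emod_eq_zero this
  have hp := recur_pell k
  have hX := (recur_pell_pos k).1
  have hN : recur 14 2 14 (2 * k) - 1 = 1 + 4800 * Y ^ 2 := by
    rw [recur_two_mul, recur_two_fourteen]
    rw [hY] at hp
    linear_combination 4 * hp
  have hH : recur 14 1 17 (2 * k) = 1 + 5 * Y * (96 * (5 * Y) + 20 * recur 14 1 7 k) := by
    have h1 := recur_add_recur 14 1 7 k 0
    have h2 := recur_add_recur 14 0 1 k 0
    rw [recur_two_fourteen, zero_add, zero_add, hY] at h2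
    rw [recur_two_fourteen, zero_add, zero_add] at h1
    rw [recur_one_seventeen]
    simp only [recur] at h1 h2
    rw [hY] at hp
    linear_combination h1 + 10 * h2 + 2 * hp
  have hp' : recur 14 1 7 k ^ 2 - 1200 * Y ^ 2 = 1 := by rw [hY] at hp; linear_combination hp
  rcases (by omega : t % 3 = 1 ∨ t % 3 = 2) with h | h
  · obtain ⟨s, hs, hdvd⟩ := exists_dvd_recur_sub k (2 * k) (t / 3)
    rw [show 2 * k + 6 * k * (t / 3) = 2 * k * (t % 3 + 3 * (t / 3)) by rw [h]; ring,
      Nat.mod_add_div, ← hc, hN] at hdvd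
    refine not_dvd_sq_sub (c := c) hX hp' hs (.inr rfl)
      (jacobiSym_recur_twentynine hk hY (.inr rfl)) ?_
    refine (dvd_add hdvd (dvd_mul_left (1 + 4800 * Y ^ 2) s)).trans (dvd_of_eq ?_)
    rw [hH]
    ring
  · obtain ⟨s, hs, hdvd⟩ := exists_dvd_recur_sub k (4 * k) (t / 3)
    rw [show 4 * k + 6 * k * (t / 3) = 2 * k * (t % 3 + 3 * (t / 3)) by rw [h]; ring,
      Nat.mod_add_div, ← hc, hN] at hdvd
    refine not_dvd_sq_sub (c := c) hX hp' hs (.inl rfl)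
      (jacobiSym_recur_twentynine hk hY (.inl rfl)) ?_
    have h1 := recur_add_recur 14 1 17 (2 * k) 0
    rw [zero_add, zero_add, show recur 14 1 17 0 = 1 from rfl, hH] at h1
    refine (dvd_add hdvd
        (dvd_mul_left (1 + 4800 * Y ^ 2) (s * recur 14 1 17 (2 * k)))).trans (dvd_of_eq ?_)
    rw [show 4 * k = 2 * (2 * k) by ring, hH]
    linear_combination -s * h1 - s * (1 + 5 * Y * (96 * (5 * Y) + 20 * recur 14 1 7 k)) * hN

lemma eq_one_of_twelve {c d : ℕ} (h0 : 0 < c) (h : 12 * c ^ 4 + 13 = d ^ 2) : c = 1 := by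
  obtain ⟨n, ⟨h1, -⟩ | ⟨h1, -⟩⟩ :=
      exists_recur_of_twelve (c ^ 2) d (by positivity) (by rw [← h]; ring)
  · push_cast at h1
    have h8 := recur_modEq_mod (p := 14) (a := 1) (b := 17) (m := 8) (r := 4) (by decide)
      (by decide) n
    have h5 := recur_modEq_mod (p := 14) (a := 1) (b := 17) (m := 5) (r := 3) (by decide)
      (by decide) n
    rw [← h1] at h8 h5
    have hc8 : (c : ℤ) ^ 2 % 8 = 0 ∨ (c : ℤ) ^ 2 % 8 = 1 ∨ (c : ℤ) ^ 2 % 8 = 4 := by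
      have : (c : ℤ) % 8 = 0 ∨ (c : ℤ) % 8 = 1 ∨ (c : ℤ) % 8 = 2 ∨ (c : ℤ) % 8 = 3 ∨
        (c : ℤ) % 8 = 4 ∨ (c : ℤ) % 8 = 5 ∨ (c : ℤ) % 8 = 6 ∨ (c : ℤ) % 8 = 7 := by omega
      rcases this with h | h | h | h | h | h | h | h <;> simp [pow_two, Int.mul_emod, h]
    have hc5 : (c : ℤ) ^ 2 % 5 = 0 ∨ (c : ℤ) ^ 2 % 5 = 1 ∨ (c : ℤ) ^ 2 % 5 = 4 := by
      have : (c : ℤ) % 5 = 0 ∨ (c : ℤ) % 5 = 1 ∨ (c : ℤ) % 5 = 2 ∨ (c : ℤ) % 5 = 3 ∨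
        (c : ℤ) % 5 = 4 := by omega
      rcases this with h | h | h | h | h <;> simp [pow_two, Int.mul_emod, h]
    have h3 : 3 ∣ n := by
      by_contra h3
      rw [Int.ModEq] at h5
      rcases (by omega : n % 3 = 1 ∨ n % 3 = 2) with h | h <;> rw [h] at h5 <;>
        norm_num [recur] at h5 <;> omega
    have h4 : n % 4 = 0 ∨ n % 4 = 1 := by
      by_contra! h4
      rw [Int.ModEq] at h8
      rcases (by omega : n % 4 = 2 ∨ n % 4 = 3) with h | h <;> rw [h] at h8 <;>
        norm_num [recur] at h8 <;> omega
    rcases h4 with h4 | h4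
    · by_cases hn : n = 0
      · subst hn
        rw [recur] at h1
        have : c ^ 2 = 1 := by exact_mod_cast h1
        simpa using this
      · exact absurd h1 (sq_ne_recur_of_dvd hn h3 (Nat.dvd_of_mod_eq_zero h4) c)
    · exfalso
      obtain ⟨i, rfl⟩ : ∃ i, n = 4 * i + 1 := ⟨n / 4, by omega⟩
      have e := recur_add_recur 14 (-3) 1 (2 * i + 1) 0
      rw [zero_add, zero_add, show 2 * (2 * i + 1) = 4 * i + 1 + 1 by ring,
        recur_succ 14 (-3) 1 (4 * i + 1), recur_two_fourteen] at e
      norm_num at e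
      rw [← h1] at e
      have hX := recur_modEq_mod (p := 14) (a := 1) (b := 7) (m := 12) (r := 2) (by decide)
        (by decide) (2 * i + 1)
      rw [Nat.mul_add_mod, Int.ModEq] at hX
      norm_num [recur] at hX
      have hpos := (recur_pell_pos (2 * i + 1)).1
      generalize recur 14 1 7 (2 * i + 1) = X at *
      lift X to ℕ using hpos.le
      have hX12 : X % 12 = 7 := by omega
      have hJ : jacobiSym 3 X = -1 := by
        rw [jacobiSym.mod_right _ (Nat.odd_iff.2 (by omega)),
          show 4 * Int.natAbs 3 = 12 by rfl, hX12]
        norm_num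
      have hJ' : jacobiSym 3 X = jacobiSym ((c : ℤ) ^ 2) X := by
        apply jacobiSym.mod_left'
        apply Int.modEq_iff_dvd.2
        exact ⟨2 * recur 14 (-3) 1 (2 * i + 1), by simp only [recur] at e; linear_combination e⟩
      linarith [jacobiSym_sq_nonneg c X]
  · have h4 := recur_modEq_mod (p := 14) (a := 3) (b := 43) (m := 4) (r := 1) (by decide)
        (by decide) n
    rw [← h1, Nat.mod_one, Int.ModEq] at h4
    push_cast at h4
    rcases (by omega : (c : ℤ) % 4 = 0 ∨ (c : ℤ) % 4 = 1 ∨ (c : ℤ) % 4 = 2 ∨ (c : ℤ) % 4 = 3) with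
      h | h | h | h <;> simp [pow_two, Int.mul_emod, h, recur] at h4

end CubeSum

namespace CubeSum

open Pell

lemma one_lt_five : 1 < 5 := by norm_num

/-- The coefficient `u n` in `(5 + √24) ^ n = x + u n * √24`. -/
abbrev pellU (n : ℕ) : ℕ := yn one_lt_five n

/-- The coefficient `x` in `(5 + √24) ^ n = x + u * √24`. -/
abbrev pellX (n : ℕ) : ℕ := xn one_lt_five n

lemma pellX_sq (n : ℕ) : (pellX n : ℤ) ^ 2 - 24 * (pellU n : ℤ) ^ 2 = 1 := by
  have h : (pellX n : ℤ) * pellX n - ((24 : ℕ) : ℤ) * pellU n * pellU n = 1 :=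
      pell_eqz one_lt_five n
  push_cast at h
  linear_combination h

lemma pellX_add (m n : ℕ) : pellX (m + n) = pellX m * pellX n + 24 * pellU m * pellU n :=
  xn_add one_lt_five m n

lemma pellU_add (m n : ℕ) : pellU (m + n) = pellX m * pellU n + pellU m * pellX n :=
  yn_add one_lt_five m n

lemma pellX_succ (n : ℕ) : pellX (n + 1) = pellX n * 5 + 24 * pellU n := xn_succ one_lt_five n

lemma pellU_mod_four (n : ℕ) : pellU n % 4 = n % 4 := yn_modEq_a_sub_one one_lt_five n

lemma pellU_odd {n : ℕ} (hn : Odd n) : Odd (pellU n) := by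
  have := pellU_mod_four n
  rw [Nat.odd_iff] at *
  omega

lemma pellU_pos {n : ℕ} (hn : 0 < n) : 0 < pellU n := hn.trans_le (yn_ge_n one_lt_five n)

lemma pellU_add_two_mul (j n : ℕ) : (pellU (n + 2 * j) : ℤ) ≡ pellU n [ZMOD pellU j] := by
  rw [Int.modEq_iff_dvd, two_mul, pellU_add, pellU_add, pellX_add]
  push_cast
  exact ⟨-(2 * (pellX n * pellX j + 24 * pellU n * pellU j)), by
    linear_combination -(pellU n : ℤ) * pellX_sq j⟩

lemma pellU_mod_two_mul (j n : ℕ) : (pellU n : ℤ) ≡ pellU (n % (2 * j)) [ZMOD pellU j] := by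
  have : ∀ t s, (pellU (s + 2 * j * t) : ℤ) ≡ pellU s [ZMOD pellU j] := by
    intro t
    induction t with
    | zero => intro s; rfl
    | succ t ih =>
      intro s
      rw [show s + 2 * j * (t + 1) = s + 2 * j * t + 2 * j by ring]
      exact (pellU_add_two_mul j _).trans (ih s)
  conv_lhs => rw [← Nat.mod_add_div n (2 * j)]
  exact this _ _

lemma pellU_dvd_add {j r s : ℕ} (h : r + s = 2 * j) : (pellU j : ℤ) ∣ pellU r + pellU s := by
  have h1 : (pellU (r + 2 * s) : ℤ) = pellX s * pellU (r + s) + pellU s * pellX (r + s) := by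
    rw [show r + 2 * s = s + (r + s) by ring, pellU_add]
    push_cast
    ring
  have h2 : (pellU (r + s) : ℤ) = pellX r * pellU s + pellU r * pellX s := by
    rw [pellU_add]; push_cast; ring
  have h3 : (pellX (r + s) : ℤ) = pellX r * pellX s + 24 * pellU r * pellU s := by
    rw [pellX_add]; push_cast; ring
  have h4 : (pellU (2 * j) : ℤ) = 2 * pellX j * pellU j := by
    rw [two_mul, pellU_add]; push_cast; ring
  have h5 : (pellX (2 * j) : ℤ) = 1 + 48 * pellU j ^ 2 := by
    rw [two_mul, pellX_add]; push_cast; linear_combination pellX_sq j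
  have h6 : (pellU r : ℤ) = pellU (2 * j) * pellX s - pellX (2 * j) * pellU s := by
    rw [← h, h2, h3]; linear_combination -(pellU r : ℤ) * pellX_sq s
  rw [h6, h4, h5]
  exact ⟨2 * pellX j * pellX s - 48 * pellU j * pellU s, by ring⟩

lemma jacobiSym_pellU (j : ℕ) : ∀ n, Odd j → Odd n →
    jacobiSym (pellU n) (pellU j) = jacobiSym n j := by
  induction j using Nat.strong_induction_on with
  | _ j ih =>
  have small : ∀ n, n < j → Odd j → Odd n → jacobiSym (pellU n) (pellU j) = jacobiSym n j := by
    intro n hnj hj hn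
    rw [← jacobiSym.quadratic_reciprocity_if (Nat.odd_iff.1 hn) (Nat.odd_iff.1 hj),
      ← jacobiSym.quadratic_reciprocity_if (Nat.odd_iff.1 (pellU_odd hn))
        (Nat.odd_iff.1 (pellU_odd hj)), pellU_mod_four, pellU_mod_four, ih n hnj j hn hj]
  intro n hj hn
  have hjpos := hj.pos
  have hr : Odd (n % (2 * j)) := by
    rw [Nat.odd_iff] at *
    rw [Nat.mod_mul_right_mod, hn]
  have hlt : n % (2 * j) < 2 * j := Nat.mod_lt _ (by omega)
  have hnr : jacobiSym n j = jacobiSym (n % (2 * j) : ℕ) j := by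
    apply jacobiSym.mod_left'
    norm_cast
    rw [Nat.mod_mul_left_mod]
  rw [jacobiSym.mod_left' (pellU_mod_two_mul j n), hnr]
  generalize n % (2 * j) = r at *
  rcases lt_trichotomy r j with h | rfl | h
  · exact small r h hj hr
  · rcases eq_or_ne r 1 with rfl | h1
    · simp
    · have h2 : 1 < r := by omega
      rw [jacobiSym.mod_left, jacobiSym.mod_left (r : ℤ), Int.emod_self, Int.emod_self,
        jacobiSym.zero_left h2, jacobiSym.zero_left (h2.trans_le (yn_ge_n one_lt_five r))]
  · obtain ⟨s, hs⟩ : ∃ s, r + s = 2 * j := ⟨2 * j - r, by omega⟩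
    have hso : Odd s := by rw [Nat.odd_iff] at *; omega
    have e1 : jacobiSym r j = jacobiSym (-s) j := by
      apply jacobiSym.mod_left'
      apply Int.ModEq.symm
      rw [Int.modEq_iff_dvd]
      exact ⟨2, by zify at hs; linarith⟩
    have e2 : jacobiSym (pellU r) (pellU j) = jacobiSym (-pellU s) (pellU j) := by
      apply jacobiSym.mod_left'
      apply Int.ModEq.symm
      rw [Int.modEq_iff_dvd, sub_neg_eq_add]
      exact pellU_dvd_add hs
    rw [e1, e2, jacobiSym.neg _ hj, jacobiSym.neg _ (pellU_odd hj), small s (by omega) hj hso,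
      ZMod.χ₄_nat_mod_four, pellU_mod_four, ← ZMod.χ₄_nat_mod_four]

lemma exists_jacobiSym_eq_neg_one {p k M : ℕ} (hp : p.Prime) (hp2 : p ≠ 2) (hk : ¬ p ∣ k)
    (hM : ¬ p ∣ M) : ∃ j, j % 4 = 1 ∧ j ≡ 1 [MOD M] ∧ ∀ f,
      jacobiSym (p ^ (2 * f + 1) * k : ℕ) j = -1 := by
  have := Fact.mk hp
  obtain ⟨a, ha⟩ := FiniteField.exists_nonsquare (F := ZMod p) (by rwa [ZMod.ringChar_zmod_n])
  have hcop : (4 * k * M).Coprime p := by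
    refine ((hp.coprime_iff_not_dvd).2 ?_).symm
    rw [hp.dvd_mul, hp.dvd_mul, not_or, not_or]
    refine ⟨⟨fun h => hp2 ?_, hk⟩, hM⟩
    exact (Nat.prime_dvd_prime_iff_eq hp Nat.prime_two).1 (hp.dvd_of_dvd_pow (n := 2) h)
  obtain ⟨j, hj1, hjp⟩ := Nat.chineseRemainder hcop 1 a.val
  have h4 : j ≡ 1 [MOD 4] := hj1.of_mul_right _ |>.of_mul_right _
  have hjo : Odd j := by rw [Nat.odd_iff]; unfold Nat.ModEq at h4; omega
  refine ⟨j, h4, hj1.of_mul_left _, fun f => ?_⟩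
  have e1 : jacobiSym k j = 1 := by
    have : j ≡ 1 [MOD 4 * k] := hj1.of_mul_right _
    rw [jacobiSym.mod_right' k hjo, this, ← jacobiSym.mod_right' k odd_one, jacobiSym.one_right]
  have e2 : jacobiSym p j = -1 := by
    rw [← jacobiSym.quadratic_reciprocity_one_mod_four h4 (hp.odd_of_ne_two hp2),
      ← jacobiSym.legendreSym.to_jacobiSym, legendreSym.eq_neg_one_iff]
    rw [Int.cast_natCast, (ZMod.natCast_eq_natCast_iff _ _ _).2 hjp, ZMod.natCast_zmod_val]
    exact ha
  push_cast
  rw [jacobiSym.mul_left, jacobiSym.pow_left, e1, e2, Odd.neg_one_pow ⟨f, rfl⟩, mul_one]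

end CubeSum

namespace CubeSum

open Pell

lemma add_pow_eq_pell {K : Type*} [CommRing K] {s : K} (hs : s ^ 2 = 24) (n : ℕ) :
    (5 + s) ^ n = pellX n + pellU n * s := by
  induction n with
  | zero => simp
  | succ n ih =>
    rw [pow_succ, ih, pellX_succ, show pellU (n + 1) = pellX n + pellU n * 5 from yn_succ _ n]
    push_cast
    linear_combination (pellU n : K) * hs

lemma natCast_ne_zero_of_lt {p n : ℕ} {K : Type*} [Field K] [CharP K p] (hp : p.Prime) (h5 : 5 ≤ p)
    (hn : n ∣ 24 ^ n) : (n : K) ≠ 0 := by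
  rw [Ne, CharP.cast_eq_zero_iff K p]
  intro h
  have h1 : p ∣ 24 := hp.dvd_of_dvd_pow (h.trans hn)
  have h2 : p ∣ 2 ^ 3 * 3 := h1
  rcases hp.dvd_mul.1 h2 with h | h
  · have := Nat.le_of_dvd two_pos (hp.dvd_of_dvd_pow h); omega
  · have := Nat.le_of_dvd three_pos h; omega

lemma add_pow_sq {p : ℕ} {K : Type*} [Field K] [CharP K p] (hp : p.Prime) (h5 : 5 ≤ p) {s : K}
    (hs : s ^ 2 = 24) : (5 + s) ^ (p ^ 2) = 5 + s := by
  have := Fact.mk hp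
  have := ExpChar.prime (R := K) hp
  let := ZMod.algebra K p
  have h24 : ((24 : ℕ) : K) ≠ 0 := natCast_ne_zero_of_lt hp h5 (dvd_pow_self 24 (by norm_num))
  have hfix (a : ℕ) : (a : K) ^ p = a := by
    have := congrArg (algebraMap (ZMod p) K) (ZMod.pow_card (a : ZMod p))
    rwa [map_pow, map_natCast] at this
  obtain ⟨q, hq⟩ := hp.odd_of_ne_two (by omega)
  have h1 : (24 : K) ^ (2 * q) = 1 := by
    have := hfix 24
    rw [hq, pow_succ] at this
    exact mul_right_cancel₀ h24 (by rw [one_mul]; exact_mod_cast this)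
  rw [add_pow_expChar_pow]
  congr 1
  · rw [pow_two, pow_mul]
    have := hfix 5
    push_cast at this
    rw [this, this]
  · rw [show p ^ 2 = 2 * (2 * q * (q + 1)) + 1 by rw [hq]; ring, pow_succ, pow_mul, hs, pow_mul, h1,
      one_pow, one_mul]

lemma pellU_eq_one {p j : ℕ} (hp : p.Prime) (h5 : 5 ≤ p) (hj : j ≡ 1 [MOD p ^ 2 - 1])
    (h0 : 0 < j) : (pellU j : ZMod p) = 1 := by
  have := Fact.mk hp
  let K := AlgebraicClosure (ZMod p)
  have : CharP K p := charP_of_injective_algebraMap (algebraMap (ZMod p) K).injective p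
  obtain ⟨i, hi⟩ := (Nat.modEq_iff_dvd' h0).1 hj.symm
  have hpow {s : K} (hs : s ^ 2 = 24) : (pellX j : K) + pellU j * s = 5 + s := by
    have hne : (5 + s) ≠ 0 := by
      intro h
      have : (1 : K) = 0 := by linear_combination (5 - s) * h + hs
      exact one_ne_zero this
    have h1 : (5 + s) ^ (p ^ 2 - 1) = 1 := by
      refine mul_right_cancel₀ hne ?_
      rw [← pow_succ, Nat.sub_add_cancel (Nat.one_le_pow _ _ hp.pos), add_pow_sq hp h5 hs, one_mul]
    rw [← add_pow_eq_pell hs, show j = (p ^ 2 - 1) * i + 1 by omega, pow_succ, pow_mul, h1, one_pow,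
      one_mul]
  obtain ⟨s, hs⟩ := IsAlgClosed.exists_pow_nat_eq (24 : K) two_pos
  have h1 := hpow hs
  have h2 := hpow (s := -s) (by rw [neg_sq, hs])
  have hs0 : s ≠ 0 := by
    rintro rfl
    have h24 : ((24 : ℕ) : K) ≠ 0 := natCast_ne_zero_of_lt hp h5 (dvd_pow_self 24 (by norm_num))
    exact h24 (by rw [zero_pow two_ne_zero] at hs; exact_mod_cast hs.symm)
  have h20 : ((2 : ℕ) : K) ≠ 0 := natCast_ne_zero_of_lt hp h5 (by norm_num)
  have h3 : (pellU j : K) = 1 := by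
    have : ((2 : ℕ) * s) * ((pellU j : K) - 1) = 0 := by push_cast; linear_combination h1 - h2
    exact sub_eq_zero.1 ((mul_eq_zero.1 this).resolve_left (mul_ne_zero h20 hs0))
  apply (algebraMap (ZMod p) K).injective
  rw [map_natCast, h3, map_one]

lemma isSquare_of_isSquare_pellU {n : ℕ} (hn : Odd n) (h : IsSquare (pellU n)) : IsSquare n := by
  by_contra hns
  obtain ⟨p, f, k, hp, hk, rfl⟩ : ∃ p f k, p.Prime ∧ ¬ p ∣ k ∧ n = p ^ (2 * f + 1) * k := by
    obtain ⟨b, c, e, hb⟩ := Nat.sq_mul_squarefree n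
    have hb1 : b ≠ 1 := by
      rintro rfl
      exact hns ⟨c, by rw [← e]; ring⟩
    obtain ⟨p, hp, hpb⟩ := Nat.exists_prime_and_dvd hb1
    obtain ⟨d, rfl⟩ := hpb
    have hpd : ¬ p ∣ d := by
      rintro ⟨g, rfl⟩
      exact hp.not_isUnit (hb p ⟨g, by ring⟩)
    have hc0 : c ≠ 0 := by
      rintro rfl
      rw [← e] at hn
      simp at hn
    obtain ⟨f, g, hg, rfl⟩ := Nat.exists_eq_pow_mul_and_not_dvd hc0 p hp.ne_one
    refine ⟨p, f, g ^ 2 * d, hp, ?_, by rw [← e]; ring⟩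
    rw [hp.dvd_mul, not_or]
    exact ⟨fun h => hg (hp.dvd_of_dvd_pow h), hpd⟩
  have hp2 : p ≠ 2 := by
    rintro rfl
    rw [pow_succ] at hn
    have := (Nat.odd_mul.1 (Nat.odd_mul.1 hn).1).2
    exact absurd this (by decide)
  obtain ⟨j, hj, -, hJ⟩ := exists_jacobiSym_eq_neg_one hp hp2 hk hp.not_dvd_one
  obtain ⟨s, hs⟩ := h
  have e := jacobiSym_pellU j _ (Nat.odd_iff.2 (by omega)) hn
  rw [hJ f, hs] at e
  push_cast at e
  rw [← pow_two] at e
  linarith [jacobiSym_sq_nonneg s (pellU j)]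

lemma pellU_ne_prime_mul_sq {p f k w : ℕ} (hp : p.Prime) (h5 : 5 ≤ p) (hk : ¬ p ∣ k)
    (hn : Odd (p ^ (2 * f + 1) * k)) : pellU (p ^ (2 * f + 1) * k) ≠ p * w ^ 2 := by
  intro h
  have := Fact.mk hp
  have hM : ¬ p ∣ p ^ 2 - 1 := by
    intro h'
    have := (Nat.dvd_sub (dvd_pow_self p two_ne_zero) h')
    rw [Nat.sub_sub_self (Nat.one_le_pow _ _ hp.pos)] at this
    exact hp.not_dvd_one this
  obtain ⟨j, hj, hjM, hJ⟩ := exists_jacobiSym_eq_neg_one hp (by omega) hk hM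
  have hjo : Odd j := Nat.odd_iff.2 (by omega)
  have e := jacobiSym_pellU j _ hjo hn
  have h1 : jacobiSym p (pellU j) = 1 := by
    rw [← jacobiSym.quadratic_reciprocity_one_mod_four (by rw [pellU_mod_four, hj])
      (hp.odd_of_ne_two (by omega)), jacobiSym.mod_left' (a₂ := 1), jacobiSym.one_left]
    have := pellU_eq_one hp h5 hjM (by omega)
    have h2 : ((pellU j : ℤ) : ZMod p) = ((1 : ℤ) : ZMod p) := by push_cast; exact this
    exact (ZMod.intCast_eq_intCast_iff _ _ _).1 h2
  rw [hJ f, h] at e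
  push_cast at e
  rw [jacobiSym.mul_left, h1] at e
  linarith [jacobiSym_sq_nonneg w (pellU j)]

end CubeSum

namespace CubeSum

open Pell

lemma isSquare_of_coprime_mul {a b : ℕ} (h : a.Coprime b) (hs : IsSquare (a * b)) : IsSquare a := by
  obtain ⟨c, hc⟩ := hs
  obtain ⟨d, hd⟩ := exists_eq_pow_of_mul_eq_pow (Nat.isUnit_iff.2 h) (hc.trans (pow_two c).symm)
  exact ⟨d, by rw [hd, pow_two]⟩

lemma exists_mul_eq_of_coprime_mul_eq_prime_mul {p x y w : ℕ} (hp : p.Prime)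
    (h : x * y = p * w) (hc : x.Coprime y) :
    (∃ x', x = p * x' ∧ x' * y = w ∧ x'.Coprime y) ∨
      ∃ y', y = p * y' ∧ x * y' = w ∧ x.Coprime y' := by
  rcases hp.dvd_mul.1 (Dvd.intro w h.symm) with ⟨z, rfl⟩ | ⟨z, rfl⟩
  · exact .inl ⟨z, rfl, Nat.eq_of_mul_eq_mul_left hp.pos (by rw [← h, mul_assoc]),
      hc.coprime_mul_left⟩
  · exact .inr ⟨z, rfl, Nat.eq_of_mul_eq_mul_left hp.pos (by rw [← h]; ring),
      hc.coprime_mul_left_right⟩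

lemma exists_pow_four_of_coprime {x y a : ℕ} (h : x * y = a ^ 4) (hc : x.Coprime y) :
    ∃ s t, a = s * t ∧ x = s ^ 4 ∧ y = t ^ 4 := by
  obtain ⟨s, rfl⟩ := exists_eq_pow_of_mul_eq_pow (Nat.isUnit_iff.2 hc) h
  obtain ⟨t, rfl⟩ := exists_eq_pow_of_mul_eq_pow (Nat.isUnit_iff.2 hc.symm) ((mul_comm _ _).trans h)
  exact ⟨s, t, Nat.pow_left_injective (n := 4) (by norm_num)
      (by simp only [← h, mul_pow]), rfl, rfl⟩

lemma pow_four_mod_sixteen {d : ℕ} (hd : Odd d) : d ^ 4 % 16 = 1 := by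
  have : d % 16 % 2 = 1 := by have := Nat.odd_iff.1 hd; omega
  have h16 := Nat.mod_lt d (show 0 < 16 by norm_num)
  rw [Nat.pow_mod]
  interval_cases d % 16 <;> simp_all

lemma thirtytwo_mul_pow_four_add_one_ne_sq {s z : ℕ} (hs : Odd s) : 32 * s ^ 4 + 1 ≠ z ^ 2 := by
  intro h
  obtain ⟨g, rfl⟩ : Odd z := by
    have : Odd (z ^ 2) := h ▸ ⟨16 * s ^ 4, by ring⟩
    exact Nat.Odd.of_mul_left (by rwa [pow_two] at this)
  have h1 : g * (g + 1) = 2 * (2 * (2 * s ^ 4)) := by linarith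
  have hc : g.Coprime (g + 1) := by simp
  have key (d c : ℕ) (hcd : s = d * c) : ¬ (d ^ 4 = 8 * c ^ 4 + 1 ∨ d ^ 4 + 1 = 8 * c ^ 4) := by
    rw [hcd, Nat.odd_mul] at hs
    have := pow_four_mod_sixteen hs.1
    have := pow_four_mod_sixteen hs.2
    omega
  rcases exists_mul_eq_of_coprime_mul_eq_prime_mul Nat.prime_two h1 hc with
    ⟨x, hx, h2, hc⟩ | ⟨x, hx, h2, hc⟩
  · rcases exists_mul_eq_of_coprime_mul_eq_prime_mul Nat.prime_two h2 hc with
      ⟨x', rfl, h2, hc⟩ | ⟨x', hx', h2, hc⟩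
    · rcases exists_mul_eq_of_coprime_mul_eq_prime_mul Nat.prime_two h2 hc with
        ⟨x, rfl, h2, hc⟩ | ⟨x, hx', h2, hc⟩
      · obtain ⟨c, d, hs', h3, h4⟩ := exists_pow_four_of_coprime h2 hc
        exact key d c (by rw [hs', mul_comm]) (.inl (by rw [← h4, hx, h3]; ring))
      · omega
    · omega
  · rcases exists_mul_eq_of_coprime_mul_eq_prime_mul Nat.prime_two h2 hc with
      ⟨x', rfl, h2, hc⟩ | ⟨x', rfl, h2, hc⟩
    · omega
    · rcases exists_mul_eq_of_coprime_mul_eq_prime_mul Nat.prime_two h2 hc with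
        ⟨x, rfl, h2, hc⟩ | ⟨x, rfl, h2, hc⟩
      · omega
      · obtain ⟨d, c, hs', h3, h4⟩ := exists_pow_four_of_coprime h2 hc
        exact key d c hs' (.inr (by rw [← h3, hx, h4]; ring))

lemma pellU_three_mul (n : ℕ) : pellU (3 * n) = 3 * (pellU n * (32 * pellU n ^ 2 + 1)) := by
  rw [show 3 * n = n + n + n by ring, pellU_add, pellU_add, pellX_add]
  zify
  linear_combination 3 * (pellU n : ℤ) * pellX_sq n

lemma isSquare_of_isSquare_mul_add_one {a c : ℕ} (h : IsSquare (a * (c * a ^ 2 + 1))) :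
    IsSquare a ∧ IsSquare (c * a ^ 2 + 1) := by
  have hc : a.Coprime (c * a ^ 2 + 1) := by
    rw [show c * a ^ 2 + 1 = 1 + a * (c * a) by ring]
    simp
  exact ⟨isSquare_of_coprime_mul hc h, isSquare_of_coprime_mul hc.symm (by rwa [mul_comm])⟩

lemma not_isSquare_pellU_nine_mul {n : ℕ} (hn : Odd n) : ¬ IsSquare (pellU (9 * n)) := by
  intro h
  rw [show 9 * n = 3 * (3 * n) by ring, pellU_three_mul] at h
  set y := pellU n * (32 * pellU n ^ 2 + 1) with hy
  have h1 : IsSquare (y * (288 * y ^ 2 + 1)) := by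
    obtain ⟨z, hz⟩ := h
    rw [pellU_three_mul, ← hy] at hz
    obtain ⟨w, rfl⟩ : 3 ∣ z := by
      apply Nat.prime_three.dvd_of_dvd_pow (n := 2)
      exact ⟨3 * y * (32 * (3 * y) ^ 2 + 1), by rw [pow_two, ← hz]⟩
    exact ⟨w, by nlinarith⟩
  obtain ⟨⟨s, hs⟩, ⟨z, hz⟩⟩ := isSquare_of_isSquare_mul_add_one
      (isSquare_of_isSquare_mul_add_one h1).1
  have hso : Odd s := by
    have := pellU_odd hn
    rw [hs] at this
    exact Nat.Odd.of_mul_left this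
  exact thirtytwo_mul_pow_four_add_one_ne_sq hso (z := z) (by rw [pow_two z, ← hz, hs]; ring)

lemma isSquare_or_of_isSquare_pellU_mul {n p : ℕ} (hp : p.Prime) (hn : 0 < n)
    (h : IsSquare (pellU (n * p))) : IsSquare (pellU n) ∨ ∃ w, pellU n = p * w ^ 2 := by
  obtain ⟨L, hL⟩ := y_mul_dvd one_lt_five n p
  change pellU (n * p) = pellU n * L at hL
  have hU := pellU_pos hn
  have hmod : L ≡ p * pellX n ^ (p - 1) [MOD pellU n ^ 2] := by
    have := (xy_modEq_yn one_lt_five n p).2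
    change pellU (n * p) ≡ p * pellX n ^ (p - 1) * pellU n [MOD pellU n ^ 3] at this
    rw [hL, mul_comm (p * _), pow_succ' _ 2] at this
    exact Nat.ModEq.mul_left_cancel' hU.ne' this
  have hg : (pellU n).gcd L ∣ p := by
    have h1 : (pellU n).gcd L ∣ p * pellX n ^ (p - 1) :=
      ((hmod.of_dvd ((Nat.gcd_dvd_left _ _).trans (dvd_pow_self _ two_ne_zero))).dvd_iff
        dvd_rfl).1 (Nat.gcd_dvd_right _ _)
    refine Nat.Coprime.dvd_of_dvd_mul_right ?_ h1
    exact Nat.Coprime.pow_right _ (Nat.Coprime.coprime_dvd_left (Nat.gcd_dvd_left _ _)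
      (xy_coprime one_lt_five n).symm)
  rcases (Nat.dvd_prime hp).1 hg with h1 | h1
  · exact .inl (isSquare_of_coprime_mul h1 (hL ▸ h))
  · right
    obtain ⟨q, hq⟩ := h
    rw [hL] at hq
    obtain ⟨a, b, hab, ha, hb⟩ := Nat.exists_coprime (pellU n) L
    rw [h1] at ha hb
    obtain ⟨r, rfl⟩ : p ∣ q := by
      apply hp.dvd_of_dvd_pow (n := 2)
      rw [pow_two, ← hq, ha]
      exact (Dvd.intro_left _ rfl).mul_right _
    have : IsSquare (a * b) := by
      refine ⟨r, Nat.eq_of_mul_eq_mul_left (Nat.mul_pos hp.pos hp.pos) ?_⟩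
      rw [ha, hb] at hq
      linarith
    obtain ⟨w, hw⟩ := isSquare_of_coprime_mul hab this
    exact ⟨w, by rw [ha, hw]; ring⟩

lemma eq_one_of_isSquare_pellU {n : ℕ} (hn : Odd n) (h : IsSquare (pellU n)) : n = 1 := by
  obtain ⟨m, rfl⟩ := isSquare_of_isSquare_pellU hn h
  by_contra hm
  obtain ⟨p, hp, hpm⟩ := Nat.exists_prime_and_dvd (n := m) (by rintro rfl; simp at hm)
  have hmo := (Nat.odd_mul.1 hn).1
  have hm0 := hmo.pos
  have hp2 : p ≠ 2 := by rintro rfl; exact (Nat.not_even_iff_odd.2 hmo) (even_iff_two_dvd.2 hpm)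
  by_cases hp3 : p = 3
  · subst hp3
    obtain ⟨r, rfl⟩ := hpm
    have hr := (Nat.odd_mul.1 hmo).2
    exact not_isSquare_pellU_nine_mul (hr.mul hr) (by convert h using 2; ring)
  · have h5 : 5 ≤ p := by
      have := hp.two_le
      have : p ≠ 4 := by rintro rfl; exact absurd hp (by norm_num)
      omega
    obtain ⟨f, k, hk, rfl⟩ := Nat.exists_eq_pow_mul_and_not_dvd hm0.ne' p hp.ne_one
    obtain _ | f := f
    · exact hk (by simpa using hpm)
    have hk2 : ¬ p ∣ k ^ 2 := fun h => hk (hp.dvd_of_dvd_pow h)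
    have e : p ^ (f + 1) * k * (p ^ (f + 1) * k) = p ^ (2 * f + 1) * k ^ 2 * p := by ring
    rw [e] at h hn
    have hodd := (Nat.odd_mul.1 hn).1
    rcases isSquare_or_of_isSquare_pellU_mul hp hodd.pos h with h1 | ⟨w, h1⟩
    · obtain ⟨c, hc⟩ := isSquare_of_isSquare_pellU hodd h1
      have hpc : (p ^ f * k) ^ 2 * p = c * c := by rw [← hc]; ring
      have h2 : IsSquare (p : ℚ) := by
        refine ⟨c / (p ^ f * k), ?_⟩
        have : (p : ℚ) ≠ 0 := by exact_mod_cast hp.ne_zero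
        have : (k : ℚ) ≠ 0 := by
          rintro h
          exact hk (by rw [Nat.cast_eq_zero.1 h]; exact dvd_zero p)
        field_simp
        have : (((p ^ f * k) ^ 2 * p : ℕ) : ℚ) = ((c * c : ℕ) : ℚ) := by rw [hpc]
        push_cast at this
        linear_combination this
      exact hp.prime.not_isSquare (Rat.isSquare_natCast_iff.1 h2)
    · exact pellU_ne_prime_mul_sq hp h5 hk2 hodd h1

lemma eq_one_of_twentyfour {q r : ℕ} (hq : Odd q) (h : r ^ 2 = 24 * q ^ 4 + 1) : q = 1 := by
  obtain ⟨n, -, hn⟩ := eq_pell one_lt_five (x := r) (y := q ^ 2) (by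
    change r * r - 24 * q ^ 2 * q ^ 2 = 1
    rw [← pow_two, h, show 24 * q ^ 2 * q ^ 2 = 24 * q ^ 4 by ring]
    omega)
  have hno : Odd n := by
    have := pellU_mod_four n
    have h2 : Odd (pellU n) := hn.subst (motive := Odd) hq.pow
    rw [Nat.odd_iff] at *
    omega
  have := eq_one_of_isSquare_pellU hno ⟨q, by rw [← pow_two]; exact hn.symm⟩
  rw [this, yn_one] at hn
  simpa using hn

end CubeSum

namespace CubeSum

lemma exists_pow_four_of_mul_eq_thirtynine {x y a : ℕ} (h : x * y = 39 * a ^ 4) (hc : x.Coprime y) :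
    ∃ s t, a = s * t ∧ (x = 39 * s ^ 4 ∧ y = t ^ 4 ∨ x = s ^ 4 ∧ y = 39 * t ^ 4 ∨
      x = 3 * s ^ 4 ∧ y = 13 * t ^ 4 ∨ x = 13 * s ^ 4 ∧ y = 3 * t ^ 4) := by
  have h13 : Nat.Prime 13 := by norm_num
  rw [show 39 * a ^ 4 = 3 * (13 * a ^ 4) by ring] at h
  rcases exists_mul_eq_of_coprime_mul_eq_prime_mul Nat.prime_three h hc with
    ⟨x', rfl, h, hc⟩ | ⟨y', rfl, h, hc⟩ <;>
  rcases exists_mul_eq_of_coprime_mul_eq_prime_mul h13 h hc with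
    ⟨x'', rfl, h, hc⟩ | ⟨y'', rfl, h, hc⟩ <;>
  obtain ⟨s, t, rfl, rfl, rfl⟩ := exists_pow_four_of_coprime h hc <;>
  refine ⟨s, t, rfl, ?_⟩ <;> grind

lemma pow_four_mod_sixteen_eq (d : ℕ) :
    d % 2 = 0 ∧ d ^ 4 % 16 = 0 ∨ d % 2 = 1 ∧ d ^ 4 % 16 = 1 := by
  rcases Nat.even_or_odd' d with ⟨e, rfl | rfl⟩
  · exact .inl ⟨by omega, by rw [show (2 * e) ^ 4 = 16 * e ^ 4 by ring]; omega⟩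
  · exact .inr ⟨by omega, pow_four_mod_sixteen ⟨e, rfl⟩⟩

lemma eq_ten_of_pow_four {P Q : ℕ} (hQ : 0 < Q) (h : P ^ 4 = 39 * Q ^ 4 + 1)
    (ih : ∀ t < P * Q, 0 < t → IsSquare (156 * t ^ 4 + 1) → t = 10) : P * Q = 10 := by
  have hP := pow_four_mod_sixteen_eq P
  have hQ2 := pow_four_mod_sixteen_eq Q
  obtain ⟨R, rfl⟩ : 2 ∣ Q := by omega
  have hPo : P % 2 = 1 := by omega
  obtain ⟨α, β, hα, hβ⟩ : ∃ α β, P ^ 2 + 1 = 2 * α ∧ P ^ 2 = 8 * β + 1 := by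
    obtain ⟨c, rfl⟩ : Odd P := Nat.odd_iff.2 hPo
    obtain ⟨d, hd⟩ := (Nat.even_mul_succ_self c).two_dvd
    exact ⟨4 * d + 1, d, by nlinarith, by nlinarith⟩
  have hαβ : α * β = 39 * R ^ 4 := by
    have h1 : (2 * α) * (8 * β) = 16 * (39 * R ^ 4) := by
      rw [← hα]
      zify at h hβ ⊢
      linear_combination h - (P ^ 2 + 1 : ℤ) * hβ
    linarith
  have h4 : α = 4 * β + 1 := by omega
  have h3 : ¬ 3 ∣ α := by
    rintro ⟨c, rfl⟩
    have : P % 3 = 0 ∨ P % 3 = 1 ∨ P % 3 = 2 := by omega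
    have h9 : P ^ 2 % 3 = 2 := by omega
    rcases this with h | h | h <;> simp [Nat.pow_mod, h] at h9
  have hc : α.Coprime β := by
    rw [h4, mul_comm]; simp
  obtain ⟨s, t, rfl, ⟨h1, h2⟩ | ⟨h1, h2⟩ | ⟨h1, h2⟩ | ⟨h1, h2⟩⟩ :=
    exists_pow_four_of_mul_eq_thirtynine hαβ hc
  · exact absurd ⟨13 * s ^ 4, by rw [h1]; ring⟩ h3
  · exfalso
    have ht0 : 0 < t := Nat.pos_of_ne_zero fun h => by simp [h] at hQ
    have hs0 : 0 < s := Nat.pos_of_ne_zero fun h => by simp [h] at hQ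
    have hP0 : 0 < P := by omega
    have hlt : t < P * (2 * (s * t)) := by
      nlinarith [Nat.mul_pos hP0 hs0, Nat.mul_pos hP0 (Nat.mul_pos hs0 ht0)]
    have h5 : s ^ 4 = 156 * t ^ 4 + 1 := by omega
    have := ih t hlt ht0 ⟨s ^ 2, by rw [← h5]; ring⟩
    subst this
    norm_num at h5
    have : s < 36 := lt_of_pow_lt_pow_left₀ 4 (by norm_num) (by omega)
    have : 35 < s := lt_of_pow_lt_pow_left₀ 4 (by norm_num) (by omega)
    omega
  · exact absurd ⟨s ^ 4, h1⟩ h3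
  · have := pow_four_mod_sixteen_eq s
    have := pow_four_mod_sixteen_eq t
    have ht : Odd t := Nat.odd_iff.2 (by omega)
    have ht1 := eq_one_of_twentyfour (r := P) ht (by omega)
    subst ht1
    have hs : s ^ 4 = 1 := by omega
    have hs1 : s = 1 := by simpa using hs
    have hP5 : P ^ 2 = 5 ^ 2 := by omega
    rw [Nat.pow_left_injective two_ne_zero hP5, hs1]

lemma eq_ten_of_isSquare (a : ℕ) : 0 < a → IsSquare (156 * a ^ 4 + 1) → a = 10 := by
  induction a using Nat.strong_induction_on with
  | _ a ih =>
  rintro ha ⟨b, hb⟩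
  obtain ⟨g, rfl⟩ : Odd b := Nat.Odd.of_mul_left (n := b) (hb ▸ ⟨78 * a ^ 4, by ring⟩)
  have h1 : g * (g + 1) = 39 * a ^ 4 := by linarith
  obtain ⟨s, t, rfl, ⟨h2, h3⟩ | ⟨h2, h3⟩ | ⟨h2, h3⟩ | ⟨h2, h3⟩⟩ :=
    exists_pow_four_of_mul_eq_thirtynine h1 (by simp)
  · rw [mul_comm s t] at *
    exact eq_ten_of_pow_four (Nat.pos_of_mul_pos_left ha) (by omega) ih
  · exfalso
    have h4 : s ^ 4 % 3 = 2 := by omega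
    rcases (by omega : s % 3 = 0 ∨ s % 3 = 1 ∨ s % 3 = 2) with h | h | h <;>
      simp [Nat.pow_mod, h] at h4
  · have := pow_four_mod_sixteen_eq s
    have := pow_four_mod_sixteen_eq t
    omega
  · have := pow_four_mod_sixteen_eq s
    have := pow_four_mod_sixteen_eq t
    omega

end CubeSum

namespace CubeSum

lemma exists_eq_mul_sq {m y : ℕ} (hy : 25 * m * (m ^ 2 + 156) = y ^ 2) :
    ∃ s ∈ [1, 2, 3, 6, 13, 26, 39, 78], ∃ t, m = s * t ^ 2 := by
  have key : ∀ c ∈ shapes, ∃ s ∈ [1, 2, 3, 6, 13, 26, 39, 78],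
      ∃ R ∈ [1, 2, 3, 6, 13, 26, 39, 78, 5, 10, 15, 30, 65, 130, 195, 390],
      R ∣ 390 ∧ R ∣ c.2 ∧ c.2.Coprime c.1 ∧ 0 < c.2 ∧ c.2 * s = c.1 * R ^ 2 := by decide +kernel
  obtain ⟨c, hc, u, v, hu, -⟩ := exists_shape hy
  obtain ⟨s, hs, R, -, hR, hRc, hcop, hpos, e⟩ := key c hc
  have h390 : Squarefree 390 := by decide +kernel
  have hd : R ∣ u :=
    ((h390.squarefree_of_dvd hR).dvd_pow_iff_dvd two_ne_zero).1
      (hRc.trans (hcop.dvd_of_dvd_mul_left (hu ▸ dvd_mul_right _ _)))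
  obtain ⟨t, rfl⟩ := hd
  refine ⟨s, hs, t, Nat.eq_of_mul_eq_mul_left hpos ?_⟩
  rw [hu, ← mul_assoc, e]
  ring

lemma quartic_mod_nine : ∀ t b : ZMod 9, 2 * t ^ 4 + 78 ≠ b ^ 2 ∧ 26 * t ^ 4 + 6 ≠ b ^ 2 := by
  decide +kernel

lemma quartic_mod_three : ∀ t b : ZMod 3, 6 * t ^ 4 + 26 ≠ b ^ 2 ∧ 78 * t ^ 4 + 2 ≠ b ^ 2 := by
  decide +kernel

lemma sq_mod_sixteen (b : ℕ) :
    b ^ 2 % 16 = 0 ∨ b ^ 2 % 16 = 1 ∨ b ^ 2 % 16 = 4 ∨ b ^ 2 % 16 = 9 := by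
  have h16 := Nat.mod_lt b (show 0 < 16 by norm_num)
  rw [Nat.pow_mod]
  interval_cases b % 16 <;> simp

lemma exists_mul_sq_eq {s t z : ℕ} (hs : s ∣ 78) (hz : 25 * s * (s ^ 2 * t ^ 4 + 156) = z ^ 2) :
    ∃ b, s ^ 2 * t ^ 4 + 156 = s * b ^ 2 := by
  have h78 : Squarefree 78 := by decide +kernel
  obtain ⟨w, rfl⟩ : 5 ∣ z := Nat.Prime.dvd_of_dvd_pow (by norm_num) (n := 2)
    ⟨5 * s * (s ^ 2 * t ^ 4 + 156), by rw [← hz]; ring⟩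
  have hw : s * (s ^ 2 * t ^ 4 + 156) = w ^ 2 := by linarith
  obtain ⟨b, rfl⟩ : s ∣ w :=
    ((h78.squarefree_of_dvd hs).dvd_pow_iff_dvd two_ne_zero).1 (Dvd.intro _ hw)
  exact ⟨b, Nat.eq_of_mul_eq_mul_left (Nat.pos_of_dvd_of_pos hs (by norm_num)) (by rw [hw]; ring)⟩

lemma eq_of_eq_sq {m y : ℕ} (hm : 14 ≤ m) (hy : 25 * m * (m ^ 2 + 156) = y ^ 2) : m = 15600 := by
  obtain ⟨s, hs, t, rfl⟩ := exists_eq_mul_sq hy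
  have ht : 0 < t := Nat.pos_of_ne_zero fun h => by simp [h] at hm
  obtain ⟨z, rfl⟩ : t ∣ y := (Nat.pow_dvd_pow_iff two_ne_zero).1
    ⟨25 * s * ((s * t ^ 2) ^ 2 + 156), by rw [← hy]; ring⟩
  have hz : 25 * s * (s ^ 2 * t ^ 4 + 156) = z ^ 2 := by
    refine Nat.eq_of_mul_eq_mul_left (pow_pos ht 2) ?_
    rw [← mul_pow, ← hy]
    ring
  have key : ∀ s ∈ [1, 2, 3, 6, 13, 26, 39, 78], s ∣ 78 := by decide
  obtain ⟨b, hb⟩ := exists_mul_sq_eq (key s hs) hz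
  have h9 {a b : ℕ} (h : a = b) : (a : ZMod 9) = b := by rw [h]
  have h3 {a b : ℕ} (h : a = b) : (a : ZMod 3) = b := by rw [h]
  have ht16 := pow_four_mod_sixteen_eq t
  have hb16 := sq_mod_sixteen b
  have hbo : b % 2 = 0 ∧ b ^ 2 % 2 = 0 ∨ b % 2 = 1 ∧ b ^ 2 % 2 = 1 := by
    rcases Nat.mod_two_eq_zero_or_one b with h | h <;> simp [Nat.pow_mod, h]
  simp only [List.mem_cons, List.not_mem_nil, or_false] at hs
  rcases hs with rfl | rfl | rfl | rfl | rfl | rfl | rfl | rfl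
  · omega
  · have h : 2 * t ^ 4 + 78 = b ^ 2 := by linarith
    exact absurd (by exact_mod_cast h9 h) (quartic_mod_nine t b).1
  · have h : 3 * t ^ 4 + 52 = b ^ 2 := by linarith
    obtain ⟨c, rfl⟩ : 2 ∣ t := by omega
    obtain ⟨d, rfl⟩ : 2 ∣ b := by omega
    have := eq_one_of_twelve (c := c) (d := d) (by omega) (by linarith)
    subst this
    omega
  · have h : 6 * t ^ 4 + 26 = b ^ 2 := by linarith
    exact absurd (by exact_mod_cast h3 h) (quartic_mod_three t b).1
  · have := eq_one_of_thirteen (t := t) (b := b) ht (by linarith)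
    subst this
    omega
  · have h : 26 * t ^ 4 + 6 = b ^ 2 := by linarith
    exact absurd (by exact_mod_cast h9 h) (quartic_mod_nine t b).2
  · have h : 39 * t ^ 4 + 4 = b ^ 2 := by linarith
    obtain ⟨a, rfl⟩ : 2 ∣ t := by omega
    obtain ⟨d, rfl⟩ : 2 ∣ b := by omega
    have := eq_ten_of_isSquare a (by omega) ⟨d, by linarith⟩
    subst this
    rfl
  · have h : 78 * t ^ 4 + 2 = b ^ 2 := by linarith
    exact absurd (by exact_mod_cast h3 h) (quartic_mod_three t b).2

end CubeSum

namespace CubeSum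

lemma eq_eighteen_of_eq_pow {ℓ m y : ℕ} (hℓ : ℓ.Prime) (h2 : ℓ ≠ 2) (hm : 14 ≤ m)
    (hy : 25 * m * (m ^ 2 + 156) = y ^ ℓ) : ℓ = 3 ∧ m = 18 := by
  by_cases h3 : ℓ = 3
  · subst h3
    exact ⟨rfl, eq_of_eq_cube (by omega) hy⟩
  exfalso
  have h5 : 5 ≤ ℓ := by
    have := hℓ.two_le
    have : ℓ ≠ 4 := by rintro rfl; exact absurd hℓ (by norm_num)
    omega
  obtain ⟨c, hc, u, v, hu, hv⟩ := exists_shape hy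
  rcases mem_shapes_iff.1 hc with rfl | hc
  · have := eq_zero_of_trivial_shape (hℓ.odd_of_ne_two h2) (by omega) (hu.trans (one_mul _)) hv
    omega
  · have heq := shape_equation hu hv
    rcases le_or_gt 18400 ℓ with h | h
    · exact impossible_of_ge h hc (by omega) hu hv
    rcases le_or_gt 7 ℓ with h7 | h7
    · exact impossible_of_lt hℓ h7 h hc u v heq
    have h6 : ℓ ≠ 6 := by rintro rfl; exact absurd hℓ (by norm_num)
    obtain rfl : ℓ = 5 := by omega
    rcases impossible_of_eq_five hc u v heq with rfl | rfl | rfl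
    · exact impossible_one_four (hu.trans (one_mul _)) hv
    · exact impossible_one_thirtynine (hu.trans (one_mul _)) hv
    · exact impossible_two_three hu hv

lemma sum_cubes_eq (x : ℤ) : ∑ i ∈ Finset.range 25, (x + (i : ℤ) + 1) ^ 3 =
    25 * (x + 13) * ((x + 13) ^ 2 + 156) := by
  simp only [Finset.sum_range_succ, Finset.sum_range_zero]
  push_cast
  ring

end CubeSum

/-- The only solutions in integers `x ≥ 1`, `y` to
`(x+1)³ + (x+2)³ + ⋯ + (x+25)³ = yˡ` with `ℓ` prime are
`(x, y, ℓ) = (15587, ±9742200, 2)` and `(5, 60, 3)`. -/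
theorem sum_twentyfive_consecutive_cubes_perfect_power (ℓ : ℕ) (hℓ : ℓ.Prime)
    (x y : ℤ) (hx : 1 ≤ x) :
    (∑ i ∈ Finset.range 25, (x + (i : ℤ) + 1) ^ 3) = y ^ ℓ ↔
      (x = 15587 ∧ y = 9742200 ∧ ℓ = 2) ∨ (x = 15587 ∧ y = -9742200 ∧ ℓ = 2) ∨
        (x = 5 ∧ y = 60 ∧ ℓ = 3) := by
  rw [CubeSum.sum_cubes_eq]
  constructor
  · intro h
    obtain ⟨m, hm⟩ : ∃ m : ℕ, (m : ℤ) = x + 13 := ⟨(x + 13).toNat, Int.toNat_of_nonneg (by omega)⟩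
    rw [← hm] at h
    by_cases h2 : ℓ = 2
    · subst h2
      have h' : 25 * m * (m ^ 2 + 156) = y.natAbs ^ 2 := by
        zify
        rw [sq_abs]
        exact h
      have hm' := CubeSum.eq_of_eq_sq (by omega) h'
      subst hm'
      have hsq : y ^ 2 = 9742200 ^ 2 := by rw [← h]; norm_num
      rcases sq_eq_sq_iff_eq_or_eq_neg.1 hsq with hy | hy
      · exact .inl ⟨by omega, hy, rfl⟩
      · exact .inr (.inl ⟨by omega, hy, rfl⟩)
    · have hy0 : 0 < y := by
        have hm0 : (0 : ℤ) < m := by omega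
        exact (hℓ.odd_of_ne_two h2).pow_pos_iff.1 (h ▸ by positivity)
      lift y to ℕ using hy0.le
      have h' : 25 * m * (m ^ 2 + 156) = y ^ ℓ := by exact_mod_cast h
      obtain ⟨rfl, rfl⟩ := CubeSum.eq_eighteen_of_eq_pow hℓ h2 (by omega) h'
      have hy : y ^ 3 = 60 ^ 3 := by rw [← h']; norm_num
      have := Nat.pow_left_injective three_ne_zero hy
      subst this
      exact .inr (.inr ⟨by omega, rfl, rfl⟩)
  · rintro (⟨rfl, rfl, rfl⟩ | ⟨rfl, rfl, rfl⟩ | ⟨rfl, rfl, rfl⟩) <;> norm_num
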